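/- Fix t ∈ (0,1/4) and set k = 4t. Let α, β₋, β₊ ∈ (π/2)ℤ with β₋ < 0 ≤ α < β₊. For all integers l,p ≥ 1, the sum over walks defining W^{(α,(β₋,β₊))}_{l,p}(t) converges, and W^{(α,(β₋,β₊))}_{l,p}(t) = Σ_{m=1}^∞ λ_m · 4·l·p·a_{l,m}·a_{p,m} / (m·(q_k^{−m} − q_k^{m})), where λ_m = (2K(k)/π) · (q_k^{2mβ₋/π} − 1)/(m·q_k^{mα/π}) · (q_k^{2mα/π} − q_k^{2mβ₊/π})/(q_k^{2mβ₋/π} − q_k^{2mβ₊/π}), the series converging absolutely. -/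

import Mathlib

open Complex Real Set

noncomputable section

/-- A lattice point `(x,y)` viewed as the complex number `x + iy`. -/
def ptC (p : ℤ × ℤ) : ℂ := (p.1 : ℂ) + (p.2 : ℂ) * Complex.I

/-- A diagonal step on `ℤ²`. -/
def IsDiagStep (a b : ℤ × ℤ) : Prop :=
  b - a = (1, 1) ∨ b - a = (1, -1) ∨ b - a = (-1, -1) ∨ b - a = (-1, 1)

/-- A rectilinear step on `ℤ²`. -/
def IsRectStep (a b : ℤ × ℤ) : Prop :=
  b - a = (1, 0) ∨ b - a = (-1, 0) ∨ b - a = (0, 1) ∨ b - a = (0, -1)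

/-- `w` encodes a simple diagonal walk `(w₀, …, w_n)` as a list of length `n+1`. -/
def IsWalkList (w : List (ℤ × ℤ)) : Prop := w ≠ [] ∧ w.Chain' IsDiagStep

/-- Winding angle of the walk `w` around the origin up to time `i`. -/
def windTo (w : List (ℤ × ℤ)) (i : ℕ) : ℝ :=
  ∑ j ∈ Finset.range i, (ptC (w.getD (j + 1) 0) / ptC (w.getD j 0)).arg

/-- The full winding angle of the walk `w` around the origin. -/
def wind (w : List (ℤ × ℤ)) : ℝ := windTo w (w.length - 1)

/-- The condition on walks counted by `W^{(α,I)}_{l,p}`: a simple diagonal walk on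
`ℤ² ∖ {0}` from `(p,0)` to a point on one of the axes at distance `l` from the origin,
with full winding angle `α` and intermediate winding angles in `I`. -/
def WCond (l p : ℕ) (α : ℝ) (I : Set ℝ) (w : List (ℤ × ℤ)) : Prop :=
  IsWalkList w ∧ (∀ x ∈ w, x ≠ (0, 0)) ∧ w.head? = some ((p : ℤ), 0) ∧
    (w.getLast? = some ((l : ℤ), 0) ∨ w.getLast? = some (-(l : ℤ), 0) ∨
      w.getLast? = some (0, (l : ℤ)) ∨ w.getLast? = some (0, -(l : ℤ))) ∧
    wind w = α ∧ (∀ i, 1 ≤ i → i ≤ w.length - 2 → windTo w i ∈ I)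

/-- The generating function `W^{(α,I)}_{l,p}(t)`. -/
def Wgen (t : ℝ) (l p : ℕ) (α : ℝ) (I : Set ℝ) : ℝ :=
  ∑' w : {w : List (ℤ × ℤ) // WCond l p α I w}, t ^ (w.val.length - 1)

/-- The complete elliptic integral of the first kind `K(k)`. -/
def Kell (k : ℝ) : ℝ := ∫ y in (0:ℝ)..1, 1 / Real.sqrt ((1 - y ^ 2) * (1 - k ^ 2 * y ^ 2))

/-- The complete elliptic integral of the second kind `E(k)`. -/
def Eell (k : ℝ) : ℝ := ∫ y in (0:ℝ)..1, Real.sqrt (1 - k ^ 2 * y ^ 2) / Real.sqrt (1 - y ^ 2)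

/-- The complementary modulus `k' = √(1-k²)`. -/
def kComp (k : ℝ) : ℝ := Real.sqrt (1 - k ^ 2)

/-- The elliptic nome `q_k = exp(-π K(k')/K(k))`. -/
def qNome (k : ℝ) : ℝ := Real.exp (-π * Kell (kComp k) / Kell k)

/-- The descending Landen transformation `k₁ = (1-k')/(1+k')`. -/
def kLanden (k : ℝ) : ℝ := (1 - kComp k) / (1 + kComp k)

/-- `T_k = K(k')/(4K(k))`. -/
def Tell (k : ℝ) : ℝ := Kell (kComp k) / (4 * Kell k)

/-- The plane minus the two real slits `{z ∈ ℝ : z² ≥ κ}`. -/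
def slitDom (κ : ℝ) : Set ℂ := {z : ℂ | ¬(z.im = 0 ∧ κ ≤ z.re ^ 2)}

/-- `v` is the analytic function `v_κ` on `ℂ ∖ {z ∈ ℝ : z² ≥ κ}` with `v 0 = 0` and
`v'(z) = 1/(4K(κ)√((κ-z²)(1-κz²)))`, the branch of the square root being positive on
`(-√κ, √κ)` (by analytic continuation this determines `v` uniquely). -/
structure IsVmap (κ : ℝ) (v : ℂ → ℂ) : Prop where
  map_zero : v 0 = 0
  analytic : AnalyticOnNhd ℂ v (slitDom κ)
  deriv_real : ∀ x : ℝ, x ^ 2 < κ →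
    HasDerivAt v ((1 / (4 * Kell κ * Real.sqrt ((κ - x ^ 2) * (1 - κ * x ^ 2))) : ℝ) : ℂ)
      (x : ℂ)

/-- The function `f_m(z) = cos(2πm(v(z) + 1/4)) - cos(πm/2)` built from `v = v_{k₁}`. -/
def fmFun (v : ℂ → ℂ) (m : ℕ) (z : ℂ) : ℂ :=
  Complex.cos (2 * (π : ℂ) * m * (v z + 1 / 4)) - Complex.cos ((π : ℂ) * m / 2)

/-- `a n m` is the (real) Taylor coefficient `[zⁿ] f_m(z)` at `0`. -/
def IsCoeff (κ : ℝ) (v : ℂ → ℂ) (a : ℕ → ℕ → ℝ) : Prop :=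
  ∀ m : ℕ, 1 ≤ m → ∀ z : ℂ, z ∈ slitDom κ → ‖z‖ < 1 →
    HasSum (fun n : ℕ => (a n m : ℂ) * z ^ n) (fmFun v m z)

/-- An excursion: a nonempty simple diagonal walk from the origin to the origin with no
intermediate visits to the origin. -/
def IsExcursion (w : List (ℤ × ℤ)) : Prop :=
  2 ≤ w.length ∧ w.Chain' IsDiagStep ∧ w.head? = some (0, 0) ∧ w.getLast? = some (0, 0) ∧
    ∀ i, 1 ≤ i → i ≤ w.length - 2 → w.getD i 0 ≠ (0, 0)

/-- The winding angle sequence of an excursion: `θ₀ = θ₁ = 0`, increments of the first and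
last step do not contribute, and `θ_n = θ_{n-1}`. -/
def windExcTo (w : List (ℤ × ℤ)) (i : ℕ) : ℝ :=
  ∑ j ∈ Finset.Icc 2 (min i (w.length - 2)), (ptC (w.getD j 0) / ptC (w.getD (j - 1) 0)).arg

/-- The full winding angle of an excursion. -/
def windExc (w : List (ℤ × ℤ)) : ℝ := windExcTo w (w.length - 1)

/-- `F^{(α)}(t)`: generating function of excursions with winding angle `α`. -/
def Fgen (t α : ℝ) : ℝ :=
  ∑' w : {w : List (ℤ × ℤ) // IsExcursion w ∧ windExc w = α}, t ^ (w.val.length - 1)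

/-- `F(t,b) = Σ_w t^{|w|} e^{i b θ^w}`, the characteristic function of excursions. -/
def Fchar (t b : ℝ) : ℂ :=
  ∑' w : {w : List (ℤ × ℤ) // IsExcursion w},
    (t : ℂ) ^ (w.val.length - 1) * Complex.exp (Complex.I * b * windExc w.val)

/-- `ψ_k(z) = (1 - √(1-kz²))/(√k z)` (principal square root), `ψ_k(0) = 0`. -/
def psiK (k : ℝ) (z : ℂ) : ℂ :=
  if z = 0 then 0 else (1 - (1 - (k : ℂ) * z ^ 2) ^ ((1 : ℂ) / 2)) / ((Real.sqrt k : ℂ) * z)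

/-- The four diagonal steps. -/
def diagSteps : Finset (ℤ × ℤ) := {(1, 1), (1, -1), (-1, -1), (-1, 1)}

lemma sum_diagSteps {M : Type*} [AddCommMonoid M] (f : ℤ × ℤ → M) :
    ∑ d ∈ diagSteps, f d = f (1, 1) + (f (1, -1) + (f (-1, -1) + f (-1, 1))) := by
  simp [diagSteps]

lemma mem_diagSteps {d : ℤ × ℤ} :
    d ∈ diagSteps ↔ d = (1, 1) ∨ d = (1, -1) ∨ d = (-1, -1) ∨ d = (-1, 1) := by
  simp [diagSteps]

lemma isDiagStep_iff {a b : ℤ × ℤ} : IsDiagStep a b ↔ b - a ∈ diagSteps := by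
  rw [mem_diagSteps, IsDiagStep]

/-- Rotation of the lattice by a right angle. -/
def rotZ : Equiv.Perm (ℤ × ℤ) where
  toFun p := (-p.2, p.1)
  invFun p := (p.2, -p.1)
  left_inv p := by simp
  right_inv p := by simp

lemma rotZ_apply (p : ℤ × ℤ) : rotZ p = (-p.2, p.1) := rfl

lemma rotZ_inv_apply (p : ℤ × ℤ) : rotZ⁻¹ p = (p.2, -p.1) := rfl

lemma rotZ_zpow_add (c : ℤ) (p q : ℤ × ℤ) :
    (rotZ ^ c) (p + q) = (rotZ ^ c) p + (rotZ ^ c) q := by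
  induction c using Int.induction_on generalizing p q with
  | zero => simp
  | succ i ih =>
    simp only [zpow_add_one, Equiv.Perm.mul_apply]
    rw [← ih]; congr 1; ext <;> simp [rotZ_apply]; ring
  | pred i ih =>
    simp only [zpow_sub_one, Equiv.Perm.mul_apply]
    rw [← ih]; congr 1; ext <;> simp [rotZ_inv_apply]; ring

lemma ptC_rotZ (p : ℤ × ℤ) : ptC (rotZ p) = Complex.I * ptC p := by
  simp only [ptC, rotZ_apply]; push_cast; linear_combination (-(p.2 : ℂ)) * Complex.I_mul_I

lemma ptC_rotZ_inv (p : ℤ × ℤ) : ptC (rotZ⁻¹ p) = Complex.I⁻¹ * ptC p := by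
  rw [Complex.inv_I]; simp only [ptC, rotZ_inv_apply]; push_cast
  linear_combination (p.2 : ℂ) * Complex.I_mul_I

lemma ptC_rotZ_zpow (c : ℤ) (p : ℤ × ℤ) : ptC ((rotZ ^ c) p) = Complex.I ^ c * ptC p := by
  induction c using Int.induction_on generalizing p with
  | zero => simp
  | succ i ih =>
    rw [zpow_add_one, Equiv.Perm.mul_apply, ih, ptC_rotZ, zpow_add_one₀ Complex.I_ne_zero]; ring
  | pred i ih =>
    rw [zpow_sub_one, Equiv.Perm.mul_apply, ih, ptC_rotZ_inv, zpow_sub_one₀ Complex.I_ne_zero]; ring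

lemma sum_diagSteps_rotZ (c : ℤ) (f : ℤ × ℤ → ℝ) :
    ∑ d ∈ diagSteps, f ((rotZ ^ c) d) = ∑ d ∈ diagSteps, f d := by
  induction c using Int.induction_on generalizing f with
  | zero => simp
  | succ i ih =>
    rw [← ih f]
    simp only [zpow_add_one, Equiv.Perm.mul_apply]
    simp only [sum_diagSteps, rotZ_apply, neg_neg]; ring
  | pred i ih =>
    rw [← ih f]
    simp only [zpow_sub_one, Equiv.Perm.mul_apply]
    simp only [sum_diagSteps, rotZ_inv_apply, neg_neg]; ring

lemma ptC_eq_zero {p : ℤ × ℤ} : ptC p = 0 ↔ p = 0 := by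
  constructor
  · intro h
    have h1 := congrArg Complex.re h
    have h2 := congrArg Complex.im h
    simp [ptC] at h1 h2
    ext <;> simp [h1, h2]
  · rintro rfl; simp [ptC]

lemma ptC_re (p : ℤ × ℤ) : (ptC p).re = p.1 := by simp [ptC]
lemma ptC_im (p : ℤ × ℤ) : (ptC p).im = p.2 := by simp [ptC]

/-- The winding angle of the point with coordinates `p` in the chart number `c`. -/
def chartAngle (c : ℤ) (p : ℤ × ℤ) : ℝ := c * (π / 2) + (ptC p).arg

lemma arg_rotZ_div (c : ℤ) {p p' : ℤ × ℤ} (hp : 1 ≤ p.1) (hp' : 0 ≤ p'.1) (hp0 : p' ≠ 0) :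
    (ptC ((rotZ ^ c) p') / ptC ((rotZ ^ c) p)).arg = (ptC p').arg - (ptC p).arg := by
  have h0 : ptC p ≠ 0 := by
    rw [Ne, ptC_eq_zero]; rintro rfl; simp at hp
  have h0' : ptC p' ≠ 0 := by rwa [Ne, ptC_eq_zero]
  rw [ptC_rotZ_zpow, ptC_rotZ_zpow, mul_div_mul_left _ _ (zpow_ne_zero _ Complex.I_ne_zero),
    div_eq_mul_inv]
  have hre : 0 < (ptC p).re := by rw [ptC_re]; exact_mod_cast hp
  have h1 : |(ptC p).arg| < π / 2 := by
    rw [Complex.abs_arg_lt_pi_div_two_iff]; exact Or.inl hre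
  have h2 : |(ptC p').arg| ≤ π / 2 := by
    rw [Complex.abs_arg_le_pi_div_two_iff, ptC_re]; exact_mod_cast hp'
  rw [abs_lt] at h1
  rw [abs_le] at h2
  have h3 : (ptC p)⁻¹.arg = -(ptC p).arg := by
    rw [Complex.arg_inv, if_neg]; intro h; linarith [Real.pi_pos]
  rw [Complex.arg_mul h0' (inv_ne_zero h0), h3]; · ring
  rw [h3]; constructor <;> linarith

lemma chartAngle_add_step (c : ℤ) {p p' : ℤ × ℤ} (hp : 1 ≤ p.1) (hp' : 0 ≤ p'.1)
    (hp0 : p' ≠ 0) :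
    chartAngle c p + (ptC ((rotZ ^ c) p') / ptC ((rotZ ^ c) p)).arg = chartAngle c p' := by
  rw [arg_rotZ_div c hp hp' hp0, chartAngle, chartAngle]; ring

lemma chartAngle_zero_pos (c : ℤ) {y : ℤ} (hy : 1 ≤ y) :
    chartAngle c (0, y) = chartAngle (c + 1) (y, 0) := by
  have h1 : ptC (0, y) = ((y : ℝ) : ℂ) * Complex.I := by simp [ptC]
  have h2 : ptC (y, 0) = ((y : ℝ) : ℂ) := by simp [ptC]
  have hy' : (0 : ℝ) < y := by exact_mod_cast hy
  rw [chartAngle, chartAngle, h1, h2, Complex.arg_real_mul _ hy', Complex.arg_I,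
    Complex.arg_ofReal_of_nonneg hy'.le]; push_cast; ring

lemma rotZ_zpow_zero_pos (c y : ℤ) : (rotZ ^ c) (0, y) = (rotZ ^ (c + 1)) (y, 0) := by
  rw [zpow_add_one, Equiv.Perm.mul_apply, rotZ_apply]; simp

lemma chartAngle_neg (c : ℤ) {x y : ℤ} (hx : 0 ≤ x) (hy : 1 ≤ y) :
    chartAngle c (x, -y) = chartAngle (c - 1) (y, x) := by
  have h1 : ptC (x, -y) = ptC (y, x) / Complex.I := by
    rw [Complex.div_I]; simp only [ptC]; push_cast
    linear_combination ((x : ℂ)) * Complex.I_mul_I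
  have h0 : ptC (y, x) ≠ 0 := by
    rw [Ne, ptC_eq_zero]; intro h; have := congrArg Prod.fst h; simp at this; omega
  have h2 : |(ptC (y, x)).arg| ≤ π / 2 := by
    rw [Complex.abs_arg_le_pi_div_two_iff, ptC_re]; exact_mod_cast (by omega : 0 ≤ y)
  have h3 : 0 ≤ (ptC (y, x)).arg := by
    rw [Complex.arg_nonneg_iff, ptC_im]; exact_mod_cast hx
  rw [abs_le] at h2
  rw [chartAngle, chartAngle, h1, div_eq_mul_inv (ptC (y, x)), Complex.inv_I,
    Complex.arg_mul h0 (neg_ne_zero.2 Complex.I_ne_zero), Complex.arg_neg_I]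
  · push_cast; ring
  · rw [Complex.arg_neg_I]; constructor <;> linarith [Real.pi_pos]

lemma rotZ_zpow_neg (c x y : ℤ) : (rotZ ^ c) (x, -y) = (rotZ ^ (c - 1)) (y, x) := by
  rw [zpow_sub_one, Equiv.Perm.mul_apply, rotZ_inv_apply]

lemma arg_ptC_nonneg {p : ℤ × ℤ} (hy : 0 ≤ p.2) : 0 ≤ (ptC p).arg := by
  rw [Complex.arg_nonneg_iff, ptC_im]; exact_mod_cast hy

lemma arg_ptC_lt {p : ℤ × ℤ} (hx : 1 ≤ p.1) : (ptC p).arg < π / 2 := by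
  have : |(ptC p).arg| < π / 2 := by
    rw [Complex.abs_arg_lt_pi_div_two_iff, ptC_re]; left; exact_mod_cast hx
  exact (abs_lt.1 this).2

lemma arg_ptC_eq_zero {p : ℤ × ℤ} (hx : 1 ≤ p.1) : (ptC p).arg = 0 ↔ p.2 = 0 := by
  rw [Complex.arg_eq_zero_iff, ptC_re, ptC_im]
  constructor
  · intro h; exact_mod_cast h.2
  · intro h; exact ⟨by exact_mod_cast (by omega : 0 ≤ p.1), by exact_mod_cast h⟩

lemma lt_chartAngle_iff {c j : ℤ} {p : ℤ × ℤ} (hx : 1 ≤ p.1) (hy : 0 ≤ p.2) :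
    π / 2 * j < chartAngle c p ↔ j < c ∨ (j = c ∧ 1 ≤ p.2) := by
  have h1 := arg_ptC_nonneg hy
  have h2 := arg_ptC_lt hx
  have h3 := arg_ptC_eq_zero hx
  have hpi := Real.pi_pos
  rw [chartAngle]
  rcases lt_trichotomy j c with h | h | h
  · simp only [h, true_or, iff_true]
    have : (j : ℝ) + 1 ≤ c := by exact_mod_cast h
    nlinarith
  · subst h
    simp only [lt_irrefl, true_and, false_or]
    constructor
    · intro h
      by_contra h4
      have : p.2 = 0 := by omega
      rw [h3.2 this] at h; linarith
    · intro h
      have : (ptC p).arg ≠ 0 := by rw [Ne, h3]; omega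
      have := lt_of_le_of_ne h1 (Ne.symm this)
      linarith
  · have h5 : ¬ (j < c ∨ (j = c ∧ 1 ≤ p.2)) := by omega
    simp only [h5, iff_false, not_lt]
    have : (c : ℝ) + 1 ≤ j := by exact_mod_cast h
    nlinarith

lemma chartAngle_lt_iff {c j : ℤ} {p : ℤ × ℤ} (hx : 1 ≤ p.1) (hy : 0 ≤ p.2) :
    chartAngle c p < π / 2 * j ↔ c < j := by
  have h1 := arg_ptC_nonneg hy
  have h2 := arg_ptC_lt hx
  have hpi := Real.pi_pos
  rw [chartAngle]
  constructor
  · intro h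
    by_contra h4
    have : (j : ℝ) ≤ c := by exact_mod_cast (not_lt.1 h4)
    nlinarith
  · intro h
    have : (c : ℝ) + 1 ≤ j := by exact_mod_cast h
    nlinarith

lemma chartAngle_eq_iff {c j : ℤ} {p : ℤ × ℤ} (hx : 1 ≤ p.1) (hy : 0 ≤ p.2) :
    chartAngle c p = π / 2 * j ↔ c = j ∧ p.2 = 0 := by
  have h1 := lt_chartAngle_iff (c := c) (j := j) hx hy
  have h2 := chartAngle_lt_iff (c := c) (j := j) hx hy
  constructor
  · intro h
    have h3 : ¬ (π / 2 * j < chartAngle c p) := by rw [h]; exact lt_irrefl _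
    have h4 : ¬ (chartAngle c p < π / 2 * j) := by rw [h]; exact lt_irrefl _
    rw [h1] at h3; rw [h2] at h4
    omega
  · rintro ⟨rfl, h⟩
    rw [chartAngle, (arg_ptC_eq_zero hx).2 h]; ring

/-- The point `z` lies on an axis at distance `l` from the origin. -/
def OnAxis (l : ℕ) (z : ℤ × ℤ) : Prop :=
  z = ((l : ℤ), 0) ∨ z = (-(l : ℤ), 0) ∨ z = (0, (l : ℤ)) ∨ z = (0, -(l : ℤ))

lemma onAxis_rotZ (l : ℕ) (c : ℤ) (z : ℤ × ℤ) : OnAxis l ((rotZ ^ c) z) ↔ OnAxis l z := by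
  have key : ∀ z, OnAxis l (rotZ z) ↔ OnAxis l z := by
    rintro ⟨x, y⟩; simp only [OnAxis, rotZ_apply, Prod.mk.injEq]; omega
  have key' : ∀ z, OnAxis l (rotZ⁻¹ z) ↔ OnAxis l z := by
    rintro ⟨x, y⟩; simp only [OnAxis, rotZ_inv_apply, Prod.mk.injEq]; omega
  induction c using Int.induction_on generalizing z with
  | zero => simp
  | succ i ih => rw [zpow_add_one, Equiv.Perm.mul_apply]; exact (ih _).trans (key _)
  | pred i ih => rw [zpow_sub_one, Equiv.Perm.mul_apply]; exact (ih _).trans (key' _)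

lemma target_iff {l : ℕ} {c j : ℤ} {p : ℤ × ℤ} (hx : 1 ≤ p.1) (hy : 0 ≤ p.2) :
    OnAxis l ((rotZ ^ c) p) ∧ chartAngle c p = π / 2 * j ↔ c = j ∧ p = ((l : ℤ), 0) := by
  rw [onAxis_rotZ, chartAngle_eq_iff hx hy]
  obtain ⟨x, y⟩ := p
  simp only [OnAxis, Prod.mk.injEq] at *
  have hl : (0 : ℤ) ≤ l := Int.natCast_nonneg l
  omega

open Classical in
/-- The finite set of walks of length `n` started at `z` with initial winding angle `θ`, whose
later positions satisfy `ok` and whose final position satisfies `T`. -/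
def walkSet (T ok : ℤ × ℤ → ℝ → Prop) : ℕ → ℤ × ℤ → ℝ → Finset (List (ℤ × ℤ))
  | 0, z, θ => if T z θ then {[z]} else ∅
  | n + 1, z, θ => diagSteps.biUnion fun d =>
      if ok (z + d) (θ + (ptC (z + d) / ptC z).arg) then
        (walkSet T ok n (z + d) (θ + (ptC (z + d) / ptC z).arg)).map
          ⟨List.cons z, List.cons_injective⟩
      else ∅

lemma windTo_cons_succ (z : ℤ × ℤ) (w : List (ℤ × ℤ)) (i : ℕ) :
    windTo (z :: w) (i + 1) = (ptC (w.getD 0 0) / ptC z).arg + windTo w i := by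
  rw [windTo, Finset.sum_range_succ', add_comm]; simp [windTo]

lemma windTo_zero (w : List (ℤ × ℤ)) : windTo w 0 = 0 := by simp [windTo]

lemma mem_walkSet (T ok : ℤ × ℤ → ℝ → Prop) (n : ℕ) (z : ℤ × ℤ) (θ : ℝ) (w : List (ℤ × ℤ)) :
    w ∈ walkSet T ok n z θ ↔ w.length = n + 1 ∧ w.IsChain IsDiagStep ∧ w.getD 0 0 = z ∧
      (∀ i, 1 ≤ i → i ≤ n → ok (w.getD i 0) (θ + windTo w i)) ∧
      T (w.getD n 0) (θ + windTo w n) := by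
  induction n generalizing z θ w with
  | zero =>
    rw [walkSet]
    constructor
    · intro h
      split_ifs at h with hT
      · rw [Finset.mem_singleton] at h; subst h
        refine ⟨rfl, by simp, rfl, ?_, by simpa [windTo_zero] using hT⟩
        intro i h1 h2; omega
      · simp at h
    · rintro ⟨h1, -, h2, -, h3⟩
      rw [windTo_zero, add_zero, h2] at h3
      rw [if_pos h3, Finset.mem_singleton]
      match w, h1 with
      | [a], _ => simpa using h2
  | succ n ih =>
    rw [walkSet, Finset.mem_biUnion]
    constructor
    · rintro ⟨d, hd, h⟩
      split_ifs at h with hok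
      · rw [Finset.mem_map] at h
        obtain ⟨w', hw', rfl⟩ := h
        rw [ih] at hw'
        obtain ⟨h1, h2, h3, h4, h5⟩ := hw'
        simp only [Function.Embedding.coeFn_mk]
        refine ⟨by simp [h1], ?_, rfl, ?_, ?_⟩
        · match w', h1 with
          | a :: w'', _ =>
            rw [List.isChain_cons_cons]
            refine ⟨?_, h2⟩
            simp only [List.getD_cons_zero] at h3
            rw [isDiagStep_iff, h3]; simpa using hd
        · intro i hi hin
          obtain ⟨i, rfl⟩ : ∃ j, i = j + 1 := ⟨i - 1, by omega⟩
          rw [windTo_cons_succ, h3, List.getD_cons_succ, ← add_assoc]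
          rcases Nat.eq_zero_or_pos i with rfl | hi'
          · rw [windTo_zero, add_zero, h3]; exact hok
          · exact h4 i hi' (by omega)
        · rw [windTo_cons_succ, h3, List.getD_cons_succ, ← add_assoc]; exact h5
      · simp at h
    · rintro ⟨h1, h2, h3, h4, h5⟩
      match w, h1 with
      | a :: b :: w'', h1 =>
        simp only [List.getD_cons_zero] at h3
        subst h3
        rw [List.isChain_cons_cons] at h2
        refine ⟨b - a, isDiagStep_iff.1 h2.1, ?_⟩
        have e : a + (b - a) = b := by abel
        rw [e]
        have h41 := h4 1 le_rfl (by omega)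
        rw [← zero_add 1, windTo_cons_succ, windTo_zero, add_zero] at h41
        simp only [zero_add, List.getD_cons_succ, List.getD_cons_zero] at h41
        rw [if_pos h41, Finset.mem_map]
        refine ⟨b :: w'', ?_, rfl⟩
        rw [ih]
        refine ⟨by simpa using h1, h2.2, rfl, ?_, ?_⟩
        · intro i hi hin
          have := h4 (i + 1) (by omega) (by omega)
          rwa [windTo_cons_succ, List.getD_cons_succ, ← add_assoc, List.getD_cons_zero] at this
        · rwa [windTo_cons_succ, List.getD_cons_succ, ← add_assoc, List.getD_cons_zero] at h5

open Classical in
lemma card_walkSet_succ (T ok : ℤ × ℤ → ℝ → Prop) (n : ℕ) (z : ℤ × ℤ) (θ : ℝ) :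
    (walkSet T ok (n + 1) z θ).card = ∑ d ∈ diagSteps,
      if ok (z + d) (θ + (ptC (z + d) / ptC z).arg) then
        (walkSet T ok n (z + d) (θ + (ptC (z + d) / ptC z).arg)).card else 0 := by
  rw [walkSet, Finset.card_biUnion]
  · refine Finset.sum_congr rfl fun d _ => ?_
    split_ifs <;> simp
  · intro d _ d' _ hdd
    simp only [Function.onFun]
    rw [Finset.disjoint_left]
    intro w hw hw'
    split_ifs at hw with h1
    · split_ifs at hw' with h2
      · rw [Finset.mem_map] at hw hw'
        obtain ⟨u, hu, rfl⟩ := hw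
        obtain ⟨u', hu', he⟩ := hw'
        have : u' = u := by simpa using he
        subst this
        rw [mem_walkSet] at hu hu'
        exact hdd (add_left_cancel (hu.2.2.1.symm.trans hu'.2.2.1))
      · simp at hw'
    · simp at hw

/-- The data of a bounded function on the charts of the universal cover of the punctured
plane that solves the Green's function equation with Dirichlet boundary conditions. -/
structure IsChartGreen (t : ℝ) (jm jp ja : ℤ) (l : ℕ) (B : ℝ) (V : ℤ → ℤ → ℤ → ℝ) : Prop where
  zero : ∀ c, V c 0 0 = 0
  up : ∀ c y, jm ≤ c → c < jp → 1 ≤ y → V c 0 y = V (c + 1) y 0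
  down : ∀ c x, jm < c → c < jp → 0 ≤ x → V c x (-1) = V (c - 1) 1 x
  left : ∀ x, 1 ≤ x → V jm x 0 = 0
  right : ∀ x, 1 ≤ x → V jp x 0 = 0
  bound : ∀ c x y, jm ≤ c → c < jp → 1 ≤ x → 0 ≤ y → |V c x y| ≤ B
  eq_axis : ∀ c x, jm < c → c < jp → 1 ≤ x →
    V c x 0 = (if c = ja ∧ x = l then 1 else 0) +
      t * (V c (x + 1) 1 + (V c (x + 1) (-1) + (V c (x - 1) (-1) + V c (x - 1) 1)))
  eq_inner : ∀ c x y, jm ≤ c → c < jp → 1 ≤ x → 1 ≤ y →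
    V c x y = t * (V c (x + 1) (y + 1) + (V c (x + 1) (y - 1) +
      (V c (x - 1) (y - 1) + V c (x - 1) (y + 1))))

/-- Admissibility of an intermediate position. -/
def okPos (jm jp : ℤ) (z : ℤ × ℤ) (θ : ℝ) : Prop :=
  z ≠ 0 ∧ π / 2 * jm < θ ∧ θ < π / 2 * jp

/-- Admissibility of the final position. -/
def endPos (ja : ℤ) (l : ℕ) (z : ℤ × ℤ) (θ : ℝ) : Prop := OnAxis l z ∧ θ = π / 2 * ja

/-- The number of admissible walks of length `n` from a position in a chart. -/
def chartCard (jm jp ja : ℤ) (l n : ℕ) (c : ℤ) (p : ℤ × ℤ) : ℝ :=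
  (walkSet (endPos ja l) (okPos jm jp) n ((rotZ ^ c) p) (chartAngle c p)).card

open Classical in
/-- The number of admissible walks continuing from a chart position, zero if it is not
admissible itself. -/
def chartCardOk (jm jp ja : ℤ) (l n : ℕ) (c : ℤ) (p : ℤ × ℤ) : ℝ :=
  if okPos jm jp ((rotZ ^ c) p) (chartAngle c p) then chartCard jm jp ja l n c p else 0

lemma rotZ_zpow_eq_zero {c : ℤ} {p : ℤ × ℤ} : (rotZ ^ c) p = 0 ↔ p = 0 := by
  rw [← ptC_eq_zero, ptC_rotZ_zpow, mul_eq_zero, ptC_eq_zero]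
  simp [zpow_ne_zero c Complex.I_ne_zero]

lemma chartCard_zero {jm jp ja : ℤ} {l : ℕ} {c : ℤ} {p : ℤ × ℤ} (hx : 1 ≤ p.1) (hy : 0 ≤ p.2) :
    chartCard jm jp ja l 0 c p = if c = ja ∧ p = ((l : ℤ), 0) then 1 else 0 := by
  rw [chartCard, walkSet, endPos]
  by_cases h : c = ja ∧ p = ((l : ℤ), 0)
  · rw [if_pos h, if_pos ((target_iff hx hy).2 h)]; simp
  · rw [if_neg h, if_neg (fun h' => h ((target_iff hx hy).1 h'))]; simp

lemma chartCard_succ {jm jp ja : ℤ} {l n : ℕ} {c : ℤ} {p : ℤ × ℤ} (hx : 1 ≤ p.1) :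
    chartCard jm jp ja l (n + 1) c p =
      ∑ d ∈ diagSteps, chartCardOk jm jp ja l n c (p + d) := by
  classical
  rw [chartCard, card_walkSet_succ]
  push_cast
  rw [← sum_diagSteps_rotZ c]
  refine Finset.sum_congr rfl fun d hd => ?_
  rw [← rotZ_zpow_add]
  by_cases h0 : p + d = 0
  · rw [chartCardOk, h0, rotZ_zpow_eq_zero.2 rfl, if_neg (fun h => h.1 rfl),
      if_neg (fun h => h.1 rfl)]
  · have hd1 : -1 ≤ d.1 := by
      rcases mem_diagSteps.1 hd with rfl | rfl | rfl | rfl <;> simp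
    rw [chartAngle_add_step c hx (by simp; omega) h0, chartCardOk, chartCard]

lemma chartCardOk_up (jm jp ja : ℤ) (l n : ℕ) (c : ℤ) {y : ℤ} (hy : 1 ≤ y) :
    chartCardOk jm jp ja l n c (0, y) = chartCardOk jm jp ja l n (c + 1) (y, 0) := by
  rw [chartCardOk, chartCardOk, chartCard, chartCard, chartAngle_zero_pos c hy,
    rotZ_zpow_zero_pos]

lemma chartCardOk_down (jm jp ja : ℤ) (l n : ℕ) (c : ℤ) {x : ℤ} (hx : 0 ≤ x) :
    chartCardOk jm jp ja l n c (x, -1) = chartCardOk jm jp ja l n (c - 1) (1, x) := by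
  rw [chartCardOk, chartCardOk, chartCard, chartCard, chartAngle_neg c hx le_rfl,
    rotZ_zpow_neg]

lemma okPos_chart_iff {jm jp c : ℤ} {p : ℤ × ℤ} (hx : 1 ≤ p.1) (hy : 0 ≤ p.2) :
    okPos jm jp ((rotZ ^ c) p) (chartAngle c p) ↔ (jm < c ∨ (jm = c ∧ 1 ≤ p.2)) ∧ c < jp := by
  rw [okPos, lt_chartAngle_iff hx hy, chartAngle_lt_iff hx hy, Ne, rotZ_zpow_eq_zero]
  have : p ≠ 0 := by rintro rfl; simp at hx
  simp [this]

/-- The error of the partial sums of the walk generating function in a chart. -/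
lemma IsChartGreen.error_le {t B : ℝ} {jm jp ja : ℤ} {l : ℕ} {V : ℤ → ℤ → ℤ → ℝ}
    (hV : IsChartGreen t jm jp ja l B V) (ht : 0 ≤ t) (N : ℕ) (c x y : ℤ)
    (hx : 1 ≤ x) (hy : 0 ≤ y) (hc : jm < c ∨ (jm = c ∧ 1 ≤ y)) (hcp : c < jp) :
    |V c x y - ∑ n ∈ Finset.range N, t ^ n * chartCard jm jp ja l n c (x, y)| ≤
      (4 * t) ^ N * B := by
  induction N generalizing c x y with
  | zero => simpa using hV.bound c x y (by omega) hcp hx hy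
  | succ N ih =>
    have hB : 0 ≤ (4 * t) ^ N * B := (abs_nonneg _).trans (ih c x y hx hy hc hcp)
    have key0 : ∀ c x y : ℤ, jm ≤ c → c ≤ jp → 1 ≤ x → 0 ≤ y → (c = jp → y = 0) →
        |V c x y - ∑ n ∈ Finset.range N, t ^ n * chartCardOk jm jp ja l n c (x, y)| ≤
          (4 * t) ^ N * B := by
      intro c x y h1 h2 hx hy h3
      by_cases h : (jm < c ∨ (jm = c ∧ 1 ≤ y)) ∧ c < jp
      · have := ih c x y hx hy h.1 h.2
        simpa only [chartCardOk, if_pos ((okPos_chart_iff (p := (x, y)) hx hy).2 h)] using this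
      · have hz : V c x y = 0 := by
          by_cases hcm : c < jp
          · have hy0 : y = 0 := by omega
            have hcj : c = jm := by omega
            rw [hy0, hcj]; exact hV.left x hx
          · have hcj : c = jp := by omega
            rw [h3 hcj, hcj]; exact hV.right x hx
        have h' : ¬ okPos jm jp ((rotZ ^ c) (x, y)) (chartAngle c (x, y)) := fun h' =>
          h ((okPos_chart_iff (p := (x, y)) hx hy).1 h')
        simp only [chartCardOk, if_neg h', hz, mul_zero, Finset.sum_const_zero, sub_zero, abs_zero]
        exact hB
    have key : ∀ x y : ℤ, 0 ≤ x → (0 ≤ y ∨ (y = -1 ∧ jm < c)) →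
        |V c x y - ∑ n ∈ Finset.range N, t ^ n * chartCardOk jm jp ja l n c (x, y)| ≤
          (4 * t) ^ N * B := by
      intro x y hx hy
      rcases hy with hy | ⟨rfl, hcm⟩
      · rcases hx.eq_or_lt with rfl | hx
        · rcases hy.eq_or_lt with rfl | hy
          · have h' : ¬ okPos jm jp ((rotZ ^ c) (0, 0)) (chartAngle c (0, 0)) := fun h' =>
              h'.1 (rotZ_zpow_eq_zero.2 rfl)
            simp only [chartCardOk, if_neg h', hV.zero, mul_zero, Finset.sum_const_zero, sub_zero,
              abs_zero]
            exact hB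
          · simp only [chartCardOk_up _ _ _ _ _ _ hy]
            rw [hV.up c y (by omega) hcp hy]
            exact key0 _ _ _ (by omega) (by omega) hy le_rfl (fun _ => rfl)
        · exact key0 _ _ _ (by omega) (by omega) hx hy (by omega)
      · simp only [chartCardOk_down _ _ _ _ _ _ hx]
        rw [hV.down c x hcm hcp hx]
        exact key0 _ _ _ (by omega) (by omega) le_rfl hx (by omega)
    have hrec : V c x y = (if c = ja ∧ (x, y) = ((l : ℤ), (0 : ℤ)) then 1 else 0) +
        t * ∑ d ∈ diagSteps, V c (x + d.1) (y + d.2) := by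
      rw [sum_diagSteps]
      by_cases hy1 : 1 ≤ y
      · rw [if_neg (by simp only [Prod.mk.injEq]; omega), zero_add]
        rw [hV.eq_inner c x y (by omega) hcp hx hy1]
        simp only [sub_eq_add_neg]
      · have hy0 : y = 0 := by omega
        subst hy0
        rw [hV.eq_axis c x (by omega) hcp hx]
        simp only [Prod.mk.injEq, and_true, zero_add, sub_eq_add_neg]
    have hsum : ∑ n ∈ Finset.range (N + 1), t ^ n * chartCard jm jp ja l n c (x, y) =
        (if c = ja ∧ (x, y) = ((l : ℤ), (0 : ℤ)) then 1 else 0) +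
        t * ∑ d ∈ diagSteps, ∑ n ∈ Finset.range N,
          t ^ n * chartCardOk jm jp ja l n c (x + d.1, y + d.2) := by
      rw [Finset.sum_range_succ', chartCard_zero (p := (x, y)) hx hy, Finset.sum_comm,
        pow_zero, one_mul, add_comm, Finset.mul_sum]
      congr 1
      refine Finset.sum_congr rfl fun n _ => ?_
      rw [chartCard_succ (p := (x, y)) hx, pow_succ', ← Finset.mul_sum]
      simp only [mul_assoc]
      rfl
    rw [hrec, hsum, add_sub_add_left_eq_sub, ← mul_sub, ← Finset.sum_sub_distrib, abs_mul,
      abs_of_nonneg ht, pow_succ, mul_comm _ (4 * t), mul_assoc, mul_assoc, ← mul_assoc,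
      mul_comm 4 t, mul_assoc]
    refine mul_le_mul_of_nonneg_left ?_ ht
    refine (Finset.abs_sum_le_sum_abs _ _).trans ?_
    have : ∀ d ∈ diagSteps, |V c (x + d.1) (y + d.2) - ∑ n ∈ Finset.range N,
        t ^ n * chartCardOk jm jp ja l n c (x + d.1, y + d.2)| ≤ (4 * t) ^ N * B := by
      intro d hd
      refine key _ _ ?_ ?_ <;> rcases mem_diagSteps.1 hd with rfl | rfl | rfl | rfl <;>
        simp <;> omega
    refine (Finset.sum_le_card_nsmul _ _ _ this).trans ?_
    have hcard : diagSteps.card = 4 := by decide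
    rw [hcard, nsmul_eq_mul, mul_comm t 4]
    norm_num

lemma wCond_iff {jm jp ja : ℤ} (hjm : jm < ja) (hjp : ja < jp) (l p : ℕ) (w : List (ℤ × ℤ))
    (hp : 1 ≤ p) :
    WCond l p (π / 2 * ja) (Set.Ioo (π / 2 * jm) (π / 2 * jp)) w ↔
      ∃ n, w ∈ walkSet (endPos ja l) (okPos jm jp) n ((p : ℤ), 0) 0 := by
  have hpi := Real.pi_pos
  have e1 : π / 2 * (jm : ℝ) < π / 2 * ja := by
    have : (jm : ℝ) < ja := by exact_mod_cast hjm
    gcongr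
  have e2 : π / 2 * (ja : ℝ) < π / 2 * jp := by
    have : (ja : ℝ) < jp := by exact_mod_cast hjp
    gcongr
  simp only [mem_walkSet, zero_add, WCond, IsWalkList, wind, okPos, endPos]
  constructor
  · rintro ⟨⟨h1, h2⟩, h3, h4, h5, h6, h7⟩
    have hlen : 0 < w.length := List.length_pos_iff.2 h1
    have hw : w.length = w.length - 1 + 1 := by omega
    have hget : ∀ i (hi : i < w.length), w.getD i 0 = w[i] := fun i hi => by
      rw [List.getD_eq_getElem?_getD, List.getElem?_eq_getElem hi]; rfl
    refine ⟨w.length - 1, hw, h2, ?_, ?_, ?_, h6⟩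
    · rw [hget 0 hlen]
      rw [List.head?_eq_getElem?, List.getElem?_eq_getElem hlen] at h4
      simpa using h4
    · intro i hi hin
      refine ⟨?_, ?_⟩
      · rw [hget i (by omega)]; exact h3 _ (List.getElem_mem _)
      · rcases Nat.lt_or_ge i (w.length - 1) with h | h
        · exact h7 i hi (by omega)
        · obtain rfl : i = w.length - 1 := by omega
          rw [h6]; exact ⟨e1, e2⟩
    · rw [hget _ (by omega)]
      simp only [List.getLast?_eq_getElem?, List.getElem?_eq_getElem (by omega : w.length - 1 < w.length),
        Option.some.injEq] at h5
      exact h5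
  · rintro ⟨n, h1, h2, h3, h4, h5, h6⟩
    obtain rfl : n = w.length - 1 := by omega
    have hget : ∀ i (hi : i < w.length), w.getD i 0 = w[i] := fun i hi => by
      rw [List.getD_eq_getElem?_getD, List.getElem?_eq_getElem hi]; rfl
    have hlen : 0 < w.length := by omega
    refine ⟨⟨List.length_pos_iff.1 hlen, h2⟩, ?_, ?_, ?_, h6, ?_⟩
    · intro x hx
      obtain ⟨i, hi, rfl⟩ := List.getElem_of_mem hx
      rcases Nat.eq_zero_or_pos i with rfl | hi'
      · rw [← hget 0 hi, h3]; simp; omega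
      · rw [← hget i hi]; exact (h4 i hi' (by omega)).1
    · rw [List.head?_eq_getElem?, List.getElem?_eq_getElem hlen, ← hget 0 hlen, h3]
    · simp only [List.getLast?_eq_getElem?, List.getElem?_eq_getElem (by omega : w.length - 1 < w.length),
        Option.some.injEq]
      rw [hget _ (by omega)] at h5
      exact h5
    · intro i hi hin
      exact (h4 i hi (by omega)).2

/-- A chart Green's function computes the walk generating function. -/
theorem IsChartGreen.hasSum {t B : ℝ} {jm jp ja : ℤ} {l : ℕ} {V : ℤ → ℤ → ℤ → ℝ}
    (hV : IsChartGreen t jm jp ja l B V) (ht : 0 ≤ t) (ht4 : t < 1 / 4) (hjm : jm < 0)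
    (hja : 0 ≤ ja) (hjp : ja < jp) (p : ℕ) (hp : 1 ≤ p) :
    HasSum (fun w : {w // WCond l p (π / 2 * ja) (Set.Ioo (π / 2 * jm) (π / 2 * jp)) w} =>
      t ^ (w.val.length - 1)) (V 0 p 0) := by
  set S : ℕ → Finset (List (ℤ × ℤ)) := fun n =>
    walkSet (endPos ja l) (okPos jm jp) n ((p : ℤ), 0) 0 with hS
  have hcard : ∀ n, chartCard jm jp ja l n 0 ((p : ℤ), 0) = (S n).card := by
    intro n
    have : chartAngle 0 ((p : ℤ), 0) = 0 := by
      have := (chartAngle_eq_iff (c := 0) (j := 0) (p := ((p : ℤ), 0))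
        (by simpa using hp) le_rfl).2 ⟨rfl, rfl⟩
      simpa using this
    rw [chartCard, this]; simp [hS]
  have hlim : HasSum (fun n => t ^ n * ((S n).card : ℝ)) (V 0 p 0) := by
    rw [hasSum_iff_tendsto_nat_of_nonneg (fun n => by positivity)]
    rw [tendsto_iff_norm_sub_tendsto_zero]
    have hz : Filter.Tendsto (fun N : ℕ => (4 * t) ^ N * B) Filter.atTop (nhds 0) := by
      have := (tendsto_pow_atTop_nhds_zero_of_lt_one (r := 4 * t) (by linarith)
        (by linarith)).mul_const B
      simpa using this
    refine squeeze_zero (fun _ => norm_nonneg _) (fun N => ?_) hz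
    have := hV.error_le ht N 0 p 0 (by exact_mod_cast hp) le_rfl (Or.inl hjm) (by omega)
    simp only [hcard] at this
    rwa [Real.norm_eq_abs, abs_sub_comm]
  have hiff := fun w => wCond_iff (by omega : jm < ja) hjp l p w hp
  have hlen : ∀ n w, w ∈ S n → w.length - 1 = n := fun n w hw => by
    have := ((mem_walkSet _ _ _ _ _ _).1 hw).1
    omega
  let e : (Σ n, {w // w ∈ S n}) →
      {w // WCond l p (π / 2 * ja) (Set.Ioo (π / 2 * jm) (π / 2 * jp)) w} :=
    fun x => ⟨x.2.1, (hiff _).2 ⟨x.1, x.2.2⟩⟩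
  have he : Function.Bijective e := by
    constructor
    · rintro ⟨n, w, hw⟩ ⟨n', w', hw'⟩ h
      have h1 : w = w' := congrArg Subtype.val h
      subst h1
      obtain rfl : n = n' := by rw [← hlen n w hw, ← hlen n' w hw']
      rfl
    · rintro ⟨w, hw⟩
      obtain ⟨n, hn⟩ := (hiff w).1 hw
      exact ⟨⟨n, w, hn⟩, rfl⟩
  rw [← (Equiv.ofBijective e he).hasSum_iff]
  have hfib : ∀ n, HasSum (fun w : {w // w ∈ S n} => t ^ (w.1.length - 1))
      (t ^ n * ((S n).card : ℝ)) := by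
    intro n
    convert hasSum_fintype (fun w : {w // w ∈ S n} => t ^ (w.1.length - 1)) using 1
    rw [Finset.sum_congr rfl fun w _ => by rw [hlen n w.1 w.2]]
    simp [mul_comm]
  have hs : Summable (fun x : Σ n, {w // w ∈ S n} => t ^ (x.2.1.length - 1)) := by
    rw [summable_sigma_of_nonneg (fun x => by positivity)]
    refine ⟨fun n => (hfib n).summable, ?_⟩
    simp only [fun n => (hfib n).tsum_eq]
    exact hlim.summable
  have := (hs.hasSum.sigma hfib).unique hlim
  rw [← this]
  exact hs.hasSum

/-- A bounded function on the lattice that is strictly subharmonic for the massive diagonal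
walk vanishes. -/
lemma eq_zero_of_abs_le_sum {t B : ℝ} (ht : 0 ≤ t) (ht4 : t < 1 / 4) (f : ℤ → ℤ → ℝ)
    (hB : ∀ x y, |f x y| ≤ B)
    (hf : ∀ x y, |f x y| ≤ t * (|f (x + 1) (y + 1)| + (|f (x + 1) (y - 1)| +
      (|f (x - 1) (y - 1)| + |f (x - 1) (y + 1)|)))) (x y : ℤ) : f x y = 0 := by
  have key : ∀ N : ℕ, ∀ x y, |f x y| ≤ (4 * t) ^ N * B := by
    intro N
    induction N with
    | zero => simpa using hB
    | succ N ih =>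
      intro x y
      refine (hf x y).trans ?_
      have := mul_le_mul_of_nonneg_left (add_le_add (ih (x + 1) (y + 1)) (add_le_add
        (ih (x + 1) (y - 1)) (add_le_add (ih (x - 1) (y - 1)) (ih (x - 1) (y + 1))))) ht
      refine this.trans (le_of_eq ?_)
      rw [pow_succ]; ring
  have hz : Filter.Tendsto (fun N : ℕ => (4 * t) ^ N * B) Filter.atTop (nhds 0) := by
    have := (tendsto_pow_atTop_nhds_zero_of_lt_one (r := 4 * t) (by linarith)
      (by linarith)).mul_const B
    simpa using this
  exact abs_eq_zero.1 (le_antisymm (ge_of_tendsto' hz fun N => key N x y) (abs_nonneg _))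

/-- The function `√(1 - k² cos² φ)`. -/
def wf (k φ : ℝ) : ℝ := √(1 - k ^ 2 * Real.cos φ ^ 2)

/-- The root inside the unit disc of `k cos φ (1 + X²) = 2 X`. -/
def Xf (k φ : ℝ) : ℝ := k * Real.cos φ / (1 + wf k φ)

/-- The normalized incomplete elliptic integral. -/
def uf (k φ : ℝ) : ℝ := π / (2 * Kell k) * ∫ s in (0 : ℝ)..φ, 1 / wf k s

section basics

variable {k : ℝ}

lemma wf_arg_pos (h0 : 0 < k) (h1 : k < 1) (φ : ℝ) : 0 < 1 - k ^ 2 * Real.cos φ ^ 2 := by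
  have := Real.cos_sq_le_one φ
  nlinarith [sq_nonneg (Real.cos φ)]

lemma wf_pos (h0 : 0 < k) (h1 : k < 1) (φ : ℝ) : 0 < wf k φ :=
  Real.sqrt_pos.2 (wf_arg_pos h0 h1 φ)

lemma wf_sq (h0 : 0 < k) (h1 : k < 1) (φ : ℝ) : wf k φ ^ 2 = 1 - k ^ 2 * Real.cos φ ^ 2 :=
  Real.sq_sqrt (wf_arg_pos h0 h1 φ).le

lemma continuous_wf : Continuous (wf k) := by unfold wf; fun_prop

lemma wf_neg (φ : ℝ) : wf k (-φ) = wf k φ := by simp [wf]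

lemma wf_pi_sub (φ : ℝ) : wf k (π - φ) = wf k φ := by simp [wf, Real.cos_pi_sub]

lemma Xf_sq (h0 : 0 < k) (h1 : k < 1) (φ : ℝ) :
    Xf k φ ^ 2 = (1 - wf k φ) / (1 + wf k φ) := by
  have hw := wf_pos h0 h1 φ
  have h2 := wf_sq h0 h1 φ
  have : k ^ 2 * Real.cos φ ^ 2 = (1 - wf k φ) * (1 + wf k φ) := by linear_combination h2
  rw [Xf, div_pow, mul_pow, this]; field_simp

lemma Xf_rel (h0 : 0 < k) (h1 : k < 1) (φ : ℝ) :
    k * Real.cos φ * (1 + Xf k φ ^ 2) = 2 * Xf k φ := by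
  have hw := wf_pos h0 h1 φ
  rw [Xf_sq h0 h1, Xf]; field_simp; ring_nf

lemma one_sub_Xf_sq (h0 : 0 < k) (h1 : k < 1) (φ : ℝ) :
    1 - Xf k φ ^ 2 = wf k φ * (1 + Xf k φ ^ 2) := by
  have hw := wf_pos h0 h1 φ
  rw [Xf_sq h0 h1]; field_simp; ring

lemma abs_Xf_le (h0 : 0 < k) (h1 : k < 1) (φ : ℝ) : |Xf k φ| ≤ k := by
  have hw := wf_pos h0 h1 φ
  rw [Xf, abs_div, abs_mul, abs_of_pos h0, abs_of_pos (by linarith : 0 < 1 + wf k φ),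
    div_le_iff₀ (by linarith)]
  have := Real.abs_cos_le_one φ
  nlinarith

lemma hasDerivAt_wf (h0 : 0 < k) (h1 : k < 1) (φ : ℝ) :
    HasDerivAt (wf k) (k ^ 2 * Real.cos φ * Real.sin φ / wf k φ) φ := by
  have h := (((Real.hasDerivAt_cos φ).pow 2).const_mul (k ^ 2)).const_sub 1
  have h2 := h.sqrt (wf_arg_pos h0 h1 φ).ne'
  refine h2.congr_deriv ?_
  have hw := (wf_pos h0 h1 φ).ne'
  change _ / (2 * wf k φ) = _
  field_simp
  norm_num
  ring

lemma hasDerivAt_Xf (h0 : 0 < k) (h1 : k < 1) (φ : ℝ) :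
    HasDerivAt (Xf k) (-(k * Real.sin φ) / (wf k φ * (1 + wf k φ))) φ := by
  have hw := wf_pos h0 h1 φ
  have h2 := wf_sq h0 h1 φ
  have h := ((Real.hasDerivAt_cos φ).const_mul k).div ((hasDerivAt_wf h0 h1 φ).const_add 1)
    (by positivity)
  refine h.congr_deriv ?_
  field_simp
  linear_combination (-Real.sin φ) * h2

lemma continuous_Xf (h0 : 0 < k) (h1 : k < 1) : Continuous (Xf k) :=
  continuous_iff_continuousAt.2 fun φ => (hasDerivAt_Xf h0 h1 φ).continuousAt

lemma continuous_one_div_wf (h0 : 0 < k) (h1 : k < 1) : Continuous fun φ => 1 / wf k φ :=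
  continuous_const.div continuous_wf fun φ => (wf_pos h0 h1 φ).ne'

lemma Kell_eq (h0 : 0 < k) (h1 : k < 1) :
    Kell k = ∫ φ in (0 : ℝ)..(π / 2), 1 / wf k φ := by
  have hpi := Real.pi_pos
  have h := intervalIntegral.integral_deriv_smul_comp_of_deriv_nonpos (a := 0) (b := π / 2)
    (f := Real.cos) (f' := fun x => -Real.sin x)
    (g := fun y => 1 / √((1 - y ^ 2) * (1 - k ^ 2 * y ^ 2))) Real.continuous_cos.continuousOn
    (fun x _ => Real.hasDerivAt_cos x) (fun x hx => by
      rw [min_eq_left (by positivity), max_eq_right (by positivity)] at hx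
      have := Real.sin_pos_of_pos_of_lt_pi hx.1 (by linarith [hx.2])
      linarith)
  rw [Real.cos_zero, Real.cos_pi_div_two] at h
  rw [Kell, intervalIntegral.integral_symm, ← h, eq_comm, ← intervalIntegral.integral_neg]
  refine intervalIntegral.integral_congr_Ioo_of_le (by positivity) fun x hx => ?_
  have hs := Real.sin_pos_of_pos_of_lt_pi hx.1 (by linarith [hx.2])
  have hw := wf_pos h0 h1 x
  simp only [Function.comp_apply, smul_eq_mul]
  rw [← Real.sin_sq, Real.sqrt_mul (sq_nonneg _), Real.sqrt_sq hs.le]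
  change _ = -(-Real.sin x * (1 / (Real.sin x * wf k x)))
  field_simp

lemma Kell_pos (h0 : 0 < k) (h1 : k < 1) : 0 < Kell k := by
  rw [Kell_eq h0 h1]
  exact intervalIntegral.intervalIntegral_pos_of_pos
    ((continuous_one_div_wf h0 h1).intervalIntegrable _ _)
    (fun x => one_div_pos.2 (wf_pos h0 h1 x)) (by positivity)

lemma hasDerivAt_uf (h0 : 0 < k) (h1 : k < 1) (φ : ℝ) :
    HasDerivAt (uf k) (π / (2 * Kell k) * (1 / wf k φ)) φ :=
  (((continuous_one_div_wf h0 h1).integral_hasStrictDerivAt 0 φ).hasDerivAt).const_mul _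

lemma continuous_uf (h0 : 0 < k) (h1 : k < 1) : Continuous (uf k) :=
  continuous_iff_continuousAt.2 fun φ => (hasDerivAt_uf h0 h1 φ).continuousAt

lemma uf_zero : uf k 0 = 0 := by simp [uf]

lemma uf_pi_div_two (h0 : 0 < k) (h1 : k < 1) : uf k (π / 2) = π / 2 := by
  have := Kell_pos h0 h1
  rw [uf, ← Kell_eq h0 h1]; field_simp

lemma uf_neg (h0 : 0 < k) (h1 : k < 1) (φ : ℝ) : uf k (-φ) = -uf k φ := by
  have hd : ∀ x, HasDerivAt (fun φ => uf k (-φ) + uf k φ) 0 x := by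
    intro x
    refine (((hasDerivAt_uf h0 h1 (-x)).scomp x (hasDerivAt_neg x)).add
      (hasDerivAt_uf h0 h1 x)).congr_deriv ?_
    simp [wf_neg]
  have := is_const_of_deriv_eq_zero (fun x => (hd x).differentiableAt) (fun x => (hd x).deriv) φ 0
  simp only [neg_zero, uf_zero, add_zero] at this
  linarith

lemma uf_pi_sub (h0 : 0 < k) (h1 : k < 1) (φ : ℝ) : uf k (π - φ) = π - uf k φ := by
  have hd : ∀ x, HasDerivAt (fun φ => uf k (π - φ) + uf k φ) 0 x := by
    intro x
    refine (((hasDerivAt_uf h0 h1 (π - x)).scomp x ((hasDerivAt_id x).const_sub π)).add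
      (hasDerivAt_uf h0 h1 x)).congr_deriv ?_
    simp [wf_pi_sub]
  have := is_const_of_deriv_eq_zero (fun x => (hd x).differentiableAt) (fun x => (hd x).deriv) φ
    (π / 2)
  simp only [sub_half, uf_pi_div_two h0 h1] at this
  linarith

lemma uf_pi (h0 : 0 < k) (h1 : k < 1) : uf k π = π := by
  simpa [uf_zero] using uf_pi_sub h0 h1 0

lemma strictMono_uf (h0 : 0 < k) (h1 : k < 1) : StrictMono (uf k) :=
  strictMono_of_deriv_pos fun x => by
    rw [(hasDerivAt_uf h0 h1 x).deriv]
    have := Kell_pos h0 h1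
    have := wf_pos h0 h1 x
    positivity

end basics

/-- The density of `uf`. -/
def rf (k φ : ℝ) : ℝ := π / (2 * Kell k) * (1 / wf k φ)

/-- Elementary solutions of the massive harmonic equation on the half plane. -/
def hm (k : ℝ) (m : ℤ) (x : ℕ) (y : ℤ) : ℝ :=
  1 / π * ∫ φ in (0 : ℝ)..π, Xf k φ ^ x * Real.cos (y * φ + m * uf k φ) * rf k φ

section hm

variable {k : ℝ}

lemma rf_pos (h0 : 0 < k) (h1 : k < 1) (φ : ℝ) : 0 < rf k φ := by
  have := Kell_pos h0 h1
  have := wf_pos h0 h1 φ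
  have := Real.pi_pos
  rw [rf]; positivity

lemma continuous_rf (h0 : 0 < k) (h1 : k < 1) : Continuous (rf k) :=
  (continuous_one_div_wf h0 h1).const_mul _

lemma integral_rf (h0 : 0 < k) (h1 : k < 1) : ∫ φ in (0 : ℝ)..π, rf k φ = π := by
  change ∫ φ in (0 : ℝ)..π, π / (2 * Kell k) * (1 / wf k φ) = π
  rw [intervalIntegral.integral_eq_sub_of_hasDerivAt (fun x _ => hasDerivAt_uf h0 h1 x)
    ((continuous_rf h0 h1).intervalIntegrable _ _), uf_pi h0 h1, uf_zero, sub_zero]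

lemma continuous_hm_integrand (h0 : 0 < k) (h1 : k < 1) (m : ℤ) (x : ℕ) (y : ℤ) :
    Continuous fun φ => Xf k φ ^ x * Real.cos (y * φ + m * uf k φ) * rf k φ := by
  have := continuous_Xf h0 h1
  have := continuous_uf h0 h1
  have := continuous_rf h0 h1
  fun_prop

lemma abs_hm_le (h0 : 0 < k) (h1 : k < 1) (m : ℤ) (x : ℕ) (y : ℤ) : |hm k m x y| ≤ 1 := by
  have hpi := Real.pi_pos
  have h : |∫ φ in (0 : ℝ)..π, Xf k φ ^ x * Real.cos (y * φ + m * uf k φ) * rf k φ| ≤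
      ∫ φ in (0 : ℝ)..π, rf k φ := by
    rw [← Real.norm_eq_abs]
    refine intervalIntegral.norm_integral_le_of_norm_le hpi.le (Filter.Eventually.of_forall
      fun φ _ => ?_) ((continuous_rf h0 h1).intervalIntegrable _ _)
    rw [norm_mul, norm_mul, norm_pow, Real.norm_eq_abs, Real.norm_eq_abs, Real.norm_eq_abs,
      abs_of_pos (rf_pos h0 h1 φ)]
    have e1 : |Xf k φ| ^ x ≤ 1 := pow_le_one₀ (abs_nonneg _) ((abs_Xf_le h0 h1 φ).trans h1.le)
    have e2 := Real.abs_cos_le_one (y * φ + m * uf k φ)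
    have := rf_pos h0 h1 φ
    have := mul_le_one₀ e1 (abs_nonneg _) e2
    nlinarith
  rw [integral_rf h0 h1] at h
  rw [hm, abs_mul, abs_of_pos (by positivity), one_div, inv_mul_le_iff₀ hpi]
  linarith

lemma hm_neg (m : ℤ) (x : ℕ) (y : ℤ) : hm k (-m) x y = hm k m x (-y) := by
  rw [hm, hm]; congr 1
  refine intervalIntegral.integral_congr fun φ _ => ?_
  rw [← Real.cos_neg]; push_cast; ring_nf

lemma hm_zero_zero (h0 : 0 < k) (h1 : k < 1) {m : ℤ} (hm0 : m ≠ 0) : hm k m 0 0 = 0 := by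
  have hm' : (m : ℝ) ≠ 0 := by exact_mod_cast hm0
  have hd : ∀ x, HasDerivAt (fun φ => Real.sin (m * uf k φ) / m)
      (Xf k x ^ 0 * Real.cos ((0 : ℤ) * x + m * uf k x) * rf k x) x := by
    intro x
    refine (((hasDerivAt_uf h0 h1 x).const_mul (m : ℝ)).sin.div_const (m : ℝ)).congr_deriv ?_
    rw [rf]; simp; field_simp
  rw [hm, intervalIntegral.integral_eq_sub_of_hasDerivAt (fun x _ => hd x)
    ((continuous_hm_integrand h0 h1 m 0 0).intervalIntegrable _ _), uf_pi h0 h1, uf_zero]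
  simp

lemma hm_rec (h0 : 0 < k) (h1 : k < 1) (m : ℤ) (x : ℕ) (y : ℤ) :
    hm k m (x + 1) y = k / 4 * (hm k m (x + 2) (y + 1) + (hm k m (x + 2) (y - 1) +
      (hm k m x (y - 1) + hm k m x (y + 1)))) := by
  have c := fun x y => (continuous_hm_integrand h0 h1 m x y).intervalIntegrable
    (μ := MeasureTheory.volume) 0 π
  simp only [hm]
  rw [← mul_add, ← mul_add, ← mul_add, mul_left_comm (k / 4)]
  congr 1
  rw [← intervalIntegral.integral_add (c _ _) (c _ _),
    ← intervalIntegral.integral_add (c _ _) ((c _ _).add (c _ _)),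
    ← intervalIntegral.integral_add (c _ _) ((c _ _).add ((c _ _).add (c _ _))),
    ← intervalIntegral.integral_const_mul]
  refine intervalIntegral.integral_congr fun φ _ => ?_
  have e := Xf_rel h0 h1 φ
  have e1 : Real.cos ((y + 1 : ℤ) * φ + m * uf k φ) = Real.cos (y * φ + m * uf k φ) * Real.cos φ -
      Real.sin (y * φ + m * uf k φ) * Real.sin φ := by
    rw [← Real.cos_add]; push_cast; ring_nf
  have e2 : Real.cos ((y - 1 : ℤ) * φ + m * uf k φ) = Real.cos (y * φ + m * uf k φ) * Real.cos φ +
      Real.sin (y * φ + m * uf k φ) * Real.sin φ := by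
    rw [← Real.cos_sub]; push_cast; ring_nf
  rw [e1, e2]
  linear_combination (-(1 / 2) * Xf k φ ^ x * Real.cos (y * φ + m * uf k φ) * rf k φ) * e

end hm

section landen

variable {k : ℝ}

lemma kComp_sq (h0 : 0 < k) (h1 : k < 1) : kComp k ^ 2 = 1 - k ^ 2 :=
  Real.sq_sqrt (by nlinarith)

lemma kComp_pos (h0 : 0 < k) (h1 : k < 1) : 0 < kComp k := Real.sqrt_pos.2 (by nlinarith)

lemma kComp_lt_one (h0 : 0 < k) (h1 : k < 1) : kComp k < 1 := by
  have := kComp_sq h0 h1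
  have := kComp_pos h0 h1
  nlinarith

lemma kLanden_pos (h0 : 0 < k) (h1 : k < 1) : 0 < kLanden k := by
  have := kComp_lt_one h0 h1
  have := kComp_pos h0 h1
  exact div_pos (by linarith) (by linarith)

lemma kLanden_lt_one (h0 : 0 < k) (h1 : k < 1) : kLanden k < 1 := by
  have := kComp_pos h0 h1
  rw [kLanden, div_lt_one (by linarith)]; linarith

lemma one_add_kLanden (h0 : 0 < k) (h1 : k < 1) : 1 + kLanden k = 2 / (1 + kComp k) := by
  have := kComp_pos h0 h1
  rw [kLanden]; field_simp; ring

lemma kLanden_eq_sq (h0 : 0 < k) (h1 : k < 1) : kLanden k = (k / (1 + kComp k)) ^ 2 := by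
  have h2 := kComp_pos h0 h1
  have h3 := kComp_sq h0 h1
  rw [kLanden]; field_simp
  linear_combination -h3

lemma sqrt_kLanden (h0 : 0 < k) (h1 : k < 1) : √(kLanden k) = k / (1 + kComp k) := by
  have h2 := kComp_pos h0 h1
  rw [kLanden_eq_sq h0 h1, Real.sqrt_sq (by positivity)]

lemma Xf_zero : Xf k 0 = k / (1 + kComp k) := by simp [Xf, wf, kComp]

lemma landen_quartic (h0 : 0 < k) (h1 : k < 1) (φ : ℝ) :
    (kLanden k - Xf k φ ^ 2) * (1 - kLanden k * Xf k φ ^ 2) =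
      (2 * k * Real.sin φ / ((1 + kComp k) * (1 + wf k φ))) ^ 2 := by
  have h2 := kComp_pos h0 h1
  have h3 := kComp_sq h0 h1
  have hw := wf_pos h0 h1 φ
  have hw2 := wf_sq h0 h1 φ
  have hs := Real.sin_sq_add_cos_sq φ
  rw [Xf_sq h0 h1, kLanden]
  field_simp
  have e : wf k φ ^ 2 - kComp k ^ 2 = k ^ 2 * Real.sin φ ^ 2 := by
    rw [hw2, h3]; linear_combination (-k ^ 2) * hs
  linear_combination 4 * e

lemma Xf_sq_lt (h0 : 0 < k) (h1 : k < 1) {φ : ℝ} (hs : Real.sin φ ≠ 0) :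
    Xf k φ ^ 2 < kLanden k := by
  have h2 := kComp_pos h0 h1
  have hw := wf_pos h0 h1 φ
  have h4 := landen_quartic h0 h1 φ
  have h5 : 0 < (2 * k * Real.sin φ / ((1 + kComp k) * (1 + wf k φ))) ^ 2 := by positivity
  have h6 : 0 < 1 - kLanden k * Xf k φ ^ 2 := by
    have := kLanden_lt_one h0 h1
    have := kLanden_pos h0 h1
    have h7 := (abs_Xf_le h0 h1 φ).trans h1.le
    have : Xf k φ ^ 2 ≤ 1 := by rw [sq_le_one_iff_abs_le_one]; exact h7
    nlinarith
  rw [← h4] at h5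
  have := pos_of_mul_pos_left h5 h6.le
  linarith

lemma sqrt_landen_quartic (h0 : 0 < k) (h1 : k < 1) {φ : ℝ} (hs : 0 < Real.sin φ) :
    √((kLanden k - Xf k φ ^ 2) * (1 - kLanden k * Xf k φ ^ 2)) =
      2 * k * Real.sin φ / ((1 + kComp k) * (1 + wf k φ)) := by
  have h2 := kComp_pos h0 h1
  have hw := wf_pos h0 h1 φ
  rw [landen_quartic h0 h1, Real.sqrt_sq (by positivity)]

/-- The descending Landen transformation of the complete elliptic integral. -/
lemma Kell_kLanden (h0 : 0 < k) (h1 : k < 1) :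
    Kell (kLanden k) = (1 + kComp k) / 2 * Kell k := by
  have hpi := Real.pi_pos
  have h2 := kComp_pos h0 h1
  have hk1 := kLanden_pos h0 h1
  have hsq := sqrt_kLanden h0 h1
  have hsq0 : 0 < √(kLanden k) := Real.sqrt_pos.2 hk1
  have hXd := fun x => (hasDerivAt_Xf h0 h1 x).div_const (√(kLanden k))
  have h := intervalIntegral.integral_deriv_smul_comp_of_deriv_nonpos (a := 0) (b := π / 2)
    (f := fun φ => Xf k φ / √(kLanden k))
    (f' := fun x => -(k * Real.sin x) / (wf k x * (1 + wf k x)) / √(kLanden k))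
    (g := fun y => 1 / √((1 - y ^ 2) * (1 - kLanden k ^ 2 * y ^ 2)))
    ((continuous_Xf h0 h1).div_const _).continuousOn
    (fun x _ => hXd x) (fun x hx => by
      rw [min_eq_left (by positivity), max_eq_right (by positivity)] at hx
      have := Real.sin_pos_of_pos_of_lt_pi hx.1 (by linarith [hx.2])
      have := wf_pos h0 h1 x
      have : 0 ≤ k * Real.sin x / (wf k x * (1 + wf k x)) / √(kLanden k) := by positivity
      rw [neg_div, neg_div]; linarith)
  have e1 : Xf k 0 / √(kLanden k) = 1 := by
    rw [hsq, Xf_zero, div_self (by positivity)]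
  have e2 : Xf k (π / 2) / √(kLanden k) = 0 := by simp [Xf]
  rw [e1, e2] at h
  rw [Kell, intervalIntegral.integral_symm, ← h, Kell_eq h0 h1,
    ← intervalIntegral.integral_neg, ← intervalIntegral.integral_const_mul]
  refine intervalIntegral.integral_congr_Ioo_of_le (by positivity) fun x hx => ?_
  have hs := Real.sin_pos_of_pos_of_lt_pi hx.1 (by linarith [hx.2])
  have hw := wf_pos h0 h1 x
  simp only [Function.comp_apply, smul_eq_mul]
  have e3 : (1 - (Xf k x / √(kLanden k)) ^ 2) * (1 - kLanden k ^ 2 * (Xf k x / √(kLanden k)) ^ 2) =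
      (kLanden k - Xf k x ^ 2) * (1 - kLanden k * Xf k x ^ 2) / kLanden k := by
    rw [div_pow, Real.sq_sqrt hk1.le]; field_simp
  rw [e3, Real.sqrt_div' _ hk1.le, sqrt_landen_quartic h0 h1 hs]
  field_simp

/-- The half period of the Landen-transformed elliptic integral along the imaginary axis. -/
lemma integral_imag_kLanden (h0 : 0 < k) (h1 : k < 1) :
    ∫ s in (0 : ℝ)..1, 1 / √((kLanden k + s ^ 2) * (1 + kLanden k * s ^ 2)) =
      (1 + kComp k) / 2 * Kell (kComp k) := by
  have hk1 := kLanden_pos h0 h1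
  have h2 := kComp_pos h0 h1
  have hd : ∀ s : ℝ, HasDerivAt (fun s : ℝ => (1 - s ^ 2) / (1 + s ^ 2))
      (-(4 * s) / (1 + s ^ 2) ^ 2) s := by
    intro s
    refine (((hasDerivAt_pow 2 s).const_sub 1).div ((hasDerivAt_pow 2 s).const_add 1)
      (by positivity)).congr_deriv ?_
    push_cast
    congr 1
    ring
  have h := intervalIntegral.integral_deriv_smul_comp_of_deriv_nonpos (a := 0) (b := 1)
    (f := fun s : ℝ => (1 - s ^ 2) / (1 + s ^ 2))
    (f' := fun s => -(4 * s) / (1 + s ^ 2) ^ 2)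
    (g := fun y => 1 / √((1 - y ^ 2) * (1 - kComp k ^ 2 * y ^ 2)))
    (fun s _ => (hd s).continuousAt.continuousWithinAt)
    (fun s _ => hd s) (fun s hs => by
      rw [min_eq_left (by positivity), max_eq_right (by positivity)] at hs
      have := hs.1
      have : 0 ≤ 4 * s / (1 + s ^ 2) ^ 2 := by positivity
      rw [neg_div]; linarith)
  norm_num only at h
  have hK : Kell (kComp k) = -∫ y in (1 : ℝ)..0, 1 / √((1 - y ^ 2) * (1 - kComp k ^ 2 * y ^ 2)) := by
    rw [Kell, intervalIntegral.integral_symm]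
  rw [hK, ← h, ← intervalIntegral.integral_neg, ← intervalIntegral.integral_const_mul]
  refine intervalIntegral.integral_congr_Ioo_of_le (by positivity) fun s hs => ?_
  have hs0 := hs.1
  have e : kComp k = (1 - kLanden k) / (1 + kLanden k) := by
    rw [one_add_kLanden h0 h1, kLanden]; field_simp; ring
  have e3 : (1 - ((1 - s ^ 2) / (1 + s ^ 2)) ^ 2) *
      (1 - kComp k ^ 2 * ((1 - s ^ 2) / (1 + s ^ 2)) ^ 2) =
      (4 * s / ((1 + kLanden k) * (1 + s ^ 2) ^ 2)) ^ 2 *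
        ((kLanden k + s ^ 2) * (1 + kLanden k * s ^ 2)) := by
    rw [e]; field_simp; ring
  simp only [Function.comp_apply, smul_eq_mul, e3]
  have hq : 0 < (kLanden k + s ^ 2) * (1 + kLanden k * s ^ 2) := by positivity
  rw [Real.sqrt_mul (sq_nonneg _), Real.sqrt_sq (by positivity), one_add_kLanden h0 h1]
  have := Real.sqrt_pos.2 hq
  field_simp

end landen

section vmap

variable {k : ℝ} {v : ℂ → ℂ}

lemma isPreconnected_slitDom {κ : ℝ} (hκ : 0 < κ) : IsPreconnected (slitDom κ) := by
  have h : StarConvex ℝ 0 (slitDom κ) := by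
    rw [starConvex_zero_iff]
    rintro z hz r hr0 hr1 ⟨him, hre⟩
    apply hz
    have e1 : (r • z).im = r * z.im := by simp
    have e2 : (r • z).re = r * z.re := by simp
    rw [e1] at him
    rw [e2] at hre
    rcases mul_eq_zero.1 him with h | h
    · rw [h] at hre; norm_num at hre; linarith
    · refine ⟨h, hre.trans ?_⟩
      rw [mul_pow]
      have : r ^ 2 ≤ 1 := by nlinarith
      nlinarith [sq_nonneg z.re]
  have h0 : (0 : ℂ) ∈ slitDom κ := by simpa [slitDom] using hκ
  exact (StarConvex.isPathConnected h h0).isConnected.isPreconnected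

lemma ofReal_mem_slitDom {κ x : ℝ} (hx : x ^ 2 < κ) : (x : ℂ) ∈ slitDom κ := by
  simp only [slitDom, Set.mem_ofPred_eq, Complex.ofReal_im, Complex.ofReal_re, true_and, not_le]
  exact hx

lemma mem_slitDom_of_im {κ : ℝ} {z : ℂ} (hz : z.im ≠ 0) : z ∈ slitDom κ := fun h => hz h.1

lemma imag_mem_slitDom {κ : ℝ} (hκ : 0 < κ) (s : ℝ) : (s : ℂ) * Complex.I ∈ slitDom κ := by
  rintro ⟨-, h⟩; simp at h; linarith

/-- The square of the derivative of `v`. -/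
lemma IsVmap.deriv_sq {κ : ℝ} (hκ : 0 < κ) (hκ1 : κ < 1) (hv : IsVmap κ v) {z : ℂ}
    (hz : z ∈ slitDom κ) :
    deriv v z ^ 2 * (16 * (Kell κ : ℂ) ^ 2 * ((κ - z ^ 2) * (1 - κ * z ^ 2))) = 1 := by
  have hK := Kell_pos hκ hκ1
  have hF : AnalyticOnNhd ℂ
      (fun z => deriv v z ^ 2 * (16 * (Kell κ : ℂ) ^ 2 * ((κ - z ^ 2) * (1 - κ * z ^ 2))))
      (slitDom κ) := by
    have := hv.analytic.deriv
    intro z hz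
    exact ((this z hz).pow 2).mul (by fun_prop)
  refine hF.eqOn_of_preconnected_of_frequently_eq (analyticOnNhd_const (v := 1))
    (isPreconnected_slitDom hκ) (z₀ := 0) (by simpa using ofReal_mem_slitDom (x := 0) (by simpa))
    ?_ hz
  have ht : Filter.Tendsto (fun x : ℝ => (x : ℂ)) (nhdsWithin 0 {0}ᶜ) (nhdsWithin 0 {0}ᶜ) := by
    refine tendsto_nhdsWithin_of_tendsto_nhds_of_eventually_within _ ?_ ?_
    · exact (Complex.continuous_ofReal.tendsto' 0 0 (by simp)).mono_left nhdsWithin_le_nhds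
    · filter_upwards [self_mem_nhdsWithin] with x hx
      simpa using hx
  refine ht.frequently (Filter.Eventually.frequently ?_)
  have : ∀ᶠ x : ℝ in nhds 0, x ^ 2 < κ :=
    (continuous_pow 2).tendsto' (0 : ℝ) 0 (by simp) |>.eventually_lt_const hκ
  filter_upwards [nhdsWithin_le_nhds this] with x hx
  rw [(hv.deriv_real x hx).deriv]
  have h1 : 0 < (κ - x ^ 2) * (1 - κ * x ^ 2) := mul_pos (by linarith) (by nlinarith)
  have h2 := Real.sqrt_pos.2 h1
  have h3 := Real.sq_sqrt h1.le
  have : (1 / (4 * Kell κ * √((κ - x ^ 2) * (1 - κ * x ^ 2)))) ^ 2 *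
      (16 * Kell κ ^ 2 * ((κ - x ^ 2) * (1 - κ * x ^ 2))) = 1 := by
    rw [div_pow, mul_pow, h3]
    generalize (κ - x ^ 2) * (1 - κ * x ^ 2) = y at h1
    field_simp; norm_num
  exact_mod_cast this

lemma IsVmap.differentiableAt {κ : ℝ} (hv : IsVmap κ v) {z : ℂ} (hz : z ∈ slitDom κ) :
    HasDerivAt v (deriv v z) z := (hv.analytic z hz).differentiableAt.hasDerivAt

lemma eq_of_hasDerivAt_zero {f : ℝ → ℂ} {a b : ℝ} (h : ∀ x ∈ Ioo a b, HasDerivAt f 0 x) {x y : ℝ}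
    (hx : x ∈ Ioo a b) (hy : y ∈ Ioo a b) : f x = f y :=
  isOpen_Ioo.is_const_of_deriv_eq_zero isPreconnected_Ioo
    (fun z hz => (h z hz).differentiableAt.differentiableWithinAt) (fun z hz => (h z hz).deriv)
    hx hy

lemma pi_div_two_mem : π / 2 ∈ Ioo 0 π := ⟨by positivity, by linarith [Real.pi_pos]⟩

/-- The values of `v` on the real interval. -/
lemma IsVmap.apply_Xf (h0 : 0 < k) (h1 : k < 1) (hv : IsVmap (kLanden k) v) {φ : ℝ}
    (hφ : φ ∈ Ioo 0 π) : v (Xf k φ) = ((1 / 4 - uf k φ / (2 * π) : ℝ) : ℂ) := by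
  have hd : ∀ x ∈ Ioo 0 π,
      HasDerivAt (fun φ : ℝ => v (Xf k φ) + ((uf k φ / (2 * π) : ℝ) : ℂ)) 0 x := by
    intro x hx
    have hs := Real.sin_pos_of_pos_of_lt_pi hx.1 hx.2
    have hX := (hasDerivAt_Xf h0 h1 x).ofReal_comp
    have hu := ((hasDerivAt_uf h0 h1 x).div_const (2 * π)).ofReal_comp
    have := ((hv.deriv_real _ (Xf_sq_lt h0 h1 hs.ne')).comp x hX).add hu
    refine this.congr_deriv ?_
    rw [sqrt_landen_quartic h0 h1 hs, Kell_kLanden h0 h1]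
    have hK := Kell_pos h0 h1
    have hkp := kComp_pos h0 h1
    have hw := wf_pos h0 h1 x
    have hpi := Real.pi_pos
    norm_cast
    field_simp
    norm_num
  have := eq_of_hasDerivAt_zero hd hφ pi_div_two_mem
  have e : Xf k (π / 2) = 0 := by simp [Xf]
  rw [e, uf_pi_div_two h0 h1, Complex.ofReal_zero, hv.map_zero, zero_add] at this
  rw [eq_sub_of_add_eq this]
  have hpi := Real.pi_pos
  norm_cast
  field_simp
  ring

/-- The derivative of `v` on the imaginary axis. -/
lemma IsVmap.deriv_imag {κ : ℝ} (hκ : 0 < κ) (hκ1 : κ < 1) (hv : IsVmap κ v) (s : ℝ) :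
    deriv v (s * Complex.I) =
      ((1 / (4 * Kell κ) * (1 / √((κ + s ^ 2) * (1 + κ * s ^ 2))) : ℝ) : ℂ) := by
  have hK := Kell_pos hκ hκ1
  have hpos : ∀ s : ℝ, 0 < (κ + s ^ 2) * (1 + κ * s ^ 2) := fun s => by positivity
  have hc : ContinuousOn (fun s : ℝ => deriv v (s * Complex.I)) univ := by
    have := hv.analytic.deriv.continuousOn
    exact this.comp (by fun_prop) (fun s _ => imag_mem_slitDom hκ s)
  refine isPreconnected_univ.eq_of_sq_eq hc (g := fun s : ℝ =>
    ((1 / (4 * Kell κ) * (1 / √((κ + s ^ 2) * (1 + κ * s ^ 2))) : ℝ) : ℂ)) ?_ ?_ ?_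
    (mem_univ 0) ?_ (mem_univ s)
  · refine (Complex.continuous_ofReal.comp (continuous_const.mul (continuous_const.div ?_ ?_))
      ).continuousOn
    · fun_prop
    · intro s; exact (Real.sqrt_pos.2 (hpos s)).ne'
  · intro s _
    have h := hv.deriv_sq hκ hκ1 (imag_mem_slitDom hκ s)
    have e : (1 / (4 * Kell κ) * (1 / √((κ + s ^ 2) * (1 + κ * s ^ 2)))) ^ 2 =
        1 / (16 * Kell κ ^ 2 * ((κ + s ^ 2) * (1 + κ * s ^ 2))) := by
      have := Real.sq_sqrt (hpos s).le
      rw [mul_pow, div_pow, div_pow, this]; field_simp; norm_num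
    simp only [Pi.pow_apply]
    rw [← Complex.ofReal_pow, e]
    have hne : 16 * Kell κ ^ 2 * ((κ + s ^ 2) * (1 + κ * s ^ 2)) ≠ 0 := by
      have := hpos s
      positivity
    rw [Complex.ofReal_div, Complex.ofReal_one, eq_div_iff (by exact_mod_cast hne), ← h]
    rw [mul_pow, Complex.I_sq]
    push_cast; ring
  · intro s _
    have := Real.sqrt_pos.2 (hpos s)
    exact_mod_cast (by positivity : (1 / (4 * Kell κ) * (1 / √((κ + s ^ 2) * (1 + κ * s ^ 2)))) ≠ 0)
  · have := (hv.deriv_real 0 (by simpa using hκ)).deriv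
    simp only [Complex.ofReal_zero, zero_mul] at this ⊢
    rw [this]
    norm_num
    ring

/-- The value of `v` at the imaginary unit. -/
lemma IsVmap.apply_I (h0 : 0 < k) (h1 : k < 1) (hv : IsVmap (kLanden k) v) :
    v Complex.I = Tell k * Complex.I := by
  have hκ := kLanden_pos h0 h1
  have hκ1 := kLanden_lt_one h0 h1
  set g : ℝ → ℝ := fun s => 1 / √((kLanden k + s ^ 2) * (1 + kLanden k * s ^ 2)) with hg
  have hgc : Continuous g := by
    refine continuous_const.div (by fun_prop) fun s => ?_
    have : 0 < (kLanden k + s ^ 2) * (1 + kLanden k * s ^ 2) := by positivity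
    exact (Real.sqrt_pos.2 this).ne'
  have hd : ∀ s ∈ uIcc (0 : ℝ) 1, HasDerivAt (fun s : ℝ => v (s * Complex.I))
      (Complex.I * ((1 / (4 * Kell (kLanden k)) * g s : ℝ) : ℂ)) s := by
    intro s _
    rw [hg, ← hv.deriv_imag hκ hκ1 s]
    have hl : HasDerivAt (fun s : ℝ => (s : ℂ) * Complex.I) (1 * Complex.I) s :=
      (Complex.ofRealCLM.hasDerivAt).mul_const _
    refine ((hv.differentiableAt (imag_mem_slitDom hκ s)).comp s hl).congr_deriv ?_
    ring
  have := intervalIntegral.integral_eq_sub_of_hasDerivAt hd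
    (Continuous.intervalIntegrable (by fun_prop) _ _)
  simp only [Complex.ofReal_one, one_mul, Complex.ofReal_zero, zero_mul, hv.map_zero,
    sub_zero] at this
  rw [← this, intervalIntegral.integral_const_mul, intervalIntegral.integral_ofReal,
    intervalIntegral.integral_const_mul, hg, integral_imag_kLanden h0 h1, Kell_kLanden h0 h1,
    mul_comm, Tell]
  have hK := Kell_pos h0 h1
  have hkp := kComp_pos h0 h1
  congr 2
  field_simp

lemma circle_mem_slitDom {κ r φ : ℝ} (hr : 0 < r) (hφ : φ ∈ Ioo 0 π) :
    (r : ℂ) * Complex.exp (φ * Complex.I) ∈ slitDom κ := by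
  refine mem_slitDom_of_im ?_
  rw [Complex.im_ofReal_mul, Complex.exp_ofReal_mul_I_im]
  exact (mul_pos hr (Real.sin_pos_of_pos_of_lt_pi hφ.1 hφ.2)).ne'

lemma hasDerivAt_exp_mul_I (φ : ℝ) : HasDerivAt (fun φ : ℝ => Complex.exp (φ * Complex.I))
    (Complex.exp (φ * Complex.I) * Complex.I) φ := by
  have hl : HasDerivAt (fun s : ℝ => (s : ℂ) * Complex.I) (1 * Complex.I) φ :=
    (Complex.ofRealCLM.hasDerivAt).mul_const _
  simpa using hl.cexp

/-- The tangential derivative of `v` on the unit circle. -/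
lemma IsVmap.deriv_circle (h0 : 0 < k) (h1 : k < 1) (hv : IsVmap (kLanden k) v) {φ : ℝ}
    (hφ : φ ∈ Ioo 0 π) :
    deriv v (Complex.exp (φ * Complex.I)) * (Complex.exp (φ * Complex.I) * Complex.I) =
      ((-(1 / (4 * Kell k) * (1 / wf k φ)) : ℝ) : ℂ) := by
  have hK := Kell_pos h0 h1
  have hκ := kLanden_pos h0 h1
  have hκ1 := kLanden_lt_one h0 h1
  have hkp := kComp_pos h0 h1
  have hmem : ∀ φ ∈ Ioo 0 π, Complex.exp ((φ : ℝ) * Complex.I) ∈ slitDom (kLanden k) :=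
    fun φ hφ => by simpa using circle_mem_slitDom (κ := kLanden k) one_pos hφ
  have hc : ContinuousOn (fun φ : ℝ => deriv v (Complex.exp (φ * Complex.I)) *
      (Complex.exp (φ * Complex.I) * Complex.I)) (Ioo 0 π) := by
    have := hv.analytic.deriv.continuousOn
    exact (this.comp (by fun_prop) hmem).mul (by fun_prop)
  refine isPreconnected_Ioo.eq_of_sq_eq hc (g := fun φ : ℝ =>
    ((-(1 / (4 * Kell k) * (1 / wf k φ)) : ℝ) : ℂ)) ?_ ?_ ?_ pi_div_two_mem ?_ hφ
  · exact (Complex.continuous_ofReal.comp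
      ((continuous_one_div_wf h0 h1).const_mul _).neg).continuousOn
  · intro φ hφ
    have h := hv.deriv_sq hκ hκ1 (hmem φ hφ)
    have hw := wf_pos h0 h1 φ
    simp only [Pi.pow_apply]
    set z := Complex.exp (φ * Complex.I) with hz
    have hz0 : z ≠ 0 := Complex.exp_ne_zero _
    have hz' : z + z⁻¹ = 2 * Complex.cos φ := by
      rw [hz, ← Complex.exp_neg, Complex.cos]; ring_nf
    have e : (kLanden k - z ^ 2) * (1 - kLanden k * z ^ 2) =
        -z ^ 2 * ((4 / (1 + kComp k) ^ 2 * wf k φ ^ 2 : ℝ) : ℂ) := by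
      have e1 : (4 / (1 + kComp k) ^ 2 * wf k φ ^ 2 : ℝ) =
          (1 + kLanden k) ^ 2 - 4 * kLanden k * Real.cos φ ^ 2 := by
        rw [wf_sq h0 h1, one_add_kLanden h0 h1, kLanden_eq_sq h0 h1]; field_simp; ring
      rw [e1]
      push_cast
      have e2 : Complex.cos φ = (z + z⁻¹) / 2 := by rw [hz']; ring
      rw [e2]
      field_simp
      ring
    rw [e] at h
    have h3 : (4 * Kell k * wf k φ) ^ 2 ≠ 0 := by positivity
    have h4 : ((-(1 / (4 * Kell k) * (1 / wf k φ)) : ℝ)) ^ 2 = 1 / (4 * Kell k * wf k φ) ^ 2 := by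
      field_simp
    rw [← Complex.ofReal_pow, h4, Complex.ofReal_div, Complex.ofReal_one,
      eq_div_iff (by exact_mod_cast h3), ← h, Kell_kLanden h0 h1, mul_pow, mul_pow, Complex.I_sq]
    have h5 : (1 + kComp k : ℂ) ≠ 0 := by exact_mod_cast (by linarith : 1 + kComp k ≠ 0)
    push_cast
    field_simp
    ring
  · intro φ _
    have hw := wf_pos h0 h1 φ
    exact_mod_cast neg_ne_zero.2 (by positivity : (1 / (4 * Kell k) * (1 / wf k φ)) ≠ 0)
  · have e1 : Complex.exp ((π / 2 : ℝ) * Complex.I) = Complex.I := by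
      push_cast; exact Complex.exp_pi_div_two_mul_I
    have e2 := hv.deriv_imag hκ hκ1 1
    have e3 : wf k (π / 2) = 1 := by simp [wf]
    rw [Complex.ofReal_one, one_mul] at e2
    have e4 : √((kLanden k + 1 ^ 2) * (1 + kLanden k * 1 ^ 2)) = 1 + kLanden k := by
      rw [show (kLanden k + 1 ^ 2) * (1 + kLanden k * 1 ^ 2) = (1 + kLanden k) ^ 2 by ring,
        Real.sqrt_sq (by linarith)]
    rw [e1, e2, e3, Complex.I_mul_I, e4, Kell_kLanden h0 h1, one_add_kLanden h0 h1]
    norm_cast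
    field_simp
    norm_num

/-- The values of `v` on the upper half of the unit circle. -/
lemma IsVmap.apply_circle (h0 : 0 < k) (h1 : k < 1) (hv : IsVmap (kLanden k) v) {φ : ℝ}
    (hφ : φ ∈ Ioo 0 π) :
    v (Complex.exp (φ * Complex.I)) = ((1 / 4 - uf k φ / (2 * π) : ℝ) : ℂ) + Tell k * Complex.I := by
  have hK := Kell_pos h0 h1
  have hpi := Real.pi_pos
  have hd : ∀ x ∈ Ioo 0 π, HasDerivAt (fun φ : ℝ => v (Complex.exp (φ * Complex.I)) +
      ((uf k φ / (2 * π) : ℝ) : ℂ)) 0 x := by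
    intro x hx
    have hu := ((hasDerivAt_uf h0 h1 x).div_const (2 * π)).ofReal_comp
    have hm : Complex.exp (x * Complex.I) ∈ slitDom (kLanden k) := by
      simpa using circle_mem_slitDom (κ := kLanden k) one_pos hx
    have := ((hv.differentiableAt hm).comp x (hasDerivAt_exp_mul_I x)).add hu
    refine this.congr_deriv ?_
    have hw := wf_pos h0 h1 x
    rw [hv.deriv_circle h0 h1 hx]
    norm_cast
    field_simp
    norm_num
  have := eq_of_hasDerivAt_zero hd hφ pi_div_two_mem
  have e1 : Complex.exp ((π / 2 : ℝ) * Complex.I) = Complex.I := by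
    push_cast; exact Complex.exp_pi_div_two_mul_I
  rw [e1, hv.apply_I h0 h1, uf_pi_div_two h0 h1] at this
  rw [eq_sub_of_add_eq this, show π / 2 / (2 * π) = 1 / 4 by field_simp; norm_num]
  push_cast
  ring

lemma fmFun_of_eq {m : ℕ} {u T : ℝ} {z : ℂ}
    (h : v z = ((1 / 4 - u / (2 * π) : ℝ) : ℂ) + T * Complex.I) :
    fmFun v m z = (((-1) ^ m * (Real.cos (m * u) * Real.cosh (m * (2 * π * T))) -
      Real.cos (π * m / 2) : ℝ) : ℂ) +
      (((-1) ^ m * (Real.sin (m * u) * Real.sinh (m * (2 * π * T))) : ℝ) : ℂ) * Complex.I := by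
  have hpi : (π : ℂ) ≠ 0 := by exact_mod_cast Real.pi_ne_zero
  have e : 2 * (π : ℂ) * m * (v z + 1 / 4) =
      m * π - ((m * u : ℝ) - (m * (2 * π * T) : ℝ) * Complex.I) := by
    rw [h]; push_cast; field_simp; ring
  rw [fmFun, e, show ∀ x : ℂ, Complex.cos (m * π - x) = (-1) ^ m * Complex.cos x from fun x => by
      rw [Complex.cos_sub, Complex.sin_nat_mul_pi,
        show Complex.cos (m * π) = (-1) ^ m by exact_mod_cast Real.cos_nat_mul_pi m]
      simp,
    Complex.cos_sub, Complex.cos_mul_I,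
    Complex.sin_mul_I]
  push_cast
  ring

/-- The values of `f_m` on the real interval. -/
lemma IsVmap.fmFun_Xf (h0 : 0 < k) (h1 : k < 1) (hv : IsVmap (kLanden k) v) (m : ℕ) {φ : ℝ}
    (hφ : φ ∈ Ioo 0 π) : fmFun v m (Xf k φ) =
      (((-1) ^ m * Real.cos (m * uf k φ) - Real.cos (π * m / 2) : ℝ) : ℂ) := by
  rw [fmFun_of_eq (u := uf k φ) (T := 0) (by simpa using hv.apply_Xf h0 h1 hφ)]
  simp

/-- The values of `f_m` on the unit circle. -/
lemma IsVmap.fmFun_circle (h0 : 0 < k) (h1 : k < 1) (hv : IsVmap (kLanden k) v) (m : ℕ) {φ : ℝ}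
    (hφ : φ ∈ Ioo 0 π) : fmFun v m (Complex.exp (φ * Complex.I)) =
      (((-1) ^ m * (Real.cos (m * uf k φ) * Real.cosh (m * (2 * π * Tell k))) -
      Real.cos (π * m / 2) : ℝ) : ℂ) +
      (((-1) ^ m * (Real.sin (m * uf k φ) * Real.sinh (m * (2 * π * Tell k))) : ℝ) : ℂ) *
        Complex.I :=
  fmFun_of_eq (hv.apply_circle h0 h1 hφ)

lemma IsVmap.continuousOn_fmFun {κ : ℝ} (hv : IsVmap κ v) (m : ℕ) :
    ContinuousOn (fmFun v m) (slitDom κ) := by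
  have := hv.analytic.continuousOn
  unfold fmFun
  fun_prop

/-- `f_m` stays bounded on the upper half of an annulus. -/
lemma IsVmap.bound_fmFun (h0 : 0 < k) (h1 : k < 1) (hv : IsVmap (kLanden k) v) (m : ℕ) :
    ∃ r₀ : ℝ, 0 < r₀ ∧ r₀ < 1 ∧ ∃ C : ℝ, ∀ r ∈ Ioo r₀ 1, ∀ φ ∈ Ioo 0 π,
      ‖fmFun v m (r * Complex.exp (φ * Complex.I))‖ ≤ C := by
  have hκ := kLanden_pos h0 h1
  have hκ1 := kLanden_lt_one h0 h1
  set κ := kLanden k with hκd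
  have hK := Kell_pos hκ hκ1
  have hs1 : √κ < 1 := by rw [Real.sqrt_lt' one_pos]; simpa using hκ1
  obtain ⟨r₀, hr1, hr2⟩ := exists_between hs1
  have hr0 : 0 < r₀ := (Real.sqrt_nonneg _).trans_lt hr1
  have hrκ : κ < r₀ ^ 2 := (Real.sqrt_lt' hr0).1 hr1
  obtain ⟨B, hB⟩ := (isCompact_Icc (a := (0 : ℝ)) (b := 1)).exists_bound_of_continuousOn
    (f := fun s : ℝ => v (s * Complex.I))
    (hv.analytic.continuousOn.comp (by fun_prop) (fun s _ => imag_mem_slitDom hκ s))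
  set D := (r₀ ^ 2 - κ) * (1 - κ) with hD
  have hDpos : 0 < D := mul_pos (by linarith) (by linarith)
  set M := √(1 / (16 * Kell κ ^ 2 * D)) with hM
  have hderiv : ∀ r ∈ Ioo r₀ 1, ∀ φ ∈ Ioo 0 π,
      ‖deriv v (r * Complex.exp (φ * Complex.I))‖ ≤ M := by
    intro r hr φ hφ
    have h := hv.deriv_sq hκ hκ1 (circle_mem_slitDom (κ := κ) (hr0.trans hr.1) hφ)
    set z := (r : ℂ) * Complex.exp (φ * Complex.I) with hz
    have hzn : ‖z‖ = r := by
      rw [hz, norm_mul, Complex.norm_exp_ofReal_mul_I, mul_one, Complex.norm_real,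
        Real.norm_of_nonneg (hr0.trans hr.1).le]
    have h' := congrArg norm h
    rw [norm_mul, norm_pow, norm_mul, norm_mul, norm_mul, norm_pow, Complex.norm_real,
      Real.norm_of_nonneg hK.le, norm_one, Complex.norm_ofNat] at h'
    have a1 : r₀ ^ 2 - κ ≤ ‖(κ : ℂ) - z ^ 2‖ := by
      have := norm_sub_norm_le (z ^ 2) (κ : ℂ)
      rw [norm_sub_rev, norm_pow, hzn, Complex.norm_real, Real.norm_of_nonneg hκ.le] at this
      nlinarith [hr.1]
    have a2 : 1 - κ ≤ ‖1 - (κ : ℂ) * z ^ 2‖ := by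
      have := norm_sub_norm_le 1 ((κ : ℂ) * z ^ 2)
      rw [norm_mul, norm_pow, hzn, Complex.norm_real, Real.norm_of_nonneg hκ.le, norm_one] at this
      have : r ^ 2 ≤ 1 := by nlinarith [hr.1, hr.2]
      nlinarith
    have a3 : D ≤ ‖(κ : ℂ) - z ^ 2‖ * ‖1 - (κ : ℂ) * z ^ 2‖ :=
      mul_le_mul a1 a2 (by linarith) (norm_nonneg _)
    refine Real.le_sqrt_of_sq_le ?_
    rw [le_div_iff₀ (by positivity), ← h']
    gcongr
  obtain ⟨C, hC⟩ := (isCompact_closedBall (0 : ℂ) (B + M * π)).exists_bound_of_continuousOn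
    (f := fun z : ℂ => Complex.cos (2 * (π : ℂ) * m * (z + 1 / 4)) -
      Complex.cos ((π : ℂ) * m / 2)) (by fun_prop)
  refine ⟨r₀, hr0, hr2, C, fun r hr φ hφ => hC _ ?_⟩
  have hrp := hr0.trans hr.1
  have hmv := (convex_Ioo 0 π).norm_image_sub_le_of_norm_hasDerivWithin_le
    (f := fun φ : ℝ => v (r * Complex.exp (φ * Complex.I))) (C := M)
    (fun x hx => ((hv.differentiableAt (circle_mem_slitDom hrp hx)).comp x
      ((hasDerivAt_exp_mul_I x).const_mul (r : ℂ))).hasDerivWithinAt)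
    (fun x hx => by
      rw [norm_mul, norm_mul, norm_mul, Complex.norm_exp_ofReal_mul_I, Complex.norm_I, mul_one,
        mul_one, Complex.norm_real, Real.norm_of_nonneg hrp.le]
      have := hderiv r hr x hx
      nlinarith [norm_nonneg (deriv v (r * Complex.exp (x * Complex.I))), hr.2])
    pi_div_two_mem hφ
  have e1 : Complex.exp ((π / 2 : ℝ) * Complex.I) = Complex.I := by
    push_cast; exact Complex.exp_pi_div_two_mul_I
  rw [e1] at hmv
  have h2 := hB r ⟨hrp.le, hr.2.le⟩
  have h3 : ‖φ - π / 2‖ ≤ π := by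
    rw [Real.norm_eq_abs, abs_le]; constructor <;> linarith [hφ.1, hφ.2, Real.pi_pos]
  have h4 : M * ‖φ - π / 2‖ ≤ M * π := mul_le_mul_of_nonneg_left h3 (Real.sqrt_nonneg _)
  rw [mem_closedBall_zero_iff]
  have h5 := norm_le_norm_add_norm_sub' (v (r * Complex.exp (φ * Complex.I)))
    (v (r * Complex.I))
  linarith

/-- Radial limits of `f_m` on the unit circle. -/
lemma IsVmap.tendsto_fmFun {κ : ℝ} (hv : IsVmap κ v) (m : ℕ) {φ : ℝ} (hφ : φ ∈ Ioo 0 π) :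
    Filter.Tendsto (fun r : ℝ => fmFun v m (r * Complex.exp (φ * Complex.I)))
      (nhdsWithin 1 (Iio 1)) (nhds (fmFun v m (Complex.exp (φ * Complex.I)))) := by
  have hm := circle_mem_slitDom (κ := κ) one_pos hφ
  rw [Complex.ofReal_one, one_mul] at hm
  have hop : DifferentiableAt ℂ v (Complex.exp (φ * Complex.I)) :=
    (hv.analytic _ hm).differentiableAt
  have hc : ContinuousAt (fmFun v m) (Complex.exp (φ * Complex.I)) := by
    have := hop.continuousAt
    unfold fmFun
    fun_prop
  have hl : Filter.Tendsto (fun r : ℝ => (r : ℂ) * Complex.exp (φ * Complex.I))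
      (nhds 1) (nhds (Complex.exp (φ * Complex.I))) :=
    Continuous.tendsto' (by fun_prop) _ _ (by simp)
  exact (hc.tendsto.comp hl).mono_left nhdsWithin_le_nhds

end vmap

section green

variable {k : ℝ}

/-- The Fourier integrals of the free Green's function on a half plane. -/
def Gn (k : ℝ) (n : ℕ) (y : ℤ) : ℝ :=
  1 / π * ∫ φ in (0 : ℝ)..π, Xf k φ ^ n * Real.cos (y * φ) * (1 / wf k φ)

/-- The Fourier coefficients of the powers of `Xf`. -/
def Jn (k : ℝ) (n : ℕ) (y : ℤ) : ℝ := 1 / π * ∫ φ in (0 : ℝ)..π, Xf k φ ^ n * Real.cos (y * φ)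

/-- The free Green's function of the diagonal walk. -/
def Gf (k : ℝ) (x y : ℤ) : ℝ := Gn k x.natAbs y

lemma continuous_Gn_integrand (h0 : 0 < k) (h1 : k < 1) (n : ℕ) (y : ℤ) :
    Continuous fun φ => Xf k φ ^ n * Real.cos (y * φ) * (1 / wf k φ) := by
  have h1' := continuous_Xf h0 h1
  have h2' := continuous_one_div_wf h0 h1
  fun_prop

lemma cos_add_one_mul (y : ℤ) (φ : ℝ) : Real.cos ((y + 1 : ℤ) * φ) =
    Real.cos (y * φ) * Real.cos φ - Real.sin (y * φ) * Real.sin φ := by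
  rw [← Real.cos_add]; push_cast; ring_nf

lemma cos_sub_one_mul (y : ℤ) (φ : ℝ) : Real.cos ((y - 1 : ℤ) * φ) =
    Real.cos (y * φ) * Real.cos φ + Real.sin (y * φ) * Real.sin φ := by
  rw [← Real.cos_sub]; push_cast; ring_nf

lemma Gn_combine (h0 : 0 < k) (h1 : k < 1) (a b : ℕ) (y : ℤ) (c d : ℝ) :
    c * (Gn k a (y + 1) + Gn k a (y - 1)) + d * (Gn k b (y - 1) + Gn k b (y + 1)) =
      1 / π * ∫ φ in (0 : ℝ)..π, 2 * Real.cos φ * (c * Xf k φ ^ a + d * Xf k φ ^ b) *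
        Real.cos (y * φ) * (1 / wf k φ) := by
  have hc := fun x y => (continuous_Gn_integrand h0 h1 x y).intervalIntegrable
    (μ := MeasureTheory.volume) 0 π
  simp only [Gn]
  rw [← mul_add, ← mul_add, mul_left_comm c, mul_left_comm d, ← mul_add]
  congr 1
  rw [← intervalIntegral.integral_add (hc _ _) (hc _ _),
    ← intervalIntegral.integral_add (hc _ _) (hc _ _), ← intervalIntegral.integral_const_mul,
    ← intervalIntegral.integral_const_mul, ← intervalIntegral.integral_add
      (((hc _ _).add (hc _ _)).const_mul _) (((hc _ _).add (hc _ _)).const_mul _)]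
  refine intervalIntegral.integral_congr fun φ _ => ?_
  simp only [cos_add_one_mul, cos_sub_one_mul]
  ring

lemma integral_cos_int (y : ℤ) :
    1 / π * ∫ φ in (0 : ℝ)..π, Real.cos (y * φ) = if y = 0 then 1 else 0 := by
  split_ifs with h
  · subst h
    simp [Real.pi_ne_zero]
  · have hy : (y : ℝ) ≠ 0 := by exact_mod_cast h
    rw [intervalIntegral.integral_comp_mul_left (fun x => Real.cos x) hy, integral_cos,
      Real.sin_int_mul_pi]
    simp

lemma wf_one_sub (h0 : 0 < k) (h1 : k < 1) (φ : ℝ) : k * Real.cos φ * Xf k φ = 1 - wf k φ := by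
  have h := wf_sq h0 h1 φ
  have hp : 1 + wf k φ ≠ 0 := by linarith [wf_pos h0 h1 φ]
  rw [Xf]; field_simp; linarith

lemma Gf_rec (h0 : 0 < k) (h1 : k < 1) (x y : ℤ) :
    Gf k x y = k / 4 * (Gf k (x + 1) (y + 1) + (Gf k (x + 1) (y - 1) + (Gf k (x - 1) (y - 1) +
      Gf k (x - 1) (y + 1)))) + if x = 0 ∧ y = 0 then 1 else 0 := by
  have hsucc : ∀ n : ℕ, Gn k (n + 1) y = k / 4 * (Gn k (n + 2) (y + 1) + (Gn k (n + 2) (y - 1) +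
      (Gn k n (y - 1) + Gn k n (y + 1)))) := by
    intro n
    have := Gn_combine h0 h1 (n + 2) n y (k / 4) (k / 4)
    rw [← add_assoc (Gn k (n + 2) (y + 1)), mul_add, this, Gn]
    congr 1
    refine intervalIntegral.integral_congr fun φ _ => ?_
    have e := Xf_rel h0 h1 φ
    linear_combination (-(1 / 2) * Xf k φ ^ n * Real.cos (y * φ) * (1 / wf k φ)) * e
  rcases lt_trichotomy x 0 with hx | rfl | hx
  · obtain ⟨n, rfl⟩ : ∃ n : ℕ, x = -((n : ℤ) + 1) := ⟨(-x - 1).toNat, by omega⟩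
    rw [if_neg (by omega), add_zero]
    simp only [Gf]
    rw [show (-((n : ℤ) + 1)).natAbs = n + 1 by omega,
      show (-((n : ℤ) + 1) + 1).natAbs = n by omega,
      show (-((n : ℤ) + 1) - 1).natAbs = n + 2 by omega, hsucc]
    ring
  · have := Gn_combine h0 h1 1 1 y (k / 4) (k / 4)
    simp only [Gf, true_and]
    rw [show ((0 : ℤ) + 1).natAbs = 1 by rfl, show ((0 : ℤ) - 1).natAbs = 1 by rfl,
      ← add_assoc (Gn k 1 (y + 1)), mul_add, this, ← integral_cos_int, Int.natAbs_zero, Gn,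
      ← mul_add]
    congr 1
    have h1' := continuous_Xf h0 h1
    have h2' := continuous_one_div_wf h0 h1
    rw [← intervalIntegral.integral_add (Continuous.intervalIntegrable (by fun_prop) _ _)
      (Continuous.intervalIntegrable (by fun_prop) _ _)]
    refine intervalIntegral.integral_congr fun φ _ => ?_
    have e := wf_one_sub h0 h1 φ
    have hw := wf_pos h0 h1 φ
    field_simp
    linear_combination (-4 * Real.cos (y * φ)) * e
  · obtain ⟨n, rfl⟩ : ∃ n : ℕ, x = (n : ℤ) + 1 := ⟨(x - 1).toNat, by omega⟩
    rw [if_neg (by omega), add_zero]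
    simp only [Gf]
    rw [show ((n : ℤ) + 1).natAbs = n + 1 by omega,
      show ((n : ℤ) + 1 + 1).natAbs = n + 2 by omega,
      show ((n : ℤ) + 1 - 1).natAbs = n by omega, hsucc]

lemma abs_Gf_le (h0 : 0 < k) (h1 : k < 1) :
    ∃ C, 0 ≤ C ∧ ∀ x y, |Gf k x y| ≤ C * k ^ x.natAbs := by
  have hc := continuous_one_div_wf h0 h1
  obtain ⟨C, hC⟩ := (isCompact_Icc (a := (0 : ℝ)) (b := π)).exists_bound_of_continuousOn
    hc.continuousOn
  have hC0 : 0 ≤ C := (norm_nonneg _).trans (hC 0 ⟨le_rfl, Real.pi_pos.le⟩)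
  refine ⟨C, hC0, fun x y => ?_⟩
  have := intervalIntegral.norm_integral_le_of_norm_le_const (a := 0) (b := π)
    (f := fun φ => Xf k φ ^ x.natAbs * Real.cos (y * φ) * (1 / wf k φ)) (C := C * k ^ x.natAbs)
    (fun φ hφ => by
      rw [uIoc_of_le Real.pi_pos.le] at hφ
      rw [norm_mul, norm_mul, norm_pow, mul_comm]
      refine mul_le_mul (hC φ ⟨hφ.1.le, hφ.2⟩) ?_ (by positivity) hC0
      have a1 : ‖Xf k φ‖ ^ x.natAbs ≤ k ^ x.natAbs :=
        pow_le_pow_left₀ (norm_nonneg _) (abs_Xf_le h0 h1 φ) _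
      have a2 : ‖Real.cos (y * φ)‖ ≤ 1 := Real.abs_cos_le_one _
      calc _ ≤ k ^ x.natAbs * 1 := mul_le_mul a1 a2 (norm_nonneg _) (by positivity)
        _ = _ := mul_one _)
  rw [sub_zero, abs_of_pos Real.pi_pos, Real.norm_eq_abs] at this
  rw [Gf, Gn, abs_mul, abs_of_pos (by positivity : 0 < 1 / π), one_div, inv_mul_le_iff₀ Real.pi_pos]
  linarith

lemma abs_Gf_le_const (h0 : 0 < k) (h1 : k < 1) : ∃ C, ∀ x y, |Gf k x y| ≤ C := by
  obtain ⟨C, hC0, hC⟩ := abs_Gf_le h0 h1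
  refine ⟨C, fun x y => (hC x y).trans ?_⟩
  exact mul_le_of_le_one_right hC0 (pow_le_one₀ h0.le h1.le)

lemma Gf_comm (h0 : 0 < k) (h1 : k < 1) (x y : ℤ) : Gf k x y = Gf k y x := by
  obtain ⟨C, hC⟩ := abs_Gf_le_const h0 h1
  refine sub_eq_zero.1 (eq_zero_of_abs_le_sum (t := k / 4) (B := C + C) (by positivity)
    (by linarith) (fun x y => Gf k x y - Gf k y x)
    (fun x y => (abs_sub _ _).trans (add_le_add (hC _ _) (hC _ _))) (fun x y => ?_) x y)
  have e1 := Gf_rec h0 h1 x y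
  have e2 := Gf_rec h0 h1 y x
  have e3 : (if y = 0 ∧ x = 0 then (1 : ℝ) else 0) = if x = 0 ∧ y = 0 then 1 else 0 := by
    simp only [and_comm]
  have e : Gf k x y - Gf k y x =
      k / 4 * ((Gf k (x + 1) (y + 1) - Gf k (y + 1) (x + 1)) +
      ((Gf k (x + 1) (y - 1) - Gf k (y - 1) (x + 1)) +
      ((Gf k (x - 1) (y - 1) - Gf k (y - 1) (x - 1)) +
        (Gf k (x - 1) (y + 1) - Gf k (y + 1) (x - 1))))) := by
    linear_combination e1 - e2 - e3
  rw [e, abs_mul, abs_of_pos (by linarith : 0 < k / 4)]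
  gcongr
  refine (abs_add_le _ _).trans ?_
  gcongr
  refine (abs_add_le _ _).trans ?_
  gcongr
  exact abs_add_le _ _

lemma mul_abs_Gf_le (h0 : 0 < k) (h1 : k < 1) : ∃ C, ∀ x y : ℤ, |x * Gf k x y| ≤ C := by
  obtain ⟨C, hC0, hC⟩ := abs_Gf_le h0 h1
  obtain ⟨B, hB⟩ := (tendsto_self_mul_const_pow_of_lt_one h0.le h1).bddAbove_range
  refine ⟨C * B, fun x y => ?_⟩
  have h := hB ⟨x.natAbs, rfl⟩
  beta_reduce at h
  have hx : |(x : ℝ)| = (x.natAbs : ℝ) := by rw [Nat.cast_natAbs, Int.cast_abs]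
  rw [abs_mul, hx]
  calc _ ≤ (x.natAbs : ℝ) * (C * k ^ x.natAbs) := by gcongr; exact hC x y
    _ = C * ((x.natAbs : ℝ) * k ^ x.natAbs) := by ring
    _ ≤ _ := by gcongr

/-- The discrete rotation field annihilates the free Green's function. -/
lemma Gf_rotation (h0 : 0 < k) (h1 : k < 1) (x y : ℤ) :
    (x : ℝ) * (Gf k (x - 1) (y - 1) + Gf k (x + 1) (y - 1) - Gf k (x - 1) (y + 1) -
      Gf k (x + 1) (y + 1)) -
    y * (Gf k (x - 1) (y - 1) + Gf k (x - 1) (y + 1) - Gf k (x + 1) (y - 1) -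
      Gf k (x + 1) (y + 1)) = 0 := by
  obtain ⟨C, hC⟩ := abs_Gf_le_const h0 h1
  obtain ⟨D, hD⟩ := mul_abs_Gf_le h0 h1
  set G := Gf k with hG
  have hsh : ∀ (a x y : ℤ), |(a : ℝ)| ≤ 1 → |((x - a : ℤ) : ℝ) * G x y| ≤ D + C := by
    intro a x y h
    have : ((x - a : ℤ) : ℝ) * G x y = x * G x y - a * G x y := by push_cast; ring
    rw [this]
    refine (abs_sub _ _).trans (add_le_add (hD x y) ?_)
    rw [abs_mul]
    calc _ ≤ 1 * |G x y| := by gcongr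
      _ ≤ C := by rw [one_mul]; exact hC x y
  have hsh' : ∀ (a x y : ℤ), |(a : ℝ)| ≤ 1 → |((y - a : ℤ) : ℝ) * G x y| ≤ D + C := by
    intro a x y h
    rw [hG, Gf_comm h0 h1 x y]; exact hsh a y x h
  have four : ∀ a b c d E : ℝ, |a| ≤ E → |b| ≤ E → |c| ≤ E → |d| ≤ E →
      |a + b - c - d| ≤ 4 * E := by
    intro a b c d E ha hb hc hd
    rw [abs_le] at *
    constructor <;> linarith
  have one1 : |((1 : ℤ) : ℝ)| ≤ 1 := by simp
  have one2 : |((-1 : ℤ) : ℝ)| ≤ 1 := by simp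
  refine eq_zero_of_abs_le_sum (t := k / 4) (B := 4 * (D + C) + 4 * (D + C)) (by positivity)
    (by linarith) (fun x y => (x : ℝ) * (G (x - 1) (y - 1) + G (x + 1) (y - 1) -
      G (x - 1) (y + 1) - G (x + 1) (y + 1)) -
    y * (G (x - 1) (y - 1) + G (x - 1) (y + 1) - G (x + 1) (y - 1) -
      G (x + 1) (y + 1))) (fun x y => ?_) (fun x y => ?_) x y
  · refine (abs_sub _ _).trans (add_le_add ?_ ?_)
    · rw [mul_sub, mul_sub, mul_add]
      have b1 := fun y => hsh (-1) (x - 1) y one2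
      have b2 := fun y => hsh 1 (x + 1) y one1
      rw [show x - 1 - -1 = x by ring] at b1
      rw [show x + 1 - 1 = x by ring] at b2
      exact four _ _ _ _ _ (b1 _) (b2 _) (b1 _) (b2 _)
    · rw [mul_sub, mul_sub, mul_add]
      have b1 := fun x => hsh' (-1) x (y - 1) one2
      have b2 := fun x => hsh' 1 x (y + 1) one1
      rw [show y - 1 - -1 = y by ring] at b1
      rw [show y + 1 - 1 = y by ring] at b2
      exact four _ _ _ _ _ (b1 _) (b2 _) (b1 _) (b2 _)
  · have r1 := Gf_rec h0 h1 (x - 1) (y - 1)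
    have r2 := Gf_rec h0 h1 (x + 1) (y - 1)
    have r3 := Gf_rec h0 h1 (x - 1) (y + 1)
    have r4 := Gf_rec h0 h1 (x + 1) (y + 1)
    rw [← hG] at r1 r2 r3 r4
    have d1 : ((x : ℝ) - y) * (if x - 1 = 0 ∧ y - 1 = 0 then (1 : ℝ) else 0) = 0 := by
      split_ifs with h
      · rw [show x = y by omega]; simp
      · simp
    have d2 : ((x : ℝ) + y) * (if x + 1 = 0 ∧ y - 1 = 0 then (1 : ℝ) else 0) = 0 := by
      split_ifs with h
      · rw [show x = -y by omega]; simp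
      · simp
    have d3 : ((x : ℝ) + y) * (if x - 1 = 0 ∧ y + 1 = 0 then (1 : ℝ) else 0) = 0 := by
      split_ifs with h
      · rw [show x = -y by omega]; simp
      · simp
    have d4 : ((x : ℝ) - y) * (if x + 1 = 0 ∧ y + 1 = 0 then (1 : ℝ) else 0) = 0 := by
      split_ifs with h
      · rw [show x = y by omega]; simp
      · simp
    set F : ℤ → ℤ → ℝ := fun x y => (x : ℝ) * (G (x - 1) (y - 1) + G (x + 1) (y - 1) -
      G (x - 1) (y + 1) - G (x + 1) (y + 1)) -
      y * (G (x - 1) (y - 1) + G (x - 1) (y + 1) - G (x + 1) (y - 1) -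
      G (x + 1) (y + 1)) with hF
    have e : F x y = k / 4 * (F (x + 1) (y + 1) + (F (x + 1) (y - 1) + (F (x - 1) (y - 1) +
        F (x - 1) (y + 1)))) := by
      simp only [hF]
      push_cast
      simp only [add_sub_cancel_right, sub_add_cancel] at r1 r2 r3 r4 ⊢
      linear_combination (x - y : ℝ) * r1 + (x + y : ℝ) * r2 - (x + y : ℝ) * r3 -
        (x - y : ℝ) * r4 + d1 + d2 - d3 - d4
    change |F x y| ≤ k / 4 * (|F (x + 1) (y + 1)| + (|F (x + 1) (y - 1)| +
      (|F (x - 1) (y - 1)| + |F (x - 1) (y + 1)|)))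
    rw [e, abs_mul, abs_of_pos (by linarith : 0 < k / 4)]
    gcongr
    refine (abs_add_le _ _).trans ?_
    gcongr
    refine (abs_add_le _ _).trans ?_
    gcongr
    exact abs_add_le _ _

lemma Jn_eq (h0 : 0 < k) (h1 : k < 1) {n : ℕ} (hn : 1 ≤ n) (y : ℤ) :
    Jn k n y = k / 4 * (Gf k (n - 1) (y - 1) + Gf k (n - 1) (y + 1) - Gf k (n + 1) (y - 1) -
      Gf k (n + 1) (y + 1)) := by
  obtain ⟨n, rfl⟩ : ∃ j, n = j + 1 := ⟨n - 1, by omega⟩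
  have := Gn_combine h0 h1 n (n + 2) y (k / 4) (-(k / 4))
  simp only [Gf]
  rw [show (((n + 1 : ℕ) : ℤ) - 1).natAbs = n by omega,
    show (((n + 1 : ℕ) : ℤ) + 1).natAbs = n + 2 by omega]
  refine Eq.trans ?_ (this.symm.trans (by ring))
  rw [Jn]
  congr 1
  refine intervalIntegral.integral_congr fun φ _ => ?_
  have hw := wf_pos h0 h1 φ
  have e1 := one_sub_Xf_sq h0 h1 φ
  have e2 : Xf k φ * (1 + wf k φ) = k * Real.cos φ := by rw [Xf]; field_simp
  have e3 : (1 + wf k φ) ≠ 0 := by positivity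
  rw [pow_succ, pow_add]
  have e4 : Xf k φ = k / 2 * Real.cos φ * (1 - Xf k φ ^ 2) * (1 / wf k φ) := by
    have := Xf_rel h0 h1 φ
    rw [e1]; field_simp; linarith
  linear_combination (Xf k φ ^ n * Real.cos (y * φ)) * e4

/-- The reciprocity of the Fourier coefficients of the powers of `Xf`. -/
lemma Jn_comm (h0 : 0 < k) (h1 : k < 1) {n l : ℕ} (hn : 1 ≤ n) (hl : 1 ≤ l) :
    (l : ℝ) * Jn k n l = n * Jn k l n := by
  have h := Gf_rotation h0 h1 n l
  rw [Jn_eq h0 h1 hn, Jn_eq h0 h1 hl]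
  rw [Gf_comm h0 h1 (l - 1) (n - 1), Gf_comm h0 h1 (l - 1) (n + 1), Gf_comm h0 h1 (l + 1) (n - 1),
    Gf_comm h0 h1 (l + 1) (n + 1)]
  push_cast at h
  linear_combination (-(k / 4)) * h

end green

section coeff

variable {k : ℝ} {v : ℂ → ℂ} {a : ℕ → ℕ → ℝ}

/-- Half the logarithm of the inverse nome. -/
def tauK (k : ℝ) : ℝ := 2 * π * Tell k

lemma IsCoeff.summable {κ : ℝ} (hκ : 0 < κ) (ha : IsCoeff κ v a) {m : ℕ} (hm : 1 ≤ m) {r : ℝ}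
    (hr0 : 0 ≤ r) (hr1 : r < 1) : Summable fun n => |a n m| * r ^ n := by
  have := (ha m hm (r * Complex.I) (imag_mem_slitDom hκ r) (by
    rw [norm_mul, Complex.norm_I, mul_one, Complex.norm_real, Real.norm_of_nonneg hr0]
    exact hr1)).summable.norm
  refine this.congr fun n => ?_
  rw [norm_mul, norm_pow, norm_mul, Complex.norm_I, mul_one, Complex.norm_real, Complex.norm_real,
    Real.norm_of_nonneg hr0, Real.norm_eq_abs]

/-- Termwise integration of a dominated series of functions. -/
lemma hasSum_integral_mul {ι : Type*} [Countable ι] {c b : ι → ℝ} {F ψ : ℝ → ℝ}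
    {T : ι → ℝ → ℝ} (hb : Summable b)
    (hT : ∀ n, Continuous (T n)) (hψ : Continuous ψ) (hcT : ∀ n φ, |c n * T n φ| ≤ b n)
    (hF : ∀ φ ∈ Ioo 0 π, HasSum (fun n => c n * T n φ) (F φ)) :
    HasSum (fun n => c n * ∫ φ in (0 : ℝ)..π, T n φ * ψ φ) (∫ φ in (0 : ℝ)..π, F φ * ψ φ) := by
  have hae : ∀ᵐ x : ℝ, x ≠ π := by simp [MeasureTheory.ae_iff]
  simp_rw [← intervalIntegral.integral_const_mul]
  refine intervalIntegral.hasSum_integral_of_dominated_convergence (fun n φ => b n * |ψ φ|)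
    (fun n => ?_) (fun n => ?_) ?_ ?_ ?_
  · have := hT n
    exact Continuous.aestronglyMeasurable (by fun_prop)
  · refine Filter.Eventually.of_forall fun φ _ => ?_
    rw [← mul_assoc, norm_mul]
    exact mul_le_mul_of_nonneg_right (hcT n φ) (abs_nonneg _)
  · exact Filter.Eventually.of_forall fun φ _ => hb.mul_right _
  · simp_rw [tsum_mul_right]
    exact Continuous.intervalIntegrable (by fun_prop) _ _
  · filter_upwards [hae] with φ hφ hφ2
    rw [uIoc_of_le Real.pi_pos.le] at hφ2
    simp_rw [← mul_assoc]
    exact (hF φ ⟨hφ2.1, lt_of_le_of_ne hφ2.2 hφ⟩).mul_right _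

/-- Radial limits of integrals of `f_m`. -/
lemma IsVmap.tendsto_integral (h0 : 0 < k) (h1 : k < 1) (hv : IsVmap (kLanden k) v) (m : ℕ)
    (P : ℂ →L[ℝ] ℝ) {ψ : ℝ → ℝ} (hψ : Continuous ψ) :
    Filter.Tendsto (fun r : ℝ => ∫ φ in (0 : ℝ)..π,
        P (fmFun v m (r * Complex.exp (φ * Complex.I))) * ψ φ) (nhdsWithin 1 (Iio 1))
      (nhds (∫ φ in (0 : ℝ)..π, P (fmFun v m (Complex.exp (φ * Complex.I))) * ψ φ)) := by
  obtain ⟨r₀, hr0, hr1, C, hC⟩ := hv.bound_fmFun h0 h1 m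
  have hmem : Ioo r₀ 1 ∈ nhdsWithin (1 : ℝ) (Iio 1) := Ioo_mem_nhdsLT hr1
  have hae : ∀ᵐ x : ℝ, x ≠ π := by simp [MeasureTheory.ae_iff]
  refine intervalIntegral.tendsto_integral_filter_of_dominated_convergence
    (fun φ => ‖P‖ * C * |ψ φ|) ?_ ?_ ?_ ?_
  · filter_upwards [hmem] with r hr
    rw [uIoc_of_le Real.pi_pos.le, ← MeasureTheory.Measure.restrict_congr_set
      MeasureTheory.Ioo_ae_eq_Ioc]
    refine ContinuousOn.aestronglyMeasurable ?_ measurableSet_Ioo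
    refine ContinuousOn.mul (P.continuous.comp_continuousOn ?_) hψ.continuousOn
    exact (hv.continuousOn_fmFun m).comp (by fun_prop)
      fun φ hφ => circle_mem_slitDom (hr0.trans hr.1) hφ
  · filter_upwards [hmem] with r hr
    filter_upwards [hae] with φ hφ hφ2
    rw [uIoc_of_le Real.pi_pos.le] at hφ2
    rw [norm_mul]
    refine mul_le_mul_of_nonneg_right ((P.le_opNorm _).trans ?_) (abs_nonneg _)
    gcongr
    exact hC r hr φ ⟨hφ2.1, lt_of_le_of_ne hφ2.2 hφ⟩
  · exact Continuous.intervalIntegrable (by fun_prop) _ _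
  · filter_upwards [hae] with φ hφ hφ2
    rw [uIoc_of_le Real.pi_pos.le] at hφ2
    exact ((P.continuous.tendsto _).comp
      (hv.tendsto_fmFun m ⟨hφ2.1, lt_of_le_of_ne hφ2.2 hφ⟩)).mul_const _

/-- Integrals of the boundary values of `f_m` in terms of the Taylor coefficients. -/
lemma IsCoeff.tsum_integral (h0 : 0 < k) (h1 : k < 1) (hv : IsVmap (kLanden k) v)
    (ha : IsCoeff (kLanden k) v a) {m : ℕ} (hm : 1 ≤ m) (P : ℂ →L[ℝ] ℝ) (T : ℕ → ℝ → ℝ)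
    (hT : ∀ n, Continuous (T n)) (hT1 : ∀ n φ, |T n φ| ≤ 1)
    (hPT : ∀ (c : ℝ) (n : ℕ) (φ : ℝ), P (c * Complex.exp (φ * Complex.I) ^ n) = c * T n φ)
    {ψ : ℝ → ℝ} (hψ : Continuous ψ)
    (hs : Summable fun n => a n m * ∫ φ in (0 : ℝ)..π, T n φ * ψ φ) :
    ∑' n, a n m * ∫ φ in (0 : ℝ)..π, T n φ * ψ φ =
      ∫ φ in (0 : ℝ)..π, P (fmFun v m (Complex.exp (φ * Complex.I))) * ψ φ := by
  have hκ := kLanden_pos h0 h1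
  have hmem : Ioo 0 1 ∈ nhdsWithin (1 : ℝ) (Iio 1) := Ioo_mem_nhdsLT one_pos
  have hsum : ∀ r ∈ Ioo (0 : ℝ) 1, HasSum (fun n => a n m * r ^ n * ∫ φ in (0 : ℝ)..π, T n φ * ψ φ)
      (∫ φ in (0 : ℝ)..π, P (fmFun v m (r * Complex.exp (φ * Complex.I))) * ψ φ) := by
    intro r hr
    refine hasSum_integral_mul (ha.summable hκ hm hr.1.le hr.2) hT hψ (fun n φ => ?_)
      (fun φ hφ => ?_)
    · rw [abs_mul, abs_mul, abs_pow, abs_of_pos hr.1]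
      exact mul_le_of_le_one_right (by have := hr.1; positivity) (hT1 n φ)
    · have := (ha m hm (r * Complex.exp (φ * Complex.I)) (circle_mem_slitDom hr.1 hφ) (by
        rw [norm_mul, Complex.norm_exp_ofReal_mul_I, mul_one, Complex.norm_real,
          Real.norm_of_nonneg hr.1.le]
        exact hr.2)).mapL P
      refine this.congr_fun fun n => ?_
      rw [← hPT]
      push_cast
      ring_nf
  have l1 := hv.tendsto_integral h0 h1 m P hψ
  have l2 : Filter.Tendsto (fun r : ℝ => ∑' n, a n m * r ^ n * ∫ φ in (0 : ℝ)..π, T n φ * ψ φ)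
      (nhdsWithin 1 (Iio 1)) (nhds (∑' n, a n m * ∫ φ in (0 : ℝ)..π, T n φ * ψ φ)) := by
    refine tendsto_tsum_of_dominated_convergence hs.abs (fun n => ?_) ?_
    · refine Filter.Tendsto.mono_left ?_ nhdsWithin_le_nhds
      exact Continuous.tendsto' (by fun_prop) _ _ (by simp)
    · filter_upwards [hmem] with r hr n
      rw [Real.norm_eq_abs, abs_mul, abs_mul, abs_mul, abs_pow, abs_of_pos hr.1]
      refine mul_le_mul_of_nonneg_right ?_ (abs_nonneg _)
      exact mul_le_of_le_one_right (abs_nonneg _) (pow_le_one₀ hr.1.le hr.2.le)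
  refine tendsto_nhds_unique l2 (l1.congr' ?_)
  filter_upwards [hmem] with r hr
  exact (hsum r hr).tsum_eq.symm

lemma re_exp_pow (c : ℝ) (n : ℕ) (φ : ℝ) :
    Complex.reCLM (c * Complex.exp (φ * Complex.I) ^ n) = c * Real.cos (n * φ) := by
  rw [← Complex.exp_nat_mul, Complex.reCLM_apply, Complex.re_ofReal_mul, ← mul_assoc]
  rw [← Complex.exp_ofReal_mul_I_re]
  push_cast; rfl

lemma im_exp_pow (c : ℝ) (n : ℕ) (φ : ℝ) :
    Complex.imCLM (c * Complex.exp (φ * Complex.I) ^ n) = c * Real.sin (n * φ) := by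
  rw [← Complex.exp_nat_mul, Complex.imCLM_apply, Complex.im_ofReal_mul, ← mul_assoc]
  rw [← Complex.exp_ofReal_mul_I_im]
  push_cast; rfl

lemma integral_cos_mul_cos (j n : ℕ) (hn : 1 ≤ n) :
    ∫ φ in (0 : ℝ)..π, Real.cos (j * φ) * Real.cos (n * φ) = if j = n then π / 2 else 0 := by
  have e : ∀ φ : ℝ, Real.cos (j * φ) * Real.cos (n * φ) =
      1 / 2 * (Real.cos (((j : ℤ) - n : ℤ) * φ) + Real.cos (((j : ℤ) + n : ℤ) * φ)) := by
    intro φ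
    push_cast
    rw [sub_mul, add_mul, Real.cos_sub, Real.cos_add]; ring
  have c1 := integral_cos_int ((j : ℤ) - n)
  have c2 := integral_cos_int ((j : ℤ) + n)
  rw [if_neg (by omega)] at c2
  simp_rw [e]
  rw [intervalIntegral.integral_const_mul, intervalIntegral.integral_add
    (Continuous.intervalIntegrable (by fun_prop) _ _)
    (Continuous.intervalIntegrable (by fun_prop) _ _)]
  have hpi := Real.pi_pos
  by_cases h : j = n
  · rw [if_pos (by omega)] at c1
    rw [if_pos h]
    field_simp at c1 c2
    linarith
  · rw [if_neg (by omega)] at c1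
    rw [if_neg h]
    field_simp at c1 c2
    linarith

lemma integral_sin_mul_sin (j n : ℕ) (hn : 1 ≤ n) :
    ∫ φ in (0 : ℝ)..π, Real.sin (j * φ) * Real.sin (n * φ) = if j = n then π / 2 else 0 := by
  have e : ∀ φ : ℝ, Real.sin (j * φ) * Real.sin (n * φ) =
      1 / 2 * (Real.cos (((j : ℤ) - n : ℤ) * φ) - Real.cos (((j : ℤ) + n : ℤ) * φ)) := by
    intro φ
    push_cast
    rw [sub_mul, add_mul, Real.cos_sub, Real.cos_add]; ring
  have c1 := integral_cos_int ((j : ℤ) - n)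
  have c2 := integral_cos_int ((j : ℤ) + n)
  rw [if_neg (by omega)] at c2
  simp_rw [e]
  rw [intervalIntegral.integral_const_mul, intervalIntegral.integral_sub
    (Continuous.intervalIntegrable (by fun_prop) _ _)
    (Continuous.intervalIntegrable (by fun_prop) _ _)]
  have hpi := Real.pi_pos
  by_cases h : j = n
  · rw [if_pos (by omega)] at c1
    rw [if_pos h]
    field_simp at c1 c2
    linarith
  · rw [if_neg (by omega)] at c1
    rw [if_neg h]
    field_simp at c1 c2
    linarith

/-- The boundary values of `f_m` integrated over the half circle. -/
lemma IsVmap.integral_re (h0 : 0 < k) (h1 : k < 1) (hv : IsVmap (kLanden k) v) (m n : ℕ)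
    (hn : 1 ≤ n) : ∫ φ in (0 : ℝ)..π,
      Complex.reCLM (fmFun v m (Complex.exp (φ * Complex.I))) * Real.cos (n * φ) =
      (-1) ^ m * Real.cosh (m * tauK k) *
        ∫ φ in (0 : ℝ)..π, Real.cos (m * uf k φ) * Real.cos (n * φ) := by
  have hu := continuous_uf h0 h1
  have c1 := integral_cos_int n
  rw [if_neg (by omega)] at c1
  have hpi := Real.pi_pos
  have c2 : ∫ φ in (0 : ℝ)..π, Real.cos (n * φ) = 0 := by
    simpa [hpi.ne'] using c1
  have : (-1) ^ m * Real.cosh (m * tauK k) *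
        (∫ φ in (0 : ℝ)..π, Real.cos (m * uf k φ) * Real.cos (n * φ)) =
      ∫ φ in (0 : ℝ)..π, ((-1) ^ m * Real.cosh (m * tauK k) *
        (Real.cos (m * uf k φ) * Real.cos (n * φ)) - Real.cos (π * m / 2) * Real.cos (n * φ)) := by
    rw [intervalIntegral.integral_sub (Continuous.intervalIntegrable (by fun_prop) _ _)
      (Continuous.intervalIntegrable (by fun_prop) _ _), intervalIntegral.integral_const_mul,
      intervalIntegral.integral_const_mul, c2]
    ring
  rw [this]
  refine intervalIntegral.integral_congr_Ioo_of_le hpi.le fun φ hφ => ?_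
  simp only [Complex.reCLM_apply]
  rw [hv.fmFun_circle h0 h1 m hφ, Complex.add_re, Complex.ofReal_re, Complex.re_ofReal_mul, Complex.I_re, tauK]
  ring

lemma IsVmap.integral_im (h0 : 0 < k) (h1 : k < 1) (hv : IsVmap (kLanden k) v) (m : ℕ)
    (ψ : ℝ → ℝ) : ∫ φ in (0 : ℝ)..π,
      Complex.imCLM (fmFun v m (Complex.exp (φ * Complex.I))) * ψ φ =
      (-1) ^ m * Real.sinh (m * tauK k) *
        ∫ φ in (0 : ℝ)..π, Real.sin (m * uf k φ) * ψ φ := by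
  rw [← intervalIntegral.integral_const_mul]
  refine intervalIntegral.integral_congr_Ioo_of_le Real.pi_pos.le fun φ hφ => ?_
  simp only [Complex.imCLM_apply]
  rw [hv.fmFun_circle h0 h1 m hφ, Complex.add_im, Complex.ofReal_im, Complex.im_ofReal_mul, Complex.I_im, tauK]
  ring

lemma IsCoeff.eq_integral_cos (h0 : 0 < k) (h1 : k < 1) (hv : IsVmap (kLanden k) v)
    (ha : IsCoeff (kLanden k) v a) {m n : ℕ} (hm : 1 ≤ m) (hn : 1 ≤ n) :
    a n m * (π / 2) = (-1) ^ m * Real.cosh (m * tauK k) *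
        ∫ φ in (0 : ℝ)..π, Real.cos (m * uf k φ) * Real.cos (n * φ) := by
  have e : ∀ j, a j m * (∫ φ in (0 : ℝ)..π, Real.cos (j * φ) * Real.cos (n * φ)) =
      if j = n then a n m * (π / 2) else 0 := by
    intro j
    rw [integral_cos_mul_cos j n hn]
    split_ifs with h
    · rw [h]
    · simp
  have := ha.tsum_integral h0 h1 hv hm Complex.reCLM (fun n φ => Real.cos (n * φ))
    (fun n => by fun_prop) (fun n φ => Real.abs_cos_le_one _) re_exp_pow
    (ψ := fun φ => Real.cos (n * φ)) (by fun_prop) (by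
      simp_rw [e]; exact (hasSum_ite_eq n _).summable)
  simp_rw [e] at this
  rw [tsum_ite_eq, hv.integral_re h0 h1 m n hn] at this
  exact this

lemma IsCoeff.eq_integral_sin (h0 : 0 < k) (h1 : k < 1) (hv : IsVmap (kLanden k) v)
    (ha : IsCoeff (kLanden k) v a) {m n : ℕ} (hm : 1 ≤ m) (hn : 1 ≤ n) :
    a n m * (π / 2) = (-1) ^ m * Real.sinh (m * tauK k) *
        ∫ φ in (0 : ℝ)..π, Real.sin (m * uf k φ) * Real.sin (n * φ) := by
  have e : ∀ j, a j m * (∫ φ in (0 : ℝ)..π, Real.sin (j * φ) * Real.sin (n * φ)) =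
      if j = n then a n m * (π / 2) else 0 := by
    intro j
    rw [integral_sin_mul_sin j n hn]
    split_ifs with h
    · rw [h]
    · simp
  have := ha.tsum_integral h0 h1 hv hm Complex.imCLM (fun n φ => Real.sin (n * φ))
    (fun n => by fun_prop) (fun n φ => Real.abs_sin_le_one _) im_exp_pow
    (ψ := fun φ => Real.sin (n * φ)) (by fun_prop) (by
      simp_rw [e]; exact (hasSum_ite_eq n _).summable)
  simp_rw [e] at this
  rw [tsum_ite_eq, hv.integral_im h0 h1 m] at this
  exact this

end coeff

section axis

variable {k : ℝ} {v : ℂ → ℂ} {a : ℕ → ℕ → ℝ}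

/-- The derivative of `Xf k`. -/
def dXf (k φ : ℝ) : ℝ := -(k * Real.sin φ) / (wf k φ * (1 + wf k φ))

lemma continuous_dXf (h0 : 0 < k) (h1 : k < 1) : Continuous (dXf k) := by
  have := continuous_wf (k := k)
  unfold dXf
  refine Continuous.div (by fun_prop) (by fun_prop) fun φ => ?_
  have := wf_pos h0 h1 φ
  positivity

lemma hasDerivAt_Xf_pow (h0 : 0 < k) (h1 : k < 1) (n : ℕ) (φ : ℝ) :
    HasDerivAt (fun φ => Xf k φ ^ n) (n * Xf k φ ^ (n - 1) * dXf k φ) φ := by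
  exact (hasDerivAt_Xf h0 h1 φ).pow n

lemma continuous_Xf_pow_deriv (h0 : 0 < k) (h1 : k < 1) (n : ℕ) :
    Continuous fun φ => n * Xf k φ ^ (n - 1) * dXf k φ := by
  have e1 := continuous_Xf h0 h1
  have e2 := continuous_dXf h0 h1
  fun_prop

lemma integral_sin_mul_deriv (h0 : 0 < k) (h1 : k < 1) (l n : ℕ) :
    ∫ φ in (0 : ℝ)..π, Real.sin (l * φ) * (n * Xf k φ ^ (n - 1) * dXf k φ) =
      -(l * π * Jn k n l) := by
  have e1 := continuous_Xf h0 h1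
  rw [intervalIntegral.integral_mul_deriv_eq_deriv_mul (u := fun φ => Real.sin (l * φ))
    (u' := fun φ => Real.cos (l * φ) * l) (v := fun φ => Xf k φ ^ n)
    (fun φ _ => by simpa using ((hasDerivAt_id φ).const_mul (l : ℝ)).sin)
    (fun φ _ => hasDerivAt_Xf_pow h0 h1 n φ) (Continuous.intervalIntegrable (by fun_prop) _ _)
    ((continuous_Xf_pow_deriv h0 h1 n).intervalIntegrable _ _)]
  simp only [Real.sin_nat_mul_pi, mul_zero, Real.sin_zero, zero_mul, sub_zero, zero_sub, Jn]
  rw [show (l : ℝ) * π * (1 / π * ∫ φ in (0 : ℝ)..π, Xf k φ ^ n * Real.cos (((l : ℕ) : ℤ) * φ)) =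
    l * ∫ φ in (0 : ℝ)..π, Xf k φ ^ n * Real.cos (((l : ℕ) : ℤ) * φ) by
      field_simp [Real.pi_ne_zero], ← intervalIntegral.integral_const_mul]
  congr 1
  refine intervalIntegral.integral_congr fun φ _ => ?_
  push_cast
  ring

lemma Jn_reciprocal (h0 : 0 < k) (h1 : k < 1) {n : ℕ} (hn : 1 ≤ n) (j : ℕ) :
    (j : ℝ) * Jn k n j = n * Jn k j n := by
  rcases Nat.eq_zero_or_pos j with rfl | hj
  · have c1 := integral_cos_int n
    rw [if_neg (by omega)] at c1
    simp only [Jn, pow_zero, one_mul, c1]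
    simp
  · exact Jn_comm h0 h1 hn hj

/-- Integrals of the values of `f_m` on the real interval. -/
lemma IsCoeff.hasSum_Jn (h0 : 0 < k) (h1 : k < 1) (hv : IsVmap (kLanden k) v)
    (ha : IsCoeff (kLanden k) v a) {m n : ℕ} (hm : 1 ≤ m) (hn : 1 ≤ n) :
    HasSum (fun j => a j m * (π * Jn k j n))
      ((-1) ^ m * ∫ φ in (0 : ℝ)..π, Real.cos (m * uf k φ) * Real.cos (n * φ)) := by
  have hu := continuous_uf h0 h1
  have hX := continuous_Xf h0 h1
  have hpi := Real.pi_pos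
  have hκ := kLanden_pos h0 h1
  have hκ1 := kLanden_lt_one h0 h1
  have c1 := integral_cos_int n
  rw [if_neg (by omega)] at c1
  have c2 : ∫ φ in (0 : ℝ)..π, Real.cos (n * φ) = 0 := by
    simpa [hpi.ne'] using c1
  have := hasSum_integral_mul (c := fun j => a j m) (T := fun j φ => Xf k φ ^ j)
    (ψ := fun φ => Real.cos (n * φ))
    (F := fun φ => (-1) ^ m * Real.cos (m * uf k φ) - Real.cos (π * m / 2))
    (ha.summable hκ hm h0.le h1) (fun j => by fun_prop) (by fun_prop)
    (fun j φ => by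
      rw [abs_mul, abs_pow]
      exact mul_le_mul_of_nonneg_left
        (pow_le_pow_left₀ (abs_nonneg _) (abs_Xf_le h0 h1 φ) _) (abs_nonneg _))
    (fun φ hφ => by
      have hs := Real.sin_pos_of_pos_of_lt_pi hφ.1 hφ.2
      have h2 := Xf_sq_lt h0 h1 hs.ne'
      have := ha m hm (Xf k φ) (ofReal_mem_slitDom h2) (by
        rw [Complex.norm_real, Real.norm_eq_abs]
        exact (abs_Xf_le h0 h1 φ).trans_lt h1)
      rw [hv.fmFun_Xf h0 h1 m hφ] at this
      exact_mod_cast this)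
  convert this using 1
  · funext j
    rw [Jn]
    push_cast
    field_simp
  · have e : ∀ φ, ((-1) ^ m * Real.cos (m * uf k φ) - Real.cos (π * m / 2)) * Real.cos (n * φ) =
        (-1) ^ m * (Real.cos (m * uf k φ) * Real.cos (n * φ)) -
          Real.cos (π * m / 2) * Real.cos (n * φ) := fun φ => by ring
    simp_rw [e]
    rw [intervalIntegral.integral_sub (Continuous.intervalIntegrable (by fun_prop) _ _)
      (Continuous.intervalIntegrable (by fun_prop) _ _), intervalIntegral.integral_const_mul,
      intervalIntegral.integral_const_mul, c2]
    ring

lemma tauK_pos (h0 : 0 < k) (h1 : k < 1) : 0 < tauK k := by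
  have a1 := Kell_pos h0 h1
  have a2 := Kell_pos (kComp_pos h0 h1) (kComp_lt_one h0 h1)
  unfold tauK Tell
  positivity

lemma IsCoeff.integral_sin_uf (h0 : 0 < k) (h1 : k < 1) (hv : IsVmap (kLanden k) v)
    (ha : IsCoeff (kLanden k) v a) {m n : ℕ} (hm : 1 ≤ m) (hn : 1 ≤ n) :
    (-1) ^ m * Real.sinh (m * tauK k) *
      ∫ φ in (0 : ℝ)..π, Real.sin (m * uf k φ) * (n * Xf k φ ^ (n - 1) * dXf k φ) =
      -(n * ((-1) ^ m * ∫ φ in (0 : ℝ)..π, Real.cos (m * uf k φ) * Real.cos (n * φ))) := by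
  have hs := (ha.hasSum_Jn h0 h1 hv hm hn).mul_left (n : ℝ)
  have e : ∀ j : ℕ, a j m * (∫ φ in (0 : ℝ)..π, Real.sin (j * φ) *
      (n * Xf k φ ^ (n - 1) * dXf k φ)) = -(n * (a j m * (π * Jn k j n))) := by
    intro j
    rw [integral_sin_mul_deriv h0 h1]
    linear_combination (-(a j m * π)) * Jn_reciprocal h0 h1 hn j
  have := ha.tsum_integral h0 h1 hv hm Complex.imCLM (fun n φ => Real.sin (n * φ))
    (fun n => by fun_prop) (fun n φ => Real.abs_sin_le_one _) im_exp_pow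
    (continuous_Xf_pow_deriv h0 h1 n) (by simp_rw [e]; exact hs.neg.summable)
  simp_rw [e] at this
  rw [hs.neg.tsum_eq, hv.integral_im h0 h1 m] at this
  exact this.symm

/-- Integration by parts for the axis values. -/
lemma hm_axis_parts (h0 : 0 < k) (h1 : k < 1) {m : ℕ} (hm1 : 1 ≤ m) (n : ℕ) :
    hm k m n 0 = -(1 / (π * m) *
      ∫ φ in (0 : ℝ)..π, Real.sin (m * uf k φ) * (n * Xf k φ ^ (n - 1) * dXf k φ)) := by
  have hu := continuous_uf h0 h1
  have hm0 : (0 : ℝ) < m := by exact_mod_cast hm1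
  have hd : ∀ φ ∈ uIcc 0 π, HasDerivAt (fun φ => Real.sin (m * uf k φ))
      (Real.cos (m * uf k φ) * (m * rf k φ)) φ := fun φ _ =>
    ((hasDerivAt_uf h0 h1 φ).const_mul (m : ℝ)).sin
  have hr := continuous_rf h0 h1
  have hp := intervalIntegral.integral_mul_deriv_eq_deriv_mul hd
    (fun φ _ => hasDerivAt_Xf_pow h0 h1 n φ) (Continuous.intervalIntegrable (by fun_prop) _ _)
    ((continuous_Xf_pow_deriv h0 h1 n).intervalIntegrable _ _)
  rw [uf_pi h0 h1, uf_zero, Real.sin_nat_mul_pi, mul_zero, Real.sin_zero, zero_mul, zero_mul,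
    sub_zero, zero_sub] at hp
  rw [hp, mul_neg, neg_neg, hm, ← intervalIntegral.integral_const_mul,
    ← intervalIntegral.integral_const_mul]
  refine intervalIntegral.integral_congr fun φ _ => ?_
  have hpi := Real.pi_pos
  push_cast
  rw [zero_mul, zero_add]
  field_simp

/-- The axis values in terms of the Taylor coefficients of `f_m`. -/
lemma IsCoeff.hm_axis (h0 : 0 < k) (h1 : k < 1) (hv : IsVmap (kLanden k) v)
    (ha : IsCoeff (kLanden k) v a) {m n : ℕ} (hm1 : 1 ≤ m) (hn : 1 ≤ n) :
    hm k m n 0 = (-1) ^ m * (n * a n m / (m * Real.sinh (2 * (m * tauK k)))) := by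
  have hu := continuous_uf h0 h1
  have hX := continuous_Xf h0 h1
  have hm0 : (0 : ℝ) < m := by exact_mod_cast hm1
  have hτ : 0 < (m : ℝ) * tauK k := mul_pos hm0 (tauK_pos h0 h1)
  have e1 := hm_axis_parts h0 h1 hm1 n
  have e2 := ha.integral_sin_uf h0 h1 hv hm1 hn
  have e3 := ha.eq_integral_cos h0 h1 hv hm1 hn
  have hs : 0 < Real.sinh (m * tauK k) := Real.sinh_pos_iff.2 hτ
  have hc := Real.cosh_pos (m * tauK k)
  have hsg : ((-1 : ℝ) ^ m) * (-1) ^ m = 1 := by rw [← mul_pow]; simp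
  have hpi := Real.pi_pos
  set A := ∫ φ in (0 : ℝ)..π, Real.sin (m * uf k φ) * (n * Xf k φ ^ (n - 1) * dXf k φ)
  set B := ∫ φ in (0 : ℝ)..π, Real.cos (m * uf k φ) * Real.cos (n * φ)
  rw [e1, Real.sinh_two_mul]
  set s := Real.sinh (m * tauK k)
  set c := Real.cosh (m * tauK k)
  set g := (-1 : ℝ) ^ m
  have e4 : s * A = -(n * B) := by
    linear_combination g * e2 - (s * A + n * B) * hsg
  have e5 : g * (a n m * (π / 2)) = c * B := by
    linear_combination g * e3 + (c * B) * hsg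
  have hA : A = -(n * (g * (a n m * (π / 2)))) / (s * c) := by
    rw [e5]; field_simp; linarith
  rw [hA]
  field_simp

lemma integral_cos_add (h0 : 0 < k) (h1 : k < 1) {m : ℤ} (hm0 : m ≠ 0) (n : ℤ) :
    hm k m 0 n = -(n / m * (1 / π * ∫ φ in (0 : ℝ)..π, Real.cos (n * φ + m * uf k φ))) := by
  have hu := continuous_uf h0 h1
  have hr := continuous_rf h0 h1
  have hm1 : (m : ℝ) ≠ 0 := by exact_mod_cast hm0
  have hd : ∀ φ ∈ uIcc 0 π, HasDerivAt (fun φ => Real.sin (n * φ + m * uf k φ))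
      (Real.cos (n * φ + m * uf k φ) * (n * 1 + m * rf k φ)) φ := fun φ _ =>
    (((hasDerivAt_id φ).const_mul (n : ℝ)).add ((hasDerivAt_uf h0 h1 φ).const_mul (m : ℝ))).sin
  have h := intervalIntegral.integral_eq_sub_of_hasDerivAt hd
    (Continuous.intervalIntegrable (by fun_prop) _ _)
  have e : ∀ φ, Real.cos (n * φ + m * uf k φ) * (n * 1 + m * rf k φ) =
      n * Real.cos (n * φ + m * uf k φ) + m * (Real.cos (n * φ + m * uf k φ) * rf k φ) :=
    fun φ => by ring
  simp_rw [e] at h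
  rw [intervalIntegral.integral_add (Continuous.intervalIntegrable (by fun_prop) _ _)
      (Continuous.intervalIntegrable (by fun_prop) _ _), intervalIntegral.integral_const_mul,
      intervalIntegral.integral_const_mul, uf_pi h0 h1, uf_zero, ← add_mul, mul_zero, mul_zero,
      add_zero, Real.sin_zero, sub_zero, ← Int.cast_add, Real.sin_int_mul_pi] at h
  simp only [hm, pow_zero, one_mul]
  have hpi := Real.pi_pos
  field_simp
  linarith

/-- The values on the second axis are proportional to those on the first one. -/
lemma IsCoeff.hm_axis_two (h0 : 0 < k) (h1 : k < 1) (hv : IsVmap (kLanden k) v)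
    (ha : IsCoeff (kLanden k) v a) {m n : ℕ} (hm1 : 1 ≤ m) (hn : 1 ≤ n) :
    hm k m 0 n = Real.exp (-(m * tauK k)) * hm k m n 0 ∧
    hm k (-m) 0 n = Real.exp (m * tauK k) * hm k m n 0 := by
  have hu := continuous_uf h0 h1
  have hm0 : (0 : ℝ) < m := by exact_mod_cast hm1
  have hτ : 0 < (m : ℝ) * tauK k := mul_pos hm0 (tauK_pos h0 h1)
  have e1 := integral_cos_add h0 h1 (m := m) (by omega) n
  have e2 := integral_cos_add h0 h1 (m := -m) (by omega) n
  push_cast at e1 e2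
  simp_rw [Real.cos_add] at e1 e2
  rw [intervalIntegral.integral_sub (Continuous.intervalIntegrable (by fun_prop) _ _)
      (Continuous.intervalIntegrable (by fun_prop) _ _)] at e1 e2
  rw [e1, e2, ha.hm_axis h0 h1 hv hm1 hn]
  have i1 : ∀ φ, Real.cos (n * φ) * Real.cos (m * uf k φ) =
    Real.cos (m * uf k φ) * Real.cos (n * φ) := fun φ => mul_comm _ _
  have i2 : ∀ φ, Real.sin (n * φ) * Real.sin (m * uf k φ) =
    Real.sin (m * uf k φ) * Real.sin (n * φ) := fun φ => mul_comm _ _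
  simp_rw [neg_mul, Real.cos_neg, Real.sin_neg, mul_neg, intervalIntegral.integral_neg, i1, i2]
  have e3 := ha.eq_integral_cos h0 h1 hv hm1 hn
  have e4 := ha.eq_integral_sin h0 h1 hv hm1 hn
  have hs : 0 < Real.sinh (m * tauK k) := Real.sinh_pos_iff.2 hτ
  have hc := Real.cosh_pos (m * tauK k)
  have hsg : ((-1 : ℝ) ^ m) * (-1) ^ m = 1 := by rw [← mul_pow]; simp
  have hpi := Real.pi_pos
  set A := ∫ φ in (0 : ℝ)..π, Real.sin (m * uf k φ) * Real.sin (n * φ)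
  set B := ∫ φ in (0 : ℝ)..π, Real.cos (m * uf k φ) * Real.cos (n * φ)
  rw [Real.sinh_two_mul, ← Real.cosh_sub_sinh, ← Real.cosh_add_sinh]
  set s := Real.sinh (m * tauK k)
  set c := Real.cosh (m * tauK k)
  set g := (-1 : ℝ) ^ m
  have hB : B = g * (a n m * (π / 2)) / c := by
    rw [eq_div_iff hc.ne']; linear_combination (-g) * e3 - (c * B) * hsg
  have hA : A = g * (a n m * (π / 2)) / s := by
    rw [eq_div_iff hs.ne']; linear_combination (-g) * e4 - (s * A) * hsg
  rw [hA, hB]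
  constructor
  · field_simp
    ring
  · field_simp
    ring

end axis

section rotation

variable {k : ℝ} {v : ℂ → ℂ} {a : ℕ → ℕ → ℝ}

/-- Rotating a quadrant multiplies the harmonic functions by a constant. -/
lemma IsCoeff.hm_rotate (h0 : 0 < k) (h1 : k < 1) (hv : IsVmap (kLanden k) v)
    (ha : IsCoeff (kLanden k) v a) {m : ℕ} (hm1 : 1 ≤ m) (x y : ℕ) :
    hm k m y (-x) = Real.exp (m * tauK k) * hm k m x y := by
  have hmz : (m : ℤ) ≠ 0 := by omega
  set f : ℕ → ℕ → ℝ := fun x y => hm k m y (-x) - Real.exp (m * tauK k) * hm k m x y with hf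
  have hx0 : ∀ y, f 0 y = 0 := by
    intro y
    rcases Nat.eq_zero_or_pos y with rfl | hy
    · simp [hf, hm_zero_zero h0 h1 hmz]
    · simp only [hf]
      rw [(ha.hm_axis_two h0 h1 hv hm1 hy).1, ← mul_assoc, ← Real.exp_add]
      simp
  have hy0 : ∀ x, f x 0 = 0 := by
    intro x
    rcases Nat.eq_zero_or_pos x with rfl | hx
    · simp [hf, hm_zero_zero h0 h1 hmz]
    · simp only [hf]
      rw [← hm_neg, (ha.hm_axis_two h0 h1 hv hm1 hx).2]
      simp
  have hrec : ∀ x y, f (x + 1) (y + 1) =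
      k / 4 * (f (x + 2) (y + 2) + (f (x + 2) y + (f x y + f x (y + 2)))) := by
    intro x y
    have r1 := hm_rec h0 h1 m y (-((x : ℤ) + 1))
    have r2 := hm_rec h0 h1 m x ((y : ℤ) + 1)
    rw [show -((x : ℤ) + 1) + 1 = -x by ring, show -((x : ℤ) + 1) - 1 = -(x + 2) by ring] at r1
    rw [show (y : ℤ) + 1 + 1 = y + 2 by ring, add_sub_cancel_right] at r2
    simp only [hf]
    push_cast
    rw [r1, r2]
    ring
  set F : ℤ → ℤ → ℝ := fun x y => if 1 ≤ x ∧ 1 ≤ y then f x.toNat y.toNat else 0 with hF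
  have hFf : ∀ x y : ℕ, F x y = f x y := by
    intro x y
    simp only [hF, Int.toNat_natCast]
    split_ifs with h
    · rfl
    · rcases Nat.eq_zero_or_pos x with rfl | hx
      · rw [hx0]
      · have : y = 0 := by omega
        rw [this, hy0]
  have hz := eq_zero_of_abs_le_sum (t := k / 4) (B := 1 + Real.exp (m * tauK k)) (by linarith)
    (by linarith) F (fun x y => by
      simp only [hF]
      have hE := Real.exp_pos (m * tauK k)
      split_ifs
      · simp only [hf]
        refine (abs_sub _ _).trans (add_le_add (abs_hm_le h0 h1 _ _ _) ?_)
        rw [abs_mul, abs_of_pos hE]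
        exact mul_le_of_le_one_right hE.le (abs_hm_le h0 h1 _ _ _)
      · rw [abs_zero]; positivity) (fun x y => by
      by_cases h : 1 ≤ x ∧ 1 ≤ y
      · obtain ⟨x, rfl⟩ : ∃ n : ℕ, x = n + 1 := ⟨(x - 1).toNat, by omega⟩
        obtain ⟨y, rfl⟩ : ∃ n : ℕ, y = n + 1 := ⟨(y - 1).toNat, by omega⟩
        have e1 := hFf (x + 1) (y + 1)
        have e2 := hFf (x + 2) (y + 2)
        have e3 := hFf (x + 2) y
        have e4 := hFf x y
        have e5 := hFf x (y + 2)
        push_cast at e1 e2 e3 e4 e5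
        rw [show (x : ℤ) + 1 + 1 = x + 2 by ring, show (y : ℤ) + 1 + 1 = y + 2 by ring,
          add_sub_cancel_right, add_sub_cancel_right, e1, e2, e3, e4, e5, hrec, abs_mul,
          abs_of_pos (by linarith : 0 < k / 4)]
        gcongr
        exact (abs_add_le _ _).trans (add_le_add_right ((abs_add_le _ _).trans
          (add_le_add_right (abs_add_le _ _) _)) _)
      · have : F x y = 0 := by simp only [hF, if_neg h]
        rw [this, abs_zero]
        positivity) x y
  rw [hFf] at hz
  simp only [hf] at hz
  linarith

end rotation

section orthogonality

variable {k : ℝ} {v : ℂ → ℂ} {a : ℕ → ℕ → ℝ}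

lemma exists_abs_hm_zero_le (h0 : 0 < k) (h1 : k < 1) (n : ℤ) :
    ∃ C, 0 ≤ C ∧ ∀ m : ℤ, m ≠ 0 → |hm k m 0 n| ≤ C * (1 / (m : ℝ) ^ 2) := by
  have hu := continuous_uf h0 h1
  have hw := continuous_wf (k := k)
  have hK := Kell_pos h0 h1
  have hpi := Real.pi_pos
  set D : ℝ → ℝ := fun φ => k ^ 2 * Real.cos φ * Real.sin φ / wf k φ with hD
  have hDc : Continuous D := by
    refine Continuous.div (by fun_prop) hw fun φ => (wf_pos h0 h1 φ).ne'
  set A : ℝ := ∫ φ in (0 : ℝ)..π, |n * wf k φ| + |D φ| with hA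
  have hA0 : 0 ≤ A := intervalIntegral.integral_nonneg hpi.le fun φ _ => by positivity
  refine ⟨|(n : ℝ)| / π * (2 * Kell k / π * A), by positivity, fun m hm0 => ?_⟩
  have hmr : (m : ℝ) ≠ 0 := by exact_mod_cast hm0
  have hd : ∀ φ ∈ uIcc 0 π, HasDerivAt (fun φ => Real.sin (n * φ + m * uf k φ) * wf k φ)
      (Real.cos (n * φ + m * uf k φ) * (n * 1 + m * rf k φ) * wf k φ +
        Real.sin (n * φ + m * uf k φ) * D φ) φ := fun φ _ =>
    ((((hasDerivAt_id φ).const_mul (n : ℝ)).add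
      ((hasDerivAt_uf h0 h1 φ).const_mul (m : ℝ))).sin).mul (hasDerivAt_wf h0 h1 φ)
  have hr := continuous_rf h0 h1
  have h := intervalIntegral.integral_eq_sub_of_hasDerivAt hd
    (Continuous.intervalIntegrable (by fun_prop) _ _)
  have e : ∀ φ, Real.cos (n * φ + m * uf k φ) * (n * 1 + m * rf k φ) * wf k φ +
        Real.sin (n * φ + m * uf k φ) * D φ =
      m * (π / (2 * Kell k)) * Real.cos (n * φ + m * uf k φ) +
      (Real.cos (n * φ + m * uf k φ) * (n * wf k φ) + Real.sin (n * φ + m * uf k φ) * D φ) := by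
    intro φ
    have := wf_pos h0 h1 φ
    rw [rf]
    field_simp
    ring
  simp_rw [e] at h
  rw [intervalIntegral.integral_add (Continuous.intervalIntegrable (by fun_prop) _ _)
      (Continuous.intervalIntegrable (by fun_prop) _ _), intervalIntegral.integral_const_mul,
      uf_pi h0 h1, uf_zero, ← add_mul, mul_zero, mul_zero,
      add_zero, Real.sin_zero, zero_mul, sub_zero, ← Int.cast_add, Real.sin_int_mul_pi,
      zero_mul] at h
  have hR : |∫ φ in (0 : ℝ)..π, (Real.cos (n * φ + m * uf k φ) * (n * wf k φ) +
      Real.sin (n * φ + m * uf k φ) * D φ)| ≤ A := by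
    refine (intervalIntegral.abs_integral_le_integral_abs hpi.le).trans ?_
    refine intervalIntegral.integral_mono_on hpi.le
      (Continuous.intervalIntegrable (by fun_prop) _ _)
      (Continuous.intervalIntegrable (by fun_prop) _ _) fun φ _ => ?_
    refine (abs_add_le _ _).trans (add_le_add ?_ ?_)
    · rw [abs_mul]
      exact mul_le_of_le_one_left (abs_nonneg _) (Real.abs_cos_le_one _)
    · rw [abs_mul]
      exact mul_le_of_le_one_left (abs_nonneg _) (Real.abs_sin_le_one _)
  rw [integral_cos_add h0 h1 hm0 n]
  set R := ∫ φ in (0 : ℝ)..π, (Real.cos (n * φ + m * uf k φ) * (n * wf k φ) +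
      Real.sin (n * φ + m * uf k φ) * D φ)
  set I := ∫ φ in (0 : ℝ)..π, Real.cos (n * φ + m * uf k φ)
  have hI : I = -(2 * Kell k / π * R) / m := by
    rw [eq_div_iff hmr]
    field_simp
    field_simp at h
    linarith
  rw [hI, show -((n : ℝ) / m * (1 / π * (-(2 * Kell k / π * R) / m))) =
    n / π * (2 * Kell k / π * R) * (1 / (m : ℝ) ^ 2) by field_simp, abs_mul, abs_mul, abs_mul,
    abs_div, abs_of_pos hpi, abs_of_pos (by positivity : 0 < 2 * Kell k / π),
    abs_of_nonneg (by positivity : 0 ≤ 1 / (m : ℝ) ^ 2)]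
  gcongr

lemma summable_hm_zero (h0 : 0 < k) (h1 : k < 1) (n : ℤ) :
    Summable fun m : ℤ => |hm k m 0 n| := by
  obtain ⟨C, hC, h⟩ := exists_abs_hm_zero_le h0 h1 n
  refine ((Real.summable_one_div_int_pow.2 one_lt_two).mul_left C).of_norm_bounded_eventually ?_
  rw [Filter.eventually_cofinite]
  refine (Set.finite_singleton (0 : ℤ)).subset fun m hm1 => ?_
  by_contra hne
  exact hm1 (by simpa using h m hne)

lemma uf_add_pi (h0 : 0 < k) (h1 : k < 1) (φ : ℝ) : uf k (φ + π) = uf k φ + π := by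
  have := uf_pi_sub h0 h1 (-φ)
  rw [uf_neg h0 h1] at this
  rw [add_comm, ← sub_neg_eq_add, this]
  ring

lemma surjective_uf (h0 : 0 < k) (h1 : k < 1) : Function.Surjective (uf k) := by
  have hn : ∀ n : ℕ, uf k (n * π) = n * π := by
    intro n
    induction n with
    | zero => simp [uf_zero]
    | succ n ih =>
      push_cast
      rw [add_mul, one_mul, uf_add_pi h0 h1, ih]
  intro y
  obtain ⟨n, h⟩ := exists_nat_ge (|y| / π)
  rw [div_le_iff₀ Real.pi_pos, abs_le] at h
  have := intermediate_value_Icc (by linarith : -(n * π) ≤ n * π)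
    (continuous_uf h0 h1).continuousOn
  rw [uf_neg h0 h1, hn] at this
  obtain ⟨x, -, hx⟩ := this h
  exact ⟨x, hx⟩

/-- The exponential series of `exp (i x φ)` in the variable `u = uf k φ`. -/
lemma hasSum_hm_mul_exp (h0 : 0 < k) (h1 : k < 1) (x : ℤ) (φ : ℝ) :
    HasSum (fun m : ℤ => (hm k (-m) 0 x : ℂ) * Complex.exp (Complex.I * (m * uf k φ)))
      (Complex.exp (Complex.I * (x * φ))) := by
  have hpi := Real.pi_pos
  have hu := continuous_uf h0 h1
  have hr := continuous_rf h0 h1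
  have : Fact (0 < 2 * π) := ⟨by positivity⟩
  set e := (strictMono_uf h0 h1).orderIsoOfSurjective (uf k) (surjective_uf h0 h1) with he
  have heu : ∀ φ, e.symm (uf k φ) = φ := fun φ => e.symm_apply_apply φ
  have hec : Continuous e.symm := e.symm.continuous
  set g : ℝ → ℂ := fun u => Complex.exp (Complex.I * (x * e.symm u)) with hg
  have hgc : Continuous g := by simp only [hg]; fun_prop
  have hper : Function.Periodic g (2 * π) := by
    intro u
    obtain ⟨ψ, rfl⟩ := surjective_uf h0 h1 u
    have : uf k ψ + 2 * π = uf k (ψ + π + π) := by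
      rw [uf_add_pi h0 h1, uf_add_pi h0 h1]; ring
    simp only [hg]
    rw [this, heu, heu, Complex.exp_eq_exp_iff_exists_int]
    exact ⟨x, by push_cast; ring⟩
  set F : C(AddCircle (2 * π), ℂ) := ⟨hper.lift,
    (QuotientAddGroup.isQuotientMap_mk _).continuous_iff.2 hgc⟩ with hF
  have hFg : ∀ u : ℝ, F (u : AddCircle (2 * π)) = g u := fun u => rfl
  have hfour : ∀ m : ℤ, ∀ u : ℝ, fourier m (u : AddCircle (2 * π)) =
      Complex.exp (Complex.I * (m * u)) := by
    intro m u
    rw [fourier_coe_apply]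
    congr 1
    have : (π : ℂ) ≠ 0 := by exact_mod_cast hpi.ne'
    push_cast
    field_simp
  have hcoef : ∀ m : ℤ, fourierCoeff F m = (hm k (-m) 0 x : ℂ) := by
    intro m
    rw [fourierCoeff_eq_intervalIntegral _ m (-π), show -π + 2 * π = π by ring]
    simp_rw [hFg, hfour]
    have hs := intervalIntegral.integral_deriv_smul_comp (a := -π) (b := π) (f := uf k)
      (f' := rf k) (g := fun u : ℝ => Complex.exp (Complex.I * ((-m : ℤ) * u)) • g u)
      (fun φ _ => hasDerivAt_uf h0 h1 φ) hr.continuousOn (by fun_prop)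
    rw [uf_neg h0 h1, uf_pi h0 h1] at hs
    rw [← hs]
    set G : ℝ → ℂ := fun φ => rf k φ * Complex.exp (Complex.I * (x * φ - m * uf k φ)) with hG
    have hGc : Continuous G := by simp only [hG]; fun_prop
    have hintegrand : ∀ φ, (rf k φ • ((fun u : ℝ => Complex.exp (Complex.I * ((-m : ℤ) * u)) • g u) ∘
        uf k) φ) = G φ := by
      intro φ
      simp only [hG, hg, Function.comp, heu, smul_eq_mul, ← Complex.exp_add, Complex.real_smul]
      congr 2
      push_cast
      ring
    simp_rw [hintegrand]
    have hsplit := intervalIntegral.integral_add_adjacent_intervals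
      (hGc.intervalIntegrable (μ := MeasureTheory.volume) (-π) 0) (hGc.intervalIntegrable 0 π)
    have hneg := intervalIntegral.integral_comp_neg (a := 0) (b := π) G
    rw [neg_zero] at hneg
    rw [← hsplit, ← hneg, ← intervalIntegral.integral_add
      (Continuous.intervalIntegrable (by fun_prop) _ _) (hGc.intervalIntegrable _ _)]
    have hGG : ∀ φ : ℝ, G (-φ) + G φ =
        ((2 * (Real.cos (x * φ + (-m : ℤ) * uf k φ) * rf k φ) : ℝ) : ℂ) := by
      intro φ
      have : rf k (-φ) = rf k φ := by simp only [rf, wf_neg]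
      simp only [hG, uf_neg h0 h1, this]
      push_cast
      rw [Complex.cos]
      rw [show Complex.I * ((x : ℂ) * -φ - m * -(uf k φ : ℂ)) =
        -((x * φ + -m * uf k φ) * Complex.I) by ring,
        show Complex.I * ((x : ℂ) * φ - m * (uf k φ : ℂ)) =
        ((x * φ + -m * uf k φ) * Complex.I) by ring, neg_mul]
      ring_nf
    simp_rw [hGG]
    rw [intervalIntegral.integral_ofReal, intervalIntegral.integral_const_mul, Complex.real_smul]
    simp only [hm, pow_zero, one_mul]
    rw [← Complex.ofReal_mul]
    congr 1
    field_simp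
  have hsum : Summable (fourierCoeff F) := by
    simp_rw [funext hcoef]
    refine Summable.of_norm ?_
    simp_rw [Complex.norm_real, Real.norm_eq_abs]
    exact (Equiv.neg ℤ).summable_iff.2 (summable_hm_zero h0 h1 x)
  have := has_pointwise_sum_fourier_series_of_summable hsum (uf k φ : AddCircle (2 * π))
  simp_rw [hcoef, hfour, hFg, smul_eq_mul, hg, heu] at this
  exact this

/-- Orthogonality of the boundary values over all integers. -/
lemma hasSum_hm_mul_hm (h0 : 0 < k) (h1 : k < 1) (x : ℤ) {p : ℤ} (hp : p ≠ 0) :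
    HasSum (fun m : ℤ => m * (hm k (-m) 0 x * hm k (-m) 0 p)) (if x = p then (p : ℝ) else 0) := by
  have hu := continuous_uf h0 h1
  have hpi := Real.pi_pos
  have h := hasSum_integral_mul (c := fun m : ℤ => hm k (-m) 0 x)
    (T := fun m φ => Real.cos (p * φ + (-m : ℤ) * uf k φ)) (ψ := fun _ => 1)
    (F := fun φ => Real.cos ((x - p : ℤ) * φ))
    ((Equiv.neg ℤ).summable_iff.2 (summable_hm_zero h0 h1 x)) (fun m => by fun_prop)
    continuous_const (fun m φ => by
      rw [abs_mul]
      exact mul_le_of_le_one_right (abs_nonneg _) (Real.abs_cos_le_one _)) (fun φ _ => by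
      have h := (((hasSum_hm_mul_exp h0 h1 x φ).mul_right
        (Complex.exp (Complex.I * (-(p * φ))))).mapL Complex.reCLM)
      simp_rw [mul_assoc, ← Complex.exp_add] at h
      have e : ∀ m : ℤ, Complex.reCLM ((hm k (-m) 0 x : ℂ) *
          Complex.exp (Complex.I * (m * uf k φ) + Complex.I * (-(p * φ)))) =
          hm k (-m) 0 x * Real.cos (p * φ + (-m : ℤ) * uf k φ) := by
        intro m
        rw [Complex.reCLM_apply, Complex.re_ofReal_mul,
          show Complex.I * (m * uf k φ) + Complex.I * (-((p : ℂ) * φ)) =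
            ((-(p * φ + (-m : ℤ) * uf k φ) : ℝ) : ℂ) * Complex.I by push_cast; ring,
          Complex.exp_ofReal_mul_I_re, Real.cos_neg]
      simp_rw [e] at h
      rw [Complex.reCLM_apply,
          show Complex.I * (x * φ) + Complex.I * (-((p : ℂ) * φ)) =
            (((x - p : ℤ) * φ : ℝ) : ℂ) * Complex.I by push_cast; ring,
          Complex.exp_ofReal_mul_I_re] at h
      exact h)
  simp only [mul_one] at h
  have hc := integral_cos_int (x - p)
  have hc2 := integral_cos_int p
  rw [if_neg hp] at hc2
  convert h.mul_left ((p : ℝ) * (1 / π)) using 1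
  · rfl
  · funext m
    rcases eq_or_ne m 0 with rfl | hm0
    · have : ∫ φ in (0 : ℝ)..π, Real.cos (p * φ) = 0 := by simpa [hpi.ne'] using hc2
      simp [this]
    · have := integral_cos_add h0 h1 (neg_ne_zero.2 hm0) p
      have hmr : (m : ℝ) ≠ 0 := by exact_mod_cast hm0
      have e2 : m * hm k (-m) 0 p = p * (1 / π *
          ∫ φ in (0 : ℝ)..π, Real.cos (p * φ + (-m : ℤ) * uf k φ)) := by
        rw [this]
        push_cast
        field_simp
      linear_combination hm k (-m) 0 x * e2
  · rw [mul_assoc, hc]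
    simp only [sub_eq_zero]
    split_ifs <;> simp

/-- Orthogonality of the boundary values. -/
lemma IsCoeff.hasSum_orthogonality (h0 : 0 < k) (h1 : k < 1) (hv : IsVmap (kLanden k) v)
    (ha : IsCoeff (kLanden k) v a) {x p : ℕ} (hx : 1 ≤ x) (hp : 1 ≤ p) :
    HasSum (fun m : ℕ => ((m + 1 : ℕ) : ℝ) * (2 * Real.sinh (2 * ((m + 1 : ℕ) * tauK k))) *
      (hm k (m + 1 : ℕ) x 0 * hm k (m + 1 : ℕ) p 0)) (if x = p then (p : ℝ) else 0) := by
  have h := (hasSum_hm_mul_hm h0 h1 x (p := p) (by omega)).nat_add_neg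
  rw [← hasSum_nat_add_iff' 1] at h
  convert h using 1
  · rfl
  · funext m
    have q1 := ha.hm_axis_two h0 h1 hv (m := m + 1) (by omega) hx
    have q2 := ha.hm_axis_two h0 h1 hv (m := m + 1) (by omega) hp
    rw [neg_neg, q1.1, q1.2, q2.1, q2.2, Real.sinh_eq, two_mul ((((m + 1 : ℕ) : ℝ)) * tauK k),
      neg_add, Real.exp_add, Real.exp_add]
    push_cast
    ring
  · simp
end orthogonality

section green

variable {k : ℝ} {v : ℂ → ℂ} {a : ℕ → ℕ → ℝ}

/-- The function `e^{-mτd} - e^{mτd}`. -/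
def sd (k : ℝ) (m : ℕ) (d : ℤ) : ℝ :=
  Real.exp (-(m * tauK k * d)) - Real.exp (m * tauK k * d)

/-- The harmonic function on the `d`-th quadrant vanishing on the zeroth half axis. -/
def Ef (k : ℝ) (m : ℕ) (d : ℤ) (x : ℕ) (y : ℤ) : ℝ :=
  Real.exp (-(m * tauK k * d)) * hm k m x y - Real.exp (m * tauK k * d) * hm k (-m) x y

lemma Ef_axis (m : ℕ) (d : ℤ) (x : ℕ) : Ef k m d x 0 = sd k m d * hm k m x 0 := by
  rw [Ef, sd, hm_neg, neg_zero]
  ring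

lemma sd_zero (m : ℕ) : sd k m 0 = 0 := by simp [sd]

lemma Ef_zero_zero (h0 : 0 < k) (h1 : k < 1) {m : ℕ} (hm1 : 1 ≤ m) (d : ℤ) :
    Ef k m d 0 0 = 0 := by
  rw [Ef, hm_zero_zero h0 h1 (by omega), hm_zero_zero h0 h1 (by omega)]
  ring

lemma IsCoeff.Ef_rotate (h0 : 0 < k) (h1 : k < 1) (hv : IsVmap (kLanden k) v)
    (ha : IsCoeff (kLanden k) v a) {m : ℕ} (hm1 : 1 ≤ m) (d : ℤ) (x y : ℕ) :
    Ef k m d x (-y) = Ef k m (d - 1) y x := by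
  have r1 := ha.hm_rotate h0 h1 hv hm1 x y
  have r2 := ha.hm_rotate h0 h1 hv hm1 y x
  rw [Ef, Ef, hm_neg, hm_neg, neg_neg, r1, r2, ← mul_assoc, ← mul_assoc, ← Real.exp_add,
    ← Real.exp_add]
  congr 3
  · push_cast; ring
  · push_cast; ring

lemma Ef_rec (h0 : 0 < k) (h1 : k < 1) (m : ℕ) (d : ℤ) (x : ℕ) (y : ℤ) :
    Ef k m d (x + 1) y = k / 4 * (Ef k m d (x + 2) (y + 1) + (Ef k m d (x + 2) (y - 1) +
      (Ef k m d x (y - 1) + Ef k m d x (y + 1)))) := by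
  simp only [Ef]
  rw [hm_rec h0 h1 m x y, hm_rec h0 h1 (-m) x y]
  ring

lemma exp_le_exp_abs (h0 : 0 < k) (h1 : k < 1) (m : ℕ) (d : ℤ) :
    Real.exp (-(m * tauK k * d)) ≤ Real.exp (m * tauK k * |d|) ∧
    Real.exp (m * tauK k * d) ≤ Real.exp (m * tauK k * |d|) := by
  have hτ := tauK_pos h0 h1
  have h2 : (0 : ℝ) ≤ m * tauK k := by positivity
  push_cast
  constructor <;> rw [Real.exp_le_exp]
  · rw [← mul_neg]
    exact mul_le_mul_of_nonneg_left (neg_le_abs _) h2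
  · exact mul_le_mul_of_nonneg_left (le_abs_self _) h2

lemma abs_Ef_le (h0 : 0 < k) (h1 : k < 1) (m : ℕ) (d : ℤ) (x : ℕ) (y : ℤ) :
    |Ef k m d x y| ≤ 2 * Real.exp (m * tauK k * |d|) := by
  obtain ⟨e1, e2⟩ := exp_le_exp_abs h0 h1 m d
  refine (abs_sub _ _).trans ?_
  rw [two_mul, abs_mul, abs_mul, abs_of_pos (Real.exp_pos _), abs_of_pos (Real.exp_pos _)]
  exact add_le_add ((mul_le_of_le_one_right (Real.exp_pos _).le (abs_hm_le h0 h1 _ _ _)).trans e1)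
    ((mul_le_of_le_one_right (Real.exp_pos _).le (abs_hm_le h0 h1 _ _ _)).trans e2)

lemma abs_sd_le (h0 : 0 < k) (h1 : k < 1) (m : ℕ) (d : ℤ) :
    |sd k m d| ≤ Real.exp (m * tauK k * |d|) := by
  obtain ⟨e1, e2⟩ := exp_le_exp_abs h0 h1 m d
  exact abs_sub_le_of_nonneg_of_le (Real.exp_pos _).le e1 (Real.exp_pos _).le e2

lemma le_abs_sd (h0 : 0 < k) (h1 : k < 1) {m : ℕ} (hm1 : 1 ≤ m) {d : ℤ} (hd : 1 ≤ d) :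
    Real.exp (m * tauK k * d) * (1 - Real.exp (-tauK k)) ≤ |sd k m d| := by
  have hτ := tauK_pos h0 h1
  have hmr : (1 : ℝ) ≤ m := by exact_mod_cast hm1
  have hdr : (1 : ℝ) ≤ d := by exact_mod_cast hd
  have h2 : tauK k ≤ m * tauK k * d := by
    rw [mul_right_comm]
    exact le_mul_of_one_le_left hτ.le (by nlinarith)
  refine le_trans ?_ (neg_le_abs _)
  rw [sd, mul_sub, mul_one, neg_sub, ← Real.exp_add]
  exact sub_le_sub_left (Real.exp_le_exp.2 (by linarith)) _

/-- The jump coefficient of the Green function. -/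
def jumpCoeff (k : ℝ) (l : ℕ) (D : ℤ) (m : ℕ) : ℝ :=
  2 * Kell k / π * (2 * Real.sinh (2 * (m * tauK k))) * hm k m l 0 / sd k m D

lemma IsCoeff.abs_jumpCoeff_le (h0 : 0 < k) (h1 : k < 1) (hv : IsVmap (kLanden k) v)
    (ha : IsCoeff (kLanden k) v a) {l : ℕ} (hl : 1 ≤ l) {m : ℕ} (hm1 : 1 ≤ m) {D : ℤ}
    (hD : 1 ≤ D) : |jumpCoeff k l D m| ≤ 2 * Kell k / π / (1 - Real.exp (-tauK k)) *
      (Real.exp (m * tauK k * (1 - D)) * |hm k (-m) 0 l|) := by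
  have hτ := tauK_pos h0 h1
  have hK := Kell_pos h0 h1
  have hpi := Real.pi_pos
  have hq : 0 < 1 - Real.exp (-tauK k) := by
    rw [sub_pos, Real.exp_lt_one_iff]; linarith
  have hmr : (0 : ℝ) < m := by exact_mod_cast hm1
  have hs : 0 ≤ Real.sinh (2 * (m * tauK k)) := Real.sinh_nonneg_iff.2 (by positivity)
  have hs2 : 2 * Real.sinh (2 * (m * tauK k)) ≤ Real.exp (2 * (m * tauK k)) := by
    rw [Real.sinh_eq]
    linarith [Real.exp_pos (-(2 * (m * tauK k)))]
  rw [jumpCoeff, abs_div, abs_mul, abs_mul, abs_of_nonneg (by positivity : 0 ≤ 2 * Kell k / π),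
    abs_of_nonneg (by positivity : 0 ≤ 2 * Real.sinh (2 * (m * tauK k))),
    (ha.hm_axis_two h0 h1 hv hm1 hl).2, abs_mul, abs_of_pos (Real.exp_pos _)]
  have hE := Real.exp_pos (m * tauK k * D)
  rw [div_le_iff₀ (lt_of_lt_of_le (by positivity) (le_abs_sd h0 h1 hm1 hD))]
  refine le_trans ?_ (mul_le_mul_of_nonneg_left (le_abs_sd h0 h1 hm1 hD) (by positivity))
  have e : 2 * Kell k / π / (1 - Real.exp (-tauK k)) *
      (Real.exp (m * tauK k * (1 - D)) * (Real.exp (m * tauK k) * |hm k m l 0|)) *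
      (Real.exp (m * tauK k * D) * (1 - Real.exp (-tauK k))) =
      2 * Kell k / π * Real.exp (2 * (m * tauK k)) * |hm k m l 0| := by
    rw [show 2 * (m * tauK k) = m * tauK k * (1 - D) + m * tauK k + m * tauK k * D by ring,
      Real.exp_add, Real.exp_add]
    field_simp
  rw [e]
  gcongr

/-- The flux of the harmonic functions through an axis. -/
lemma hm_flux (h0 : 0 < k) (h1 : k < 1) {m : ℕ} (hm1 : 1 ≤ m) (x : ℕ) :
    k / 4 * ((hm k m (x + 2) (-1) - hm k m (x + 2) 1) + (hm k m x (-1) - hm k m x 1)) =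
      π * m / (2 * Kell k * (x + 1)) * hm k m (x + 1) 0 := by
  have hu := continuous_uf h0 h1
  have hX := continuous_Xf h0 h1
  have hr := continuous_rf h0 h1
  have hK := Kell_pos h0 h1
  have hpi := Real.pi_pos
  have hmr : (0 : ℝ) < m := by exact_mod_cast hm1
  have c := fun x y => (continuous_hm_integrand h0 h1 m x y).intervalIntegrable
    (μ := MeasureTheory.volume) 0 π
  rw [hm_axis_parts h0 h1 hm1]
  simp only [hm]
  rw [← mul_sub, ← mul_sub, ← mul_add, ← intervalIntegral.integral_sub (c _ _) (c _ _),
    ← intervalIntegral.integral_sub (c _ _) (c _ _), ← intervalIntegral.integral_add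
    ((c _ _).sub (c _ _)) ((c _ _).sub (c _ _)), ← mul_assoc,
    ← intervalIntegral.integral_const_mul]
  have e0 : ∀ A : ℝ, π * m / (2 * Kell k * (x + 1)) * -(1 / (π * m) * A) =
      -(1 / (2 * Kell k * (x + 1))) * A := fun A => by field_simp
  rw [e0, ← intervalIntegral.integral_const_mul]
  refine intervalIntegral.integral_congr fun φ _ => ?_
  have hw := wf_pos h0 h1 φ
  have hX2 : Xf k φ ^ 2 * (1 + wf k φ) = 1 - wf k φ := by
    rw [Xf_sq h0 h1]; field_simp
  push_cast
  simp only [neg_mul, one_mul, Real.cos_add, Real.cos_neg, Real.sin_neg]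
  rw [rf, dXf]
  field_simp
  have e : Xf k φ ^ (x + 2) = Xf k φ ^ x * Xf k φ ^ 2 := pow_add _ _ _
  rw [e]
  linear_combination (2 * Real.sin φ * Xf k φ ^ x * Real.sin (m * uf k φ)) * hX2

end green

section green

variable {k : ℝ} {v : ℂ → ℂ} {a : ℕ → ℕ → ℝ}

/-- The `m`-th mode of the Green function. -/
def greenTerm (k : ℝ) (jm jp ja : ℤ) (l m : ℕ) (c x y : ℤ) : ℝ :=
  jumpCoeff k l (jp - jm) m *
    if c < ja ∨ c = ja ∧ y < 0 then sd k m (ja - jp) * Ef k m (c - jm) x.toNat y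
    else sd k m (ja - jm) * Ef k m (c - jp) x.toNat y

variable {jm jp ja : ℤ} {l : ℕ}

lemma IsCoeff.abs_greenTerm_le (h0 : 0 < k) (h1 : k < 1) (hv : IsVmap (kLanden k) v)
    (ha : IsCoeff (kLanden k) v a) (hl : 1 ≤ l) (hjm : jm < 0) (hja : 0 ≤ ja) (hjp : ja < jp)
    {m : ℕ} (hm1 : 1 ≤ m) {c x y : ℤ} (hc : jm ≤ c) (hc2 : c < jp) (hy : 0 ≤ y) :
    |greenTerm k jm jp ja l m c x y| ≤ 2 * Kell k / π / (1 - Real.exp (-tauK k)) * 2 *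
      |hm k (-m) 0 l| := by
  have hτ := tauK_pos h0 h1
  have hK := Kell_pos h0 h1
  have hpi := Real.pi_pos
  have hq : 0 < 1 - Real.exp (-tauK k) := by
    rw [sub_pos, Real.exp_lt_one_iff]; linarith
  have key : ∀ (d e : ℤ) (n : ℕ) (z : ℤ), |d| + |e| ≤ jp - jm - 1 →
      |sd k m d * Ef k m e n z| ≤ 2 * Real.exp (m * tauK k * (jp - jm - 1)) := by
    intro d e n z hde
    rw [abs_mul]
    refine (mul_le_mul (abs_sd_le h0 h1 m d) (abs_Ef_le h0 h1 m e n z) (abs_nonneg _)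
      (Real.exp_pos _).le).trans ?_
    rw [mul_left_comm, ← Real.exp_add, ← mul_add]
    gcongr
    exact_mod_cast hde
  have hJ := ha.abs_jumpCoeff_le h0 h1 hv hl hm1 (D := jp - jm) (by omega)
  have hB : |if c < ja ∨ c = ja ∧ y < 0 then sd k m (ja - jp) * Ef k m (c - jm) x.toNat y
    else sd k m (ja - jm) * Ef k m (c - jp) x.toNat y| ≤
      2 * Real.exp (m * tauK k * (jp - jm - 1)) := by
    split_ifs with h
    · refine key _ _ _ _ ?_
      rw [abs_of_nonpos (by omega), abs_of_nonneg (by omega)]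
      omega
    · have hr := ha.Ef_rotate h0 h1 hv hm1 (c - jp + 1) y.toNat x.toNat
      rw [Int.toNat_of_nonneg hy, add_sub_cancel_right] at hr
      rw [← hr]
      refine key _ _ _ _ ?_
      rw [abs_of_nonneg (by omega), abs_of_nonpos (by omega)]
      omega
  rw [greenTerm, abs_mul]
  refine (mul_le_mul hJ hB (abs_nonneg _) (by positivity)).trans (le_of_eq ?_)
  have e : Real.exp (m * tauK k * (1 - (jp - jm : ℤ))) * Real.exp (m * tauK k * (jp - jm - 1)) =
      1 := by
    rw [← Real.exp_add, Real.exp_eq_one_iff]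
    push_cast
    ring
  linear_combination (2 * Kell k / π / (1 - Real.exp (-tauK k)) * 2 * |hm k (-m) 0 l|) * e

lemma greenTerm_zero (h0 : 0 < k) (h1 : k < 1) {m : ℕ} (hm1 : 1 ≤ m) (c : ℤ) :
    greenTerm k jm jp ja l m c 0 0 = 0 := by
  simp [greenTerm, Ef_zero_zero h0 h1 hm1]

lemma IsCoeff.greenTerm_up (h0 : 0 < k) (h1 : k < 1) (hv : IsVmap (kLanden k) v)
    (ha : IsCoeff (kLanden k) v a) {m : ℕ} (hm1 : 1 ≤ m) (c : ℤ) {y : ℤ} (hy : 1 ≤ y) :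
    greenTerm k jm jp ja l m c 0 y = greenTerm k jm jp ja l m (c + 1) y 0 := by
  have hr : ∀ d, Ef k m (d + 1) y.toNat 0 = Ef k m d 0 y := by
    intro d
    have hr := ha.Ef_rotate h0 h1 hv hm1 (d + 1) y.toNat 0
    rw [Nat.cast_zero, neg_zero, Int.toNat_of_nonneg (by omega), add_sub_cancel_right] at hr
    exact hr
  simp only [greenTerm, Int.toNat_zero]
  rw [← hr, ← hr, show c - jm + 1 = c + 1 - jm by ring, show c - jp + 1 = c + 1 - jp by ring]
  congr 1
  by_cases h2 : c + 1 = ja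
  · rw [if_pos (by omega), if_neg (by omega), h2, Ef_axis, Ef_axis]
    ring
  · by_cases h3 : c < ja
    · rw [if_pos (by omega), if_pos (by omega)]
    · rw [if_neg (by omega), if_neg (by omega)]

lemma IsCoeff.greenTerm_down (h0 : 0 < k) (h1 : k < 1) (hv : IsVmap (kLanden k) v)
    (ha : IsCoeff (kLanden k) v a) {m : ℕ} (hm1 : 1 ≤ m) (c : ℤ) {x : ℤ} (hx : 0 ≤ x) :
    greenTerm k jm jp ja l m c x (-1) = greenTerm k jm jp ja l m (c - 1) 1 x := by
  have hr : ∀ d, Ef k m d x.toNat (-1) = Ef k m (d - 1) 1 x := by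
    intro d
    have hr := ha.Ef_rotate h0 h1 hv hm1 d x.toNat 1
    rwa [Int.toNat_of_nonneg hx] at hr
  simp only [greenTerm, Int.toNat_one]
  rw [hr, hr, show c - jm - 1 = c - 1 - jm by ring, show c - jp - 1 = c - 1 - jp by ring]
  congr 1
  by_cases h3 : c ≤ ja
  · rw [if_pos (by omega), if_pos (by omega)]
  · rw [if_neg (by omega), if_neg (by omega)]

lemma greenTerm_left (hjm : jm < ja) (m : ℕ) (x : ℤ) :
    greenTerm k jm jp ja l m jm x 0 = 0 := by
  rw [greenTerm, if_pos (by omega), Ef_axis, sub_self, sd_zero]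
  ring

lemma greenTerm_right (hjp : ja < jp) (m : ℕ) (x : ℤ) :
    greenTerm k jm jp ja l m jp x 0 = 0 := by
  rw [greenTerm, if_neg (by omega), Ef_axis, sub_self, sd_zero]
  ring

lemma Ef_rec_toNat (h0 : 0 < k) (h1 : k < 1) (m : ℕ) (d : ℤ) {x : ℤ} (hx : 1 ≤ x) (y : ℤ) :
    Ef k m d x.toNat y = k / 4 * (Ef k m d (x + 1).toNat (y + 1) +
      (Ef k m d (x + 1).toNat (y - 1) + (Ef k m d (x - 1).toNat (y - 1) +
        Ef k m d (x - 1).toNat (y + 1)))) := by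
  obtain ⟨n, rfl⟩ : ∃ n : ℕ, x = n + 1 := ⟨(x - 1).toNat, by omega⟩
  have := Ef_rec h0 h1 m d n y
  rw [show ((n : ℤ) + 1).toNat = n + 1 by omega, show ((n : ℤ) + 1 + 1).toNat = n + 2 by omega,
    show ((n : ℤ) + 1 - 1).toNat = n by omega]
  exact this

lemma greenTerm_inner (h0 : 0 < k) (h1 : k < 1) (m : ℕ) (c : ℤ) {x y : ℤ}
    (hx : 1 ≤ x) (h : c ≠ ja ∨ 1 ≤ y) :
    greenTerm k jm jp ja l m c x y = k / 4 * (greenTerm k jm jp ja l m c (x + 1) (y + 1) +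
      (greenTerm k jm jp ja l m c (x + 1) (y - 1) + (greenTerm k jm jp ja l m c (x - 1) (y - 1) +
        greenTerm k jm jp ja l m c (x - 1) (y + 1)))) := by
  simp only [greenTerm]
  by_cases h3 : c < ja
  · simp only [if_pos (Or.inl h3)]
    rw [Ef_rec_toNat h0 h1 m _ hx]
    ring
  · rw [if_neg (by omega), if_neg (by omega), if_neg (by omega), if_neg (by omega),
      if_neg (by omega), Ef_rec_toNat h0 h1 m _ hx]
    ring

lemma sd_mul_sub (m : ℕ) (d e : ℤ) (x : ℕ) (y : ℤ) :
    sd k m d * Ef k m e x y - sd k m e * Ef k m d x y =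
      sd k m (d - e) * (hm k m x y - hm k m x (-y)) := by
  simp only [sd, Ef, hm_neg]
  have e1 : Real.exp (-(m * tauK k * (d - e : ℤ))) =
      Real.exp (-(m * tauK k * d)) * Real.exp (m * tauK k * e) := by
    rw [← Real.exp_add]; congr 1; push_cast; ring
  have e2 : Real.exp (m * tauK k * (d - e : ℤ)) =
      Real.exp (m * tauK k * d) * Real.exp (-(m * tauK k * e)) := by
    rw [← Real.exp_add]; congr 1; push_cast; ring
  have e3 : Real.exp (m * tauK k * d) * Real.exp (-(m * tauK k * d)) = 1 := by
    rw [← Real.exp_add]; simp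
  have e4 : Real.exp (m * tauK k * e) * Real.exp (-(m * tauK k * e)) = 1 := by
    rw [← Real.exp_add]; simp
  rw [e1, e2]
  ring

lemma greenTerm_source (h0 : 0 < k) (h1 : k < 1) {m : ℕ} (hm1 : 1 ≤ m) (hD : jm < jp) {x : ℤ}
    (hx : 1 ≤ x) :
    greenTerm k jm jp ja l m ja x 0 = ((x : ℝ)⁻¹ *
      (m * (2 * Real.sinh (2 * (m * tauK k))) * (hm k m x.toNat 0 * hm k m l 0))) +
      k / 4 * (greenTerm k jm jp ja l m ja (x + 1) 1 +
      (greenTerm k jm jp ja l m ja (x + 1) (-1) + (greenTerm k jm jp ja l m ja (x - 1) (-1) +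
        greenTerm k jm jp ja l m ja (x - 1) 1))) := by
  have hK := Kell_pos h0 h1
  have hpi := Real.pi_pos
  have hτ := tauK_pos h0 h1
  have hr := Ef_rec_toNat h0 h1 m (ja - jp) hx 0
  have hxr : (0 : ℝ) < x := by exact_mod_cast hx
  obtain ⟨n, rfl⟩ : ∃ n : ℕ, x = n + 1 := ⟨(x - 1).toNat, by omega⟩
  have hf := hm_flux h0 h1 hm1 n
  have hs : sd k m (jp - jm) ≠ 0 := by
    have := le_abs_sd h0 h1 hm1 (d := jp - jm) (by omega)
    have hq : 0 < 1 - Real.exp (-tauK k) := by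
      rw [sub_pos, Real.exp_lt_one_iff]; linarith
    exact abs_pos.1 (lt_of_lt_of_le (by positivity) this)
  have s1 := sd_mul_sub (k := k) m (ja - jm) (ja - jp) (n + 2) (-1)
  have s2 := sd_mul_sub (k := k) m (ja - jm) (ja - jp) n (-1)
  rw [show ja - jm - (ja - jp) = jp - jm by ring, neg_neg] at s1 s2
  rw [show ((n : ℤ) + 1).toNat = n + 1 by omega, show ((n : ℤ) + 1 + 1).toNat = n + 2 by omega,
    show ((n : ℤ) + 1 - 1).toNat = n by omega, zero_add, zero_sub] at hr
  simp only [greenTerm, show ((n : ℤ) + 1).toNat = n + 1 by omega,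
    show ((n : ℤ) + 1 + 1).toNat = n + 2 by omega, show ((n : ℤ) + 1 - 1).toNat = n by omega]
  simp only [lt_irrefl, true_and, false_or, if_true, if_false, show ¬(1 : ℤ) < 0 by omega,
    show (-1 : ℤ) < 0 by omega, hr]
  push_cast at hxr ⊢
  have hj : jumpCoeff k l (jp - jm) m * sd k m (jp - jm) =
      2 * Kell k / π * (2 * Real.sinh (2 * (m * tauK k))) * hm k m l 0 := by
    rw [jumpCoeff, div_mul_cancel₀ _ hs]
  have hmr : (0 : ℝ) < m := by exact_mod_cast hm1
  have e : ((n : ℝ) + 1)⁻¹ * (m * (2 * Real.sinh (2 * (m * tauK k))) *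
      (hm k m (n + 1) 0 * hm k m l 0)) = jumpCoeff k l (jp - jm) m * sd k m (jp - jm) *
      (π * m / (2 * Kell k * (n + 1)) * hm k m (n + 1) 0) := by
    rw [hj]
    field_simp
  rw [e, ← hf]
  linear_combination (jumpCoeff k l (jp - jm) m * (k / 4)) * (s1 + s2)

lemma summable_hm_neg_succ (h0 : 0 < k) (h1 : k < 1) (n : ℤ) :
    Summable fun m : ℕ => |hm k (-(m + 1 : ℕ)) 0 n| := by
  refine (summable_hm_zero h0 h1 n).comp_injective (i := fun m : ℕ => -((m + 1 : ℕ) : ℤ)) ?_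
  intro i j hij
  simpa using hij

lemma IsCoeff.summable_greenTerm (h0 : 0 < k) (h1 : k < 1) (hv : IsVmap (kLanden k) v)
    (ha : IsCoeff (kLanden k) v a) (hl : 1 ≤ l) (hjm : jm < 0) (hja : 0 ≤ ja) (hjp : ja < jp)
    {c x y : ℤ} (hc : jm ≤ c) (hc2 : c < jp) (hy : 0 ≤ y) :
    Summable fun m : ℕ => greenTerm k jm jp ja l (m + 1) c x y :=
  Summable.of_norm_bounded ((summable_hm_neg_succ h0 h1 l).mul_left _) fun m =>
    ha.abs_greenTerm_le h0 h1 hv hl hjm hja hjp (by omega) hc hc2 hy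

/-- The Green function solves the chart equations. -/
lemma IsCoeff.isChartGreen (h0 : 0 < k) (h1 : k < 1) (hv : IsVmap (kLanden k) v)
    (ha : IsCoeff (kLanden k) v a) (hl : 1 ≤ l) (hjm : jm < 0) (hja : 0 ≤ ja) (hjp : ja < jp) :
    ∃ B, IsChartGreen (k / 4) jm jp ja l B
      fun c x y => ∑' m : ℕ, greenTerm k jm jp ja l (m + 1) c x y := by
  set b : ℕ → ℝ := fun m => 2 * Kell k / π / (1 - Real.exp (-tauK k)) * 2 *
      |hm k (-(m + 1 : ℕ)) 0 l| with hb
  have hbs : Summable b := (summable_hm_neg_succ h0 h1 l).mul_left _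
  have hle : ∀ (m : ℕ) {c x y : ℤ}, jm ≤ c → c < jp → 0 ≤ y →
      |greenTerm k jm jp ja l (m + 1) c x y| ≤ b m := fun m c x y hc hc2 hy =>
    ha.abs_greenTerm_le h0 h1 hv hl hjm hja hjp (by omega) hc hc2 hy
  have hsum : ∀ {c x y : ℤ}, jm ≤ c → c < jp → 0 ≤ y →
      Summable fun m => greenTerm k jm jp ja l (m + 1) c x y := fun hc hc2 hy =>
    ha.summable_greenTerm h0 h1 hv hl hjm hja hjp hc hc2 hy
  have hsum' : ∀ {c x : ℤ}, jm < c → c < jp → 0 ≤ x →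
      Summable fun m => greenTerm k jm jp ja l (m + 1) c x (-1) := fun {c x} hc hc2 hx => by
    simp_rw [fun m : ℕ => ha.greenTerm_down (jm := jm) (jp := jp) (ja := ja) (l := l) h0 h1 hv
      (show 1 ≤ m + 1 by omega) c hx]
    exact hsum (by omega) (by omega) hx
  refine ⟨∑' m, b m, ?_, ?_, ?_, ?_, ?_, ?_, ?_, ?_⟩
  · intro c
    simp_rw [fun m : ℕ => greenTerm_zero (jm := jm) (jp := jp) (ja := ja) (l := l) h0 h1
      (show 1 ≤ m + 1 by omega) c]
    exact tsum_zero
  · intro c y _ _ hy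
    exact tsum_congr fun m => ha.greenTerm_up h0 h1 hv (by omega) c hy
  · intro c x _ _ hx
    exact tsum_congr fun m => ha.greenTerm_down h0 h1 hv (by omega) c hx
  · intro x _
    simp_rw [fun m : ℕ => greenTerm_left (k := k) (jp := jp) (l := l) (show jm < ja by omega)
      (m + 1) x]
    exact tsum_zero
  · intro x _
    simp_rw [fun m : ℕ => greenTerm_right (k := k) (jm := jm) (l := l) hjp (m + 1) x]
    exact tsum_zero
  · intro c x y hc hc2 _ hy
    exact tsum_of_norm_bounded (f := fun m => greenTerm k jm jp ja l (m + 1) c x y) hbs.hasSum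
      fun m => hle m hc hc2 hy
  · intro c x hc hc2 hx
    have t1 := (hsum (x := x + 1) (y := 1) hc.le hc2 zero_le_one).hasSum
    have t2 := (hsum' (x := x + 1) hc hc2 (by omega)).hasSum
    have t3 := (hsum' (x := x - 1) hc hc2 (by omega)).hasSum
    have t4 := (hsum (x := x - 1) (y := 1) hc.le hc2 zero_le_one).hasSum
    have tt := (t1.add (t2.add (t3.add t4))).mul_left (k / 4)
    split_ifs with h
    · obtain ⟨rfl, rfl⟩ := h
      have ho := (ha.hasSum_orthogonality h0 h1 hv (x := l) hl hl).mul_left ((l : ℝ)⁻¹)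
      rw [if_pos rfl, inv_mul_cancel₀ (by positivity)] at ho
      refine HasSum.tsum_eq ((ho.add tt).congr_fun fun m => ?_)
      rw [greenTerm_source h0 h1 (by omega) (by omega) hx]
      simp
    · rw [zero_add]
      by_cases hc3 : c = ja
      · subst hc3
        have hxl : x.toNat ≠ l := by omega
        have ho := (ha.hasSum_orthogonality h0 h1 hv (x := x.toNat) (by omega)
          hl).mul_left ((x : ℝ)⁻¹)
        rw [if_neg hxl, mul_zero] at ho
        have := ho.add tt
        rw [zero_add] at this
        refine HasSum.tsum_eq (this.congr_fun fun m => ?_)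
        rw [greenTerm_source h0 h1 (by omega) (by omega) hx]
      · refine HasSum.tsum_eq (tt.congr_fun fun m => ?_)
        rw [greenTerm_inner h0 h1 (m + 1) c hx (Or.inl hc3), zero_add, zero_sub]
  · intro c x y hc hc2 hx hy
    have t1 := (hsum (x := x + 1) (y := y + 1) hc hc2 (by omega)).hasSum
    have t2 := (hsum (x := x + 1) (y := y - 1) hc hc2 (by omega)).hasSum
    have t3 := (hsum (x := x - 1) (y := y - 1) hc hc2 (by omega)).hasSum
    have t4 := (hsum (x := x - 1) (y := y + 1) hc hc2 (by omega)).hasSum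
    refine HasSum.tsum_eq (((t1.add (t2.add (t3.add t4))).mul_left (k / 4)).congr_fun
      fun m => ?_)
    exact greenTerm_inner h0 h1 (m + 1) c hx (Or.inr hy)

end green

section final

variable {k : ℝ}

lemma qNome_rpow (h0 : 0 < k) (h1 : k < 1) (r : ℝ) :
    qNome k ^ r = Real.exp (-(2 * tauK k * r)) := by
  have hK := Kell_pos h0 h1
  rw [qNome, ← Real.exp_mul, tauK, Tell]
  congr 1
  field_simp
  ring

/-- The transfer factor as a quotient of hyperbolic sines. -/
lemma lam_eq (h0 : 0 < k) (h1 : k < 1) {m : ℕ} (hm1 : 1 ≤ m) {ja jm jp : ℤ} (hD : jm < jp) :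
    2 * Kell k / π *
        ((qNome k ^ (2 * (m : ℝ) * (π / 2 * jm) / π) - 1) /
          ((m : ℝ) * qNome k ^ ((m : ℝ) * (π / 2 * ja) / π))) *
        ((qNome k ^ (2 * (m : ℝ) * (π / 2 * ja) / π) -
            qNome k ^ (2 * (m : ℝ) * (π / 2 * jp) / π)) /
          (qNome k ^ (2 * (m : ℝ) * (π / 2 * jm) / π) -
            qNome k ^ (2 * (m : ℝ) * (π / 2 * jp) / π))) =
      2 * Kell k / π / m * (sd k m (-jm) * sd k m (ja - jp) / sd k m (jp - jm)) := by
  have hpi := Real.pi_pos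
  have hτ := tauK_pos h0 h1
  have hmr : (0 : ℝ) < m := by exact_mod_cast hm1
  have hDr : (jm : ℝ) < jp := by exact_mod_cast hD
  have e1 : ∀ j : ℤ, qNome k ^ (2 * (m : ℝ) * (π / 2 * j) / π) =
      1 / Real.exp (m * tauK k * j) ^ 2 := by
    intro j
    rw [qNome_rpow h0 h1, ← Real.exp_nat_mul, one_div, ← Real.exp_neg]
    congr 1
    field_simp
    push_cast
    ring
  have e2 : qNome k ^ ((m : ℝ) * (π / 2 * ja) / π) = 1 / Real.exp (m * tauK k * ja) := by
    rw [qNome_rpow h0 h1, one_div, ← Real.exp_neg]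
    congr 1
    field_simp
  have e3 : ∀ i j : ℤ, sd k m (i - j) = Real.exp (m * tauK k * j) / Real.exp (m * tauK k * i) -
      Real.exp (m * tauK k * i) / Real.exp (m * tauK k * j) := by
    intro i j
    rw [sd, ← Real.exp_sub, ← Real.exp_sub]
    congr 2
    · push_cast; ring
    · push_cast; ring
  have e4 : sd k m (-jm) = Real.exp (m * tauK k * jm) - 1 / Real.exp (m * tauK k * jm) := by
    rw [sd, one_div, ← Real.exp_neg]
    push_cast
    rw [mul_neg, neg_neg]
  have hlt : Real.exp (m * tauK k * jm) < Real.exp (m * tauK k * jp) :=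
    Real.exp_lt_exp.2 (mul_lt_mul_of_pos_left hDr (by positivity))
  rw [e1, e1, e1, e2, e3, e3, e4]
  have pA := Real.exp_pos (m * tauK k * ja)
  have pN := Real.exp_pos (m * tauK k * jm)
  have pP := Real.exp_pos (m * tauK k * jp)
  set A := Real.exp (m * tauK k * ja)
  set N := Real.exp (m * tauK k * jm)
  set P := Real.exp (m * tauK k * jp)
  have hne : P ^ 2 - N ^ 2 ≠ 0 := by
    have := mul_pos (sub_pos.2 hlt) (add_pos pP pN)
    nlinarith
  have d1 : 1 / N ^ 2 - 1 / P ^ 2 = (P ^ 2 - N ^ 2) / (N ^ 2 * P ^ 2) := by field_simp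
  have d2 : N / P - P / N = -((P ^ 2 - N ^ 2) / (N * P)) := by field_simp; ring
  rw [d1, d2]
  field_simp
  ring

lemma greenTerm_origin {m : ℕ} {ja jm jp : ℤ} (hja : 0 ≤ ja) (l p : ℕ) :
    greenTerm k jm jp ja l m 0 p 0 =
      2 * Kell k / π * (2 * Real.sinh (2 * (m * tauK k))) * (hm k m l 0 * hm k m p 0) *
        (sd k m (-jm) * sd k m (ja - jp) / sd k m (jp - jm)) := by
  rw [greenTerm, jumpCoeff, Int.toNat_natCast, Ef_axis, Ef_axis, zero_sub, zero_sub]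
  split_ifs with h
  · ring
  · have : ja = 0 := by omega
    subst this
    rw [zero_sub, zero_sub]
    ring

end final

/-- Theorem 1(ii), row 3: for `t ∈ (0,1/4)`, `k = 4t`, `α, β₋, β₊ ∈ (π/2)ℤ` with
`β₋ < 0 ≤ α < β₊`, and `l,p ≥ 1`, the sum over walks defining `W^{(α,(β₋,β₊))}_{l,p}(t)`
converges and equals `Σ_{m≥1} λ_m · 4 l p a_{l,m} a_{p,m} / (m (q^{-m} - q^m))`, where
`λ_m = (2K(k)/π) (q^{2mβ₋/π} - 1)/(m q^{mα/π}) · (q^{2mα/π} - q^{2mβ₊/π})/(q^{2mβ₋/π} - q^{2mβ₊/π})`,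
the series converging absolutely. -/
theorem statement1 (t : ℝ) (ht : t ∈ Set.Ioo (0 : ℝ) (1 / 4)) (k : ℝ) (hk : k = 4 * t)
    (v : ℂ → ℂ) (hv : IsVmap (kLanden k) v)
    (a : ℕ → ℕ → ℝ) (ha : IsCoeff (kLanden k) v a)
    (ja jm jp : ℤ) (α βm βp : ℝ)
    (hα : α = π / 2 * ja) (hβm : βm = π / 2 * jm) (hβp : βp = π / 2 * jp)
    (hord : βm < 0 ∧ 0 ≤ α ∧ α < βp)
    (l p : ℕ) (hl : 1 ≤ l) (hp : 1 ≤ p)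
    (lam : ℕ → ℝ)
    (hlam : ∀ m : ℕ, lam m = 2 * Kell k / π *
        ((qNome k ^ (2 * (m : ℝ) * βm / π) - 1) / ((m : ℝ) * qNome k ^ ((m : ℝ) * α / π))) *
        ((qNome k ^ (2 * (m : ℝ) * α / π) - qNome k ^ (2 * (m : ℝ) * βp / π)) /
          (qNome k ^ (2 * (m : ℝ) * βm / π) - qNome k ^ (2 * (m : ℝ) * βp / π)))) :
    Summable (fun w : {w : List (ℤ × ℤ) // WCond l p α (Set.Ioo βm βp) w} =>
        t ^ (w.val.length - 1)) ∧
    Summable (fun m : ℕ => lam (m + 1) * (4 * l * p * a l (m + 1) * a p (m + 1)) /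
        (((m : ℝ) + 1) * (qNome k ^ (-((m : ℝ) + 1)) - qNome k ^ ((m : ℝ) + 1)))) ∧
    Wgen t l p α (Set.Ioo βm βp) =
      ∑' m : ℕ, lam (m + 1) * (4 * l * p * a l (m + 1) * a p (m + 1)) /
        (((m : ℝ) + 1) * (qNome k ^ (-((m : ℝ) + 1)) - qNome k ^ ((m : ℝ) + 1))) := by
  subst hk hα hβm hβp
  obtain ⟨o1, o2, o3⟩ := hord
  have hpi := Real.pi_pos
  have hjm : jm < 0 := by
    by_contra h
    have : (0 : ℝ) ≤ jm := by exact_mod_cast not_lt.1 h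
    exact absurd o1 (not_lt.2 (by positivity))
  have hja : 0 ≤ ja := by
    by_contra h
    have : (ja : ℝ) < 0 := by exact_mod_cast not_le.1 h
    exact absurd o2 (not_le.2 (mul_neg_of_pos_of_neg (by positivity) this))
  have hjp : ja < jp := by
    have := lt_of_mul_lt_mul_left o3 (by positivity)
    exact_mod_cast this
  have h0 : 0 < 4 * t := by linarith [ht.1]
  have h1 : 4 * t < 1 := by linarith [ht.2]
  have hterm : ∀ m : ℕ, lam (m + 1) * (4 * l * p * a l (m + 1) * a p (m + 1)) /
        (((m : ℝ) + 1) * (qNome (4 * t) ^ (-((m : ℝ) + 1)) - qNome (4 * t) ^ ((m : ℝ) + 1))) =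
      greenTerm (4 * t) jm jp ja l (m + 1) 0 p 0 := by
    intro m
    have hτ := tauK_pos h0 h1
    rw [hlam, lam_eq h0 h1 (by omega) (by omega), greenTerm_origin hja,
      ha.hm_axis h0 h1 hv (by omega) hl, ha.hm_axis h0 h1 hv (by omega) hp,
      qNome_rpow h0 h1, qNome_rpow h0 h1]
    have hs : 0 < Real.sinh (2 * ((m + 1 : ℕ) * tauK (4 * t))) :=
      Real.sinh_pos_iff.2 (by positivity)
    have hd : Real.exp (-(2 * tauK (4 * t) * -((m : ℝ) + 1))) -
        Real.exp (-(2 * tauK (4 * t) * ((m : ℝ) + 1))) =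
        2 * Real.sinh (2 * ((m + 1 : ℕ) * tauK (4 * t))) := by
      rw [Real.sinh_eq]
      push_cast
      rw [show -(2 * tauK (4 * t) * -((m : ℝ) + 1)) = 2 * (((m : ℝ) + 1) * tauK (4 * t)) by ring,
        show -(2 * tauK (4 * t) * ((m : ℝ) + 1)) = -(2 * (((m : ℝ) + 1) * tauK (4 * t))) by ring]
      ring
    have hsg : ((-1 : ℝ) ^ (m + 1)) * (-1) ^ (m + 1) = 1 := by rw [← mul_pow]; simp
    have hmr : (0 : ℝ) < (m + 1 : ℕ) := by positivity
    rw [hd, show (m : ℝ) + 1 = (m + 1 : ℕ) by push_cast; rfl]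
    set σ := Real.sinh (2 * ((m + 1 : ℕ) * tauK (4 * t)))
    set R := sd (4 * t) (m + 1) (-jm) * sd (4 * t) (m + 1) (ja - jp) / sd (4 * t) (m + 1) (jp - jm)
    set g := (-1 : ℝ) ^ (m + 1)
    set M : ℝ := ((m + 1 : ℕ) : ℝ)
    rw [show g * (l * a l (m + 1) / (M * σ)) * (g * (p * a p (m + 1) / (M * σ))) =
      g * g * ((l * a l (m + 1) / (M * σ)) * (p * a p (m + 1) / (M * σ))) by ring, hsg]
    field_simp
    ring
  obtain ⟨B, hB⟩ := ha.isChartGreen h0 h1 hv hl hjm hja hjp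
  rw [show 4 * t / 4 = t by ring] at hB
  have hW := hB.hasSum ht.1.le ht.2 hjm hja hjp p hp
  refine ⟨hW.summable, ?_, ?_⟩
  · simp_rw [hterm]
    exact ha.summable_greenTerm h0 h1 hv hl hjm hja hjp hjm.le (by omega) le_rfl
  · simp_rw [hterm]
    exact hW.tsum_eq

end
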